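/- The left ℍ-module K(B, ℍ), equipped with the supremum norm, has a Schauder basis over the quaternion skew field: there exists a sequence (w_m)_{m∈ℕ} in K(B, ℍ) such that for every h ∈ K(B, ℍ) there exists a unique sequence of quaternion coefficients (a_m)_{m∈ℕ}, a_m ∈ ℍ, with lim_{N→∞} ‖h − ∑_{m=0}^{N} a_m·w_m‖ = 0 in the supremum norm, where a_m·w_m denotes the pointwise left multiple z ↦ a_m·w_m(z). -/

import Mathlib

open MeasureTheory Metric
open scoped Quaternion

/-- The standard basis `1, i₁, i₂, i₃` of the quaternions over ℝ. -/
noncomputable def qe : Fin 4 → ℍ[ℝ]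
  | 0 => ⟨1, 0, 0, 0⟩
  | 1 => ⟨0, 1, 0, 0⟩
  | 2 => ⟨0, 0, 1, 0⟩
  | 3 => ⟨0, 0, 0, 1⟩

/-- The Dirac operator `σf(z) = ∑ⱼ (∂f/∂zⱼ)(z)·iⱼ` (with `i₀ = 1`), where `∂/∂zⱼ` is
the partial derivative in the `j`-th real coordinate direction of `ℍ ≅ ℝ⁴`. -/
noncomputable def Dirac (f : ℍ[ℝ] → ℍ[ℝ]) (z : ℍ[ℝ]) : ℍ[ℝ] :=
  ∑ j : Fin 4, fderiv ℝ f z (qe j) * qe j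

/-- The adjoint Dirac operator `σ*f(z) = ∑ⱼ (∂f/∂zⱼ)(z)·iⱼ*`. -/
noncomputable def DiracStar (f : ℍ[ℝ] → ℍ[ℝ]) (z : ℍ[ℝ]) : ℍ[ℝ] :=
  ∑ j : Fin 4, fderiv ℝ f z (qe j) * star (qe j)

/-- The Laplace operator `Δf(z) = ∑ⱼ ∂²f/∂zⱼ²(z)` in the four real coordinates of `ℍ ≅ ℝ⁴`. -/
noncomputable def qLap (f : ℍ[ℝ] → ℍ[ℝ]) (z : ℍ[ℝ]) : ℍ[ℝ] :=
  ∑ j : Fin 4, fderiv ℝ (fun w => fderiv ℝ f w (qe j)) z (qe j)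

/-- Membership in the Dirac module `K(B, ℍ)`: continuous on `B̄`, continuously
ℝ-differentiable on `B`, annihilated by the Dirac operator on `B`. -/
def memK (f : ℍ[ℝ] → ℍ[ℝ]) : Prop :=
  ContinuousOn f (closedBall 0 1) ∧ ContDiffOn ℝ 1 f (ball 0 1) ∧
    ∀ z ∈ ball (0 : ℍ[ℝ]) 1, Dirac f z = 0

set_option linter.unusedSectionVars false
set_option synthInstance.maxHeartbeats 200000

noncomputable section

instance quaternionMeasurableSpace : MeasurableSpace ℍ[ℝ] := borel _
instance quaternionBorelSpace : BorelSpace ℍ[ℝ] := ⟨rfl⟩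

/-- The unit sphere of the quaternions. -/
abbrev USphere : Type := sphere (0 : ℍ[ℝ]) 1

/-- The rotation-invariant probability measure on the unit sphere. -/
def sphMeas : Measure USphere :=
  ((volume : Measure ℍ[ℝ]).toSphere Set.univ)⁻¹ • (volume : Measure ℍ[ℝ]).toSphere

instance : IsProbabilityMeasure sphMeas := by
  constructor
  rw [sphMeas, Measure.smul_apply, smul_eq_mul]
  apply ENNReal.inv_mul_cancel
  · rw [Ne, Measure.measure_univ_eq_zero]
    exact Measure.toSphere_ne_zero _
  · exact measure_ne_top _ _

lemma USphere.norm_eq (y : USphere) : ‖(y : ℍ[ℝ])‖ = 1 := by simp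

lemma USphere.mul_star (y : USphere) : (y : ℍ[ℝ]) * star (y : ℍ[ℝ]) = 1 := by
  rw [Quaternion.self_mul_star, Quaternion.normSq_eq_norm_mul_self]; simp

lemma USphere.star_mul (y : USphere) : star (y : ℍ[ℝ]) * (y : ℍ[ℝ]) = 1 := by
  rw [Quaternion.star_mul_self, Quaternion.normSq_eq_norm_mul_self]; simp

/-- The restriction of a linear isometry to the sphere. -/
def sphIso (φ : ℍ[ℝ] ≃ₗᵢ[ℝ] ℍ[ℝ]) : USphere ≃ₜ USphere where
  toFun y := ⟨φ y, by simp⟩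
  invFun y := ⟨φ.symm y, by simp⟩
  left_inv y := Subtype.ext (φ.symm_apply_apply _)
  right_inv y := Subtype.ext (φ.apply_symm_apply _)
  continuous_toFun := by fun_prop
  continuous_invFun := by fun_prop

lemma sphIso_coe (φ : ℍ[ℝ] ≃ₗᵢ[ℝ] ℍ[ℝ]) (y : USphere) : (sphIso φ y : ℍ[ℝ]) = φ y := rfl

lemma sphIso_measurePreserving (φ : ℍ[ℝ] ≃ₗᵢ[ℝ] ℍ[ℝ]) :
    MeasurePreserving (sphIso φ) sphMeas sphMeas := by
  have h : MeasurePreserving (sphIso φ) (volume : Measure ℍ[ℝ]).toSphere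
      (volume : Measure ℍ[ℝ]).toSphere := by
    refine ⟨(sphIso φ).continuous.measurable, ?_⟩
    ext s hs
    rw [Measure.map_apply (sphIso φ).continuous.measurable hs, Measure.toSphere_apply' _ hs,
      Measure.toSphere_apply' _ ((sphIso φ).continuous.measurable hs)]
    congr 1
    rw [← φ.symm.measurePreserving.measure_preimage_equiv (f := φ.symm.toMeasurableEquiv)]
    congr 1
    ext z
    simp only [Set.mem_smul, Set.mem_image, Set.mem_preimage]
    constructor
    · rintro ⟨r, hr, _, ⟨y, hy, rfl⟩, h⟩
      refine ⟨r, hr, _, ⟨sphIso φ y, hy, rfl⟩, ?_⟩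
      change _ = φ.symm z at h
      rw [sphIso_coe, ← map_smul, h, φ.apply_symm_apply]
    · rintro ⟨r, hr, _, ⟨y, hy, rfl⟩, rfl⟩
      refine ⟨r, hr, _, ⟨(sphIso φ).symm y, ?_, rfl⟩, (φ.symm.map_smul r y).symm⟩
      rwa [Homeomorph.apply_symm_apply]
  exact h.smul_measure _

lemma integral_sphIso {F : Type*} [NormedAddCommGroup F] [NormedSpace ℝ F]
    (φ : ℍ[ℝ] ≃ₗᵢ[ℝ] ℍ[ℝ]) (f : USphere → F) :
    ∫ y, f (sphIso φ y) ∂sphMeas = ∫ y, f y ∂sphMeas :=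
  (sphIso_measurePreserving φ).integral_comp (sphIso φ).measurableEmbedding f

/-- Right multiplication by a unit quaternion. -/
def rmul (u : USphere) : ℍ[ℝ] ≃ₗᵢ[ℝ] ℍ[ℝ] where
  toFun y := y * u
  invFun y := y * star (u : ℍ[ℝ])
  map_add' x y := add_mul _ _ _
  map_smul' c x := smul_mul_assoc _ _ _
  left_inv y := by
    change (y * u) * star (u : ℍ[ℝ]) = y
    rw [mul_assoc, u.mul_star, mul_one]
  right_inv y := by
    change (y * star (u : ℍ[ℝ])) * u = y
    rw [mul_assoc, u.star_mul, mul_one]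
  norm_map' y := by simp

lemma rmul_apply (u : USphere) (y : ℍ[ℝ]) : rmul u y = y * u := rfl

/-- The map `y ↦ u ȳ u`, as a linear isometry. -/
def twist (u : USphere) : ℍ[ℝ] ≃ₗᵢ[ℝ] ℍ[ℝ] where
  toLinearEquiv := LinearEquiv.ofInvolutive
    { toFun := fun y => u * star y * u
      map_add' := fun x y => by simp [mul_add, add_mul]
      map_smul' := fun c x => by simp }
    (fun y => by
      simp only [LinearMap.coe_mk, AddHom.coe_mk, StarMul.star_mul, star_star]
      calc (u : ℍ[ℝ]) * (star (u : ℍ[ℝ]) * (y * star (u : ℍ[ℝ]))) * u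
          = (u * star (u : ℍ[ℝ])) * y * (star (u : ℍ[ℝ]) * u) := by noncomm_ring
        _ = y := by rw [u.mul_star, u.star_mul]; simp)
  norm_map' := fun y => by simp [LinearEquiv.ofInvolutive]

lemma twist_apply (u : USphere) (y : ℍ[ℝ]) : twist u y = u * star y * u := rfl

/-- The restriction of `twist u` to the sphere. -/
def twistS (u : USphere) : USphere ≃ₜ USphere := sphIso (twist u)

lemma twistS_coe (u y : USphere) : (twistS u y : ℍ[ℝ]) = u * star (y : ℍ[ℝ]) * u := rfl

lemma twistS_measurePreserving (u : USphere) : MeasurePreserving (twistS u) sphMeas sphMeas :=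
  sphIso_measurePreserving _

lemma integral_twistS {F : Type*} [NormedAddCommGroup F] [NormedSpace ℝ F] (u : USphere)
    (f : USphere → F) : ∫ y, f (twistS u y) ∂sphMeas = ∫ y, f y ∂sphMeas :=
  (twistS_measurePreserving u).integral_comp (twistS u).measurableEmbedding f

instance : One USphere := ⟨⟨1, by simp⟩⟩

lemma USphere.coe_one : ((1 : USphere) : ℍ[ℝ]) = 1 := rfl

/-- Conjugation on the sphere. -/
def cj (y : USphere) : USphere := ⟨star (y : ℍ[ℝ]), by simp⟩

@[simp] lemma cj_coe (y : USphere) : (cj y : ℍ[ℝ]) = star (y : ℍ[ℝ]) := rfl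

@[simp] lemma cj_cj (y : USphere) : cj (cj y) = y := Subtype.ext (star_star _)

lemma cj_eq_twistS (y : USphere) : cj y = twistS 1 y :=
  Subtype.ext (by simp [twistS_coe, USphere.coe_one])

lemma continuous_cj : Continuous cj := by unfold cj; fun_prop

lemma integral_cj {F : Type*} [NormedAddCommGroup F] [NormedSpace ℝ F]
    (f : USphere → F) : ∫ y, f (cj y) ∂sphMeas = ∫ y, f y ∂sphMeas := by
  simp_rw [cj_eq_twistS]; exact integral_twistS 1 f

section Param

variable {H E X : Type*} [NormedAddCommGroup H] [NormedSpace ℝ H] [ProperSpace H]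
  [NormedAddCommGroup E] [NormedSpace ℝ E]
  [TopologicalSpace X] [MeasurableSpace X] [OpensMeasurableSpace X]
  [TopologicalSpace.PseudoMetrizableSpace X] {μ : Measure X} [IsFiniteMeasureOnCompacts μ]
  {K : Set X} {U : Set H}

lemma exists_bound_near (hU : IsOpen U) (hK : IsCompact K) {F : H → X → E}
    (hF : ContinuousOn (Function.uncurry F) (U ×ˢ K)) {x : H} (hx : x ∈ U) :
    ∃ ε > 0, closedBall x ε ⊆ U ∧ ∃ C : ℝ, ∀ z ∈ closedBall x ε, ∀ y ∈ K, ‖F z y‖ ≤ C := by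
  obtain ⟨ε, hε, hεU⟩ := Metric.nhds_basis_closedBall.mem_iff.1 (hU.mem_nhds hx)
  refine ⟨ε, hε, hεU, ?_⟩
  obtain ⟨C, hC⟩ := ((isCompact_closedBall x ε).prod hK).exists_bound_of_continuousOn
    (hF.mono (Set.prod_mono hεU le_rfl))
  exact ⟨C, fun z hz y hy => hC (z, y) ⟨hz, hy⟩⟩

lemma continuousOn_slice {F : H → X → E}
    (hF : ContinuousOn (Function.uncurry F) (U ×ˢ K)) {x : H} (hx : x ∈ U) :
    ContinuousOn (F x) K :=
  hF.comp (f := fun y => (x, y)) (by fun_prop) fun _ hy => ⟨hx, hy⟩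

lemma continuousOn_integral_param (hU : IsOpen U) (hK : IsCompact K) (hKm : MeasurableSet K)
    {F : H → X → E} (hF : ContinuousOn (Function.uncurry F) (U ×ˢ K)) :
    ContinuousOn (fun x => ∫ y in K, F x y ∂μ) U := by
  intro x hx
  obtain ⟨ε, hε, hεU, C, hC⟩ := exists_bound_near hU hK hF hx
  refine ContinuousAt.continuousWithinAt (continuousAt_of_dominated (bound := fun _ => C) ?_ ?_ ?_ ?_)
  · filter_upwards [hU.mem_nhds hx] with z hz
    exact (continuousOn_slice hF hz).aestronglyMeasurable_of_isCompact hK hKm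
  · filter_upwards [closedBall_mem_nhds x hε] with z hz
    exact (ae_restrict_iff' hKm).2 (.of_forall fun y hy => hC z hz y hy)
  · exact integrableOn_const hK.measure_lt_top.ne
  · refine (ae_restrict_iff' hKm).2 (.of_forall fun y hy => ?_)
    have : ContinuousOn (fun z => F z y) U :=
      hF.comp (f := fun z => (z, y)) (by fun_prop) fun _ hz => ⟨hz, hy⟩
    exact this.continuousAt (hU.mem_nhds hx)

lemma hasFDerivAt_integral_param (hU : IsOpen U) (hK : IsCompact K) (hKm : MeasurableSet K)
    {F : H → X → E} {F' : H → X → H →L[ℝ] E}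
    (hF : ContinuousOn (Function.uncurry F) (U ×ˢ K))
    (hF' : ContinuousOn (Function.uncurry F') (U ×ˢ K))
    (hd : ∀ x ∈ U, ∀ y ∈ K, HasFDerivAt (fun z => F z y) (F' x y) x) {x : H} (hx : x ∈ U) :
    HasFDerivAt (fun z => ∫ y in K, F z y ∂μ) (∫ y in K, F' x y ∂μ) x := by
  obtain ⟨ε, hε, hεU, C, hC⟩ := exists_bound_near hU hK hF' hx
  refine hasFDerivAt_integral_of_dominated_of_fderiv_le (bound := fun _ => C)
    (closedBall_mem_nhds x hε) ?_ ?_ ?_ ?_ ?_ ?_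
  · filter_upwards [hU.mem_nhds hx] with z hz
    exact (continuousOn_slice hF hz).aestronglyMeasurable_of_isCompact hK hKm
  · exact (continuousOn_slice hF hx).integrableOn_compact' hK hKm
  · exact (continuousOn_slice hF' hx).aestronglyMeasurable_of_isCompact hK hKm
  · exact (ae_restrict_iff' hKm).2 (.of_forall fun y hy z hz => hC z hz y hy)
  · exact integrableOn_const hK.measure_lt_top.ne
  · exact (ae_restrict_iff' hKm).2 (.of_forall fun y hy z hz => hd z (hεU hz) y hy)

lemma hasDerivAt_integral_param {U : Set ℝ} (hU : IsOpen U) (hK : IsCompact K)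
    (hKm : MeasurableSet K) {F F' : ℝ → X → E}
    (hF : ContinuousOn (Function.uncurry F) (U ×ˢ K))
    (hF' : ContinuousOn (Function.uncurry F') (U ×ˢ K))
    (hd : ∀ t ∈ U, ∀ y ∈ K, HasDerivAt (fun s => F s y) (F' t y) t) {t : ℝ} (ht : t ∈ U) :
    HasDerivAt (fun s => ∫ y in K, F s y ∂μ) (∫ y in K, F' t y ∂μ) t := by
  obtain ⟨ε, hε, hεU, C, hC⟩ := exists_bound_near hU hK hF' ht
  refine (hasDerivAt_integral_of_dominated_loc_of_deriv_le (bound := fun _ => C)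
    (closedBall_mem_nhds t hε) ?_ ?_ ?_ ?_ ?_ ?_).2
  · filter_upwards [hU.mem_nhds ht] with z hz
    exact (continuousOn_slice hF hz).aestronglyMeasurable_of_isCompact hK hKm
  · exact (continuousOn_slice hF ht).integrableOn_compact' hK hKm
  · exact (continuousOn_slice hF' ht).aestronglyMeasurable_of_isCompact hK hKm
  · exact (ae_restrict_iff' hKm).2 (.of_forall fun y hy z hz => hC z hz y hy)
  · exact integrableOn_const hK.measure_lt_top.ne
  · exact (ae_restrict_iff' hKm).2 (.of_forall fun y hy z hz => hd z (hεU hz) y hy)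

lemma contDiffOn_integral_param (hU : IsOpen U) (hK : IsCompact K) (hKm : MeasurableSet K)
    {F : H → X → E} {F' : H → X → H →L[ℝ] E}
    (hF : ContinuousOn (Function.uncurry F) (U ×ˢ K))
    (hF' : ContinuousOn (Function.uncurry F') (U ×ˢ K))
    (hd : ∀ x ∈ U, ∀ y ∈ K, HasFDerivAt (fun z => F z y) (F' x y) x) :
    ContDiffOn ℝ 1 (fun z => ∫ y in K, F z y ∂μ) U := by
  rw [show (1 : WithTop ℕ∞) = 0 + 1 from rfl, contDiffOn_succ_iff_fderiv_of_isOpen hU]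
  refine ⟨fun x hx =>
    (hasFDerivAt_integral_param hU hK hKm hF hF' hd hx).differentiableAt.differentiableWithinAt,
    by simp, ?_⟩
  rw [contDiffOn_zero]
  exact (continuousOn_integral_param hU hK hKm hF').congr fun x hx =>
    (hasFDerivAt_integral_param hU hK hKm hF hF' hd hx).fderiv

end Param

instance : ProperSpace ℍ[ℝ] := FiniteDimensional.proper ℝ ℍ[ℝ]

@[simp] lemma qe_zero : qe 0 = 1 := rfl
@[simp] lemma qe_one_re : (qe 1).re = 0 := rfl
@[simp] lemma qe_one_imI : (qe 1).imI = 1 := rfl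
@[simp] lemma qe_one_imJ : (qe 1).imJ = 0 := rfl
@[simp] lemma qe_one_imK : (qe 1).imK = 0 := rfl
@[simp] lemma qe_two_re : (qe 2).re = 0 := rfl
@[simp] lemma qe_two_imI : (qe 2).imI = 0 := rfl
@[simp] lemma qe_two_imJ : (qe 2).imJ = 1 := rfl
@[simp] lemma qe_two_imK : (qe 2).imK = 0 := rfl
@[simp] lemma qe_three_re : (qe 3).re = 0 := rfl
@[simp] lemma qe_three_imI : (qe 3).imI = 0 := rfl
@[simp] lemma qe_three_imJ : (qe 3).imJ = 0 := rfl
@[simp] lemma qe_three_imK : (qe 3).imK = 1 := rfl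

/-- The continuous real-linear endomorphisms of a normed space. -/
abbrev EndL (E : Type*) [NormedAddCommGroup E] [NormedSpace ℝ E] := E →L[ℝ] E

/-- Quaternion conjugation as a continuous real-linear map. -/
def conjL : EndL ℍ[ℝ] :=
  LinearMap.mkContinuous
    { toFun := star
      map_add' := star_add
      map_smul' := fun c x => by simp } 1 (fun x => by simp)

@[simp] lemma conjL_apply (x : ℍ[ℝ]) : conjL x = star x := rfl

/-- The fundamental solution of the Dirac operator. -/
def fsol (a : ℍ[ℝ]) : ℍ[ℝ] := ((‖a‖ ^ 2) ^ 2)⁻¹ • star a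

/-- The derivative of `fsol`. -/
def fsolD (a : ℍ[ℝ]) : EndL ℍ[ℝ] :=
  ((‖a‖ ^ 2) ^ 2)⁻¹ • conjL
    - (4 * ((‖a‖ ^ 2) ^ 3)⁻¹) • (innerSL ℝ a).smulRight (star a)

lemma fsolD_apply (a h : ℍ[ℝ]) : fsolD a h =
    ((‖a‖ ^ 2) ^ 2)⁻¹ • star h - (4 * ((‖a‖ ^ 2) ^ 3)⁻¹ * inner ℝ a h) • star a := by
  simp [fsolD, mul_smul, mul_assoc]

lemma hasFDerivAt_fsol {a : ℍ[ℝ]} (ha : a ≠ 0) : HasFDerivAt fsol (fsolD a) a := by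
  have h0 : ‖a‖ ^ 2 ≠ 0 := by simpa using ha
  have h1 : HasFDerivAt (fun a : ℍ[ℝ] => ‖a‖ ^ 2) _ a :=
    (hasStrictFDerivAt_norm_sq a).hasFDerivAt
  have h2 := (hasDerivAt_inv (pow_ne_zero 2 h0)).comp_hasFDerivAt a (h1.pow 2)
  have h3 := h2.smul conjL.hasFDerivAt (x := a)
  refine h3.congr_fderiv ?_
  ext h : 1
  rw [fsolD_apply]
  simp
  rw [sub_eq_add_neg]
  congr 3
  field_simp
  ring

lemma continuousOn_fsol : ContinuousOn fsol {0}ᶜ := fun _ ha =>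
  (hasFDerivAt_fsol ha).continuousAt.continuousWithinAt

lemma continuousOn_fsolD : ContinuousOn fsolD {0}ᶜ := by
  unfold fsolD
  have h0 : ∀ a ∈ ({0}ᶜ : Set ℍ[ℝ]), ‖a‖ ^ 2 ≠ 0 := fun a ha => by simpa using ha
  have hs : Continuous fun a : ℍ[ℝ] => (innerSL ℝ a).smulRight (star a) := by
    have : Continuous fun a : ℍ[ℝ] =>
      (ContinuousLinearMap.smulRightL ℝ ℍ[ℝ] ℍ[ℝ] (innerSL ℝ a)) (star a) := by fun_prop
    exact this
  refine ContinuousOn.fun_sub (ContinuousOn.fun_smul ?_ continuousOn_const)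
    (ContinuousOn.fun_smul (ContinuousOn.fun_mul continuousOn_const ?_) hs.continuousOn)
  · exact ContinuousOn.fun_inv₀ (by fun_prop) fun a ha => pow_ne_zero _ (h0 a ha)
  · exact ContinuousOn.fun_inv₀ (by fun_prop) fun a ha => pow_ne_zero _ (h0 a ha)

/-- The Dirac symbol of a linear map. -/
def symb (L : EndL ℍ[ℝ]) : ℍ[ℝ] := ∑ j : Fin 4, L (qe j) * qe j

lemma Dirac_eq_symb (f : ℍ[ℝ] → ℍ[ℝ]) (z : ℍ[ℝ]) : Dirac f z = symb (fderiv ℝ f z) := rfl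

lemma symb_fsolD {a : ℍ[ℝ]} (ha : a ≠ 0) : symb (fsolD a) = 0 := by
  have h0 : ‖a‖ ^ 2 ≠ 0 := by simpa using ha
  have h1 : ‖a‖ ^ 2 = a.re ^ 2 + a.imI ^ 2 + a.imJ ^ 2 + a.imK ^ 2 := by
    rw [sq ‖a‖, ← Quaternion.normSq_eq_norm_mul_self, Quaternion.normSq_def']
  simp only [symb, fsolD_apply, Fin.sum_univ_four, Quaternion.inner_def]
  generalize ‖a‖ ^ 2 = n at h0 h1
  apply Quaternion.ext
  all_goals
    simp
    field_simp
    try rw [h1]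
    try ring

lemma norm_fsol (a : ℍ[ℝ]) : ‖fsol a‖ = (‖a‖ ^ 3)⁻¹ := by
  rw [fsol, norm_smul, norm_star, norm_inv, norm_pow, norm_pow, norm_norm]
  rcases eq_or_ne ‖a‖ 0 with h | h
  · simp [h]
  · field_simp

/-- `symb` as a continuous linear map. -/
def symbL : EndL ℍ[ℝ] →L[ℝ] ℍ[ℝ] :=
  ∑ j : Fin 4, ((ContinuousLinearMap.mul ℝ ℍ[ℝ]).flip (qe j)).comp
    (ContinuousLinearMap.apply ℝ ℍ[ℝ] (qe j))

lemma symbL_apply (L : EndL ℍ[ℝ]) : symbL L = symb L := by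
  simp [symbL, symb]

lemma USphere.sub_ne_zero {x : ℍ[ℝ]} (hx : x ∈ ball (0 : ℍ[ℝ]) 1) (y : USphere) :
    (y : ℍ[ℝ]) - x ≠ 0 := by
  intro h
  rw [_root_.sub_eq_zero] at h
  rw [mem_ball_zero_iff, ← h, y.norm_eq] at hx
  exact lt_irrefl _ hx

lemma integrable_sph {F : Type*} [NormedAddCommGroup F] {f : USphere → F}
    (hf : Continuous f) : Integrable f sphMeas := by
  have := hf.continuousOn.integrableOn_compact' (μ := sphMeas) isCompact_univ MeasurableSet.univ
  rwa [integrableOn_univ] at this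

/-- The integral `∫ a(y) G(y - x) dμ(y)` with the fundamental solution `G`. -/
def cInt (a : USphere → ℍ[ℝ]) (x : ℍ[ℝ]) : ℍ[ℝ] :=
  ∫ y : USphere, a y * fsol ((y : ℍ[ℝ]) - x) ∂sphMeas

/-- The derivative of the integrand of `cInt`. -/
def cIntD (a : USphere → ℍ[ℝ]) (x : ℍ[ℝ]) (y : USphere) : EndL ℍ[ℝ] :=
  -((ContinuousLinearMap.mul ℝ ℍ[ℝ] (a y)).comp (fsolD ((y : ℍ[ℝ]) - x)))

lemma hasFDerivAt_cInt_integrand (a : USphere → ℍ[ℝ]) {x : ℍ[ℝ]} {y : USphere}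
    (h : (y : ℍ[ℝ]) - x ≠ 0) :
    HasFDerivAt (fun z => a y * fsol ((y : ℍ[ℝ]) - z)) (cIntD a x y) x := by
  have h1 : HasFDerivAt (fun z : ℍ[ℝ] => (y : ℍ[ℝ]) - z) (-ContinuousLinearMap.id ℝ ℍ[ℝ]) x :=
    (hasFDerivAt_id x).const_sub _
  have h2 := ((ContinuousLinearMap.mul ℝ ℍ[ℝ] (a y)).hasFDerivAt).comp x
    ((hasFDerivAt_fsol h).comp x h1)
  refine h2.congr_fderiv ?_
  ext v : 1
  simp [cIntD]

lemma continuousOn_cInt_integrand {a : USphere → ℍ[ℝ]} (ha : Continuous a) :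
    ContinuousOn (Function.uncurry fun (x : ℍ[ℝ]) (y : USphere) => a y * fsol ((y : ℍ[ℝ]) - x))
      (ball 0 1 ×ˢ Set.univ) := by
  refine ContinuousOn.fun_mul (by fun_prop) ?_
  exact continuousOn_fsol.comp (f := fun p : ℍ[ℝ] × USphere => (p.2 : ℍ[ℝ]) - p.1) (by fun_prop)
    fun p hp => USphere.sub_ne_zero hp.1 p.2

lemma continuousOn_cIntD {a : USphere → ℍ[ℝ]} (ha : Continuous a) :
    ContinuousOn (Function.uncurry (cIntD a)) (ball 0 1 ×ˢ Set.univ) := by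
  refine ContinuousOn.fun_neg (ContinuousOn.clm_comp (Continuous.continuousOn (by fun_prop)) ?_)
  exact continuousOn_fsolD.comp (f := fun p : ℍ[ℝ] × USphere => (p.2 : ℍ[ℝ]) - p.1) (by fun_prop)
    fun p hp => USphere.sub_ne_zero hp.1 p.2

lemma symb_cIntD (a : USphere → ℍ[ℝ]) {x : ℍ[ℝ]} {y : USphere}
    (h : (y : ℍ[ℝ]) - x ≠ 0) : symb (cIntD a x y) = 0 := by
  have := symb_fsolD h
  simp only [symb, cIntD, neg_apply, ContinuousLinearMap.comp_apply,
    ContinuousLinearMap.mul_apply', neg_mul, Finset.sum_neg_distrib, mul_assoc] at this ⊢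
  rw [← Finset.mul_sum, this]; simp

lemma hasFDerivAt_cInt {a : USphere → ℍ[ℝ]} (ha : Continuous a) {x : ℍ[ℝ]}
    (hx : x ∈ ball (0 : ℍ[ℝ]) 1) :
    HasFDerivAt (cInt a) (∫ y, cIntD a x y ∂sphMeas) x := by
  have := hasFDerivAt_integral_param (μ := sphMeas) isOpen_ball isCompact_univ MeasurableSet.univ
    (continuousOn_cInt_integrand ha) (continuousOn_cIntD ha)
    (fun z hz y _ => hasFDerivAt_cInt_integrand a (USphere.sub_ne_zero hz y)) hx
  simp only [Measure.restrict_univ] at this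
  exact this

lemma contDiffOn_cInt {a : USphere → ℍ[ℝ]} (ha : Continuous a) :
    ContDiffOn ℝ 1 (cInt a) (ball 0 1) := by
  have := contDiffOn_integral_param (μ := sphMeas) isOpen_ball isCompact_univ MeasurableSet.univ
    (continuousOn_cInt_integrand ha) (continuousOn_cIntD ha)
    (fun z hz y _ => hasFDerivAt_cInt_integrand a (USphere.sub_ne_zero hz y))
  simp only [Measure.restrict_univ] at this
  exact this

lemma Dirac_cInt {a : USphere → ℍ[ℝ]} (ha : Continuous a) {x : ℍ[ℝ]}
    (hx : x ∈ ball (0 : ℍ[ℝ]) 1) : Dirac (cInt a) x = 0 := by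
  rw [Dirac_eq_symb, (hasFDerivAt_cInt ha hx).fderiv, ← symbL_apply]
  have hi : Integrable (cIntD a x) sphMeas := by
    apply integrable_sph
    rw [← continuousOn_univ]
    exact continuousOn_slice (continuousOn_cIntD ha) hx
  refine (symbL.integral_comp_comm hi).symm.trans ?_
  simp_rw [symbL_apply, symb_cIntD a (USphere.sub_ne_zero hx _)]
  simp

/-- The Cauchy kernel of the ball. -/
def kern (x : ℍ[ℝ]) (y : USphere) : ℍ[ℝ] := y * fsol ((y : ℍ[ℝ]) - x)

lemma kern_eq (x : ℍ[ℝ]) (y : USphere) :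
    kern x y = (‖(y : ℍ[ℝ]) - x‖ ^ 4)⁻¹ • (1 - y * star x) := by
  rw [kern, fsol, mul_smul_comm, star_sub, mul_sub, y.mul_star, ← pow_mul]

lemma norm_kern (x : ℍ[ℝ]) (y : USphere) : ‖kern x y‖ = (‖(y : ℍ[ℝ]) - x‖ ^ 3)⁻¹ := by
  rw [kern, norm_mul, y.norm_eq, one_mul, norm_fsol]

/-- The Cauchy integral. -/
def cauchy (v : USphere → ℍ[ℝ]) (x : ℍ[ℝ]) : ℍ[ℝ] := ∫ y, v y * kern x y ∂sphMeas

lemma cauchy_eq_cInt (v : USphere → ℍ[ℝ]) : cauchy v = cInt fun y => v y * y := by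
  ext1 x; simp only [cauchy, cInt, kern, mul_assoc]

lemma contDiffOn_cauchy {v : USphere → ℍ[ℝ]} (hv : Continuous v) :
    ContDiffOn ℝ 1 (cauchy v) (ball 0 1) := by
  rw [cauchy_eq_cInt]; exact contDiffOn_cInt (by fun_prop)

lemma Dirac_cauchy {v : USphere → ℍ[ℝ]} (hv : Continuous v) {x : ℍ[ℝ]}
    (hx : x ∈ ball (0 : ℍ[ℝ]) 1) : Dirac (cauchy v) x = 0 := by
  rw [cauchy_eq_cInt]; exact Dirac_cInt (by fun_prop) hx

lemma continuous_dist_sph (x : ℍ[ℝ]) : Continuous fun y : USphere => ‖(y : ℍ[ℝ]) - x‖ := by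
  fun_prop

lemma continuous_inv_dist {x : ℍ[ℝ]} (hx : x ∈ ball (0 : ℍ[ℝ]) 1) (k : ℕ) :
    Continuous fun y : USphere => (‖(y : ℍ[ℝ]) - x‖ ^ k)⁻¹ :=
  Continuous.inv₀ (by fun_prop) fun y =>
    pow_ne_zero _ (norm_ne_zero_iff.2 (USphere.sub_ne_zero hx y))

lemma continuous_kern {x : ℍ[ℝ]} (hx : x ∈ ball (0 : ℍ[ℝ]) 1) : Continuous (kern x) := by
  simp only [funext (kern_eq x)]
  exact (continuous_inv_dist hx 4).smul (by fun_prop)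

lemma norm_sub_sq_sph (x : ℍ[ℝ]) (y : USphere) :
    ‖(y : ℍ[ℝ]) - x‖ ^ 2 = 1 - 2 * inner ℝ (y : ℍ[ℝ]) x + ‖x‖ ^ 2 := by
  rw [norm_sub_sq_real, y.norm_eq]; ring

/-- Normalisation of a nonzero quaternion. -/
def toSph (x : ℍ[ℝ]) (hx : x ≠ 0) : USphere :=
  ⟨(‖x‖⁻¹ : ℝ) • x, by simp [norm_smul, hx]⟩

lemma kern_twist {x : ℍ[ℝ]} (hx : x ≠ 0) (y : USphere) :
    star (kern x y) = kern x (twistS (toSph x hx) y) := by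
  have hn : ‖x‖ ≠ 0 := by simpa using hx
  have h1 : twist (toSph x hx) x = x := by
    rw [twist_apply]
    simp only [toSph, smul_mul_assoc, mul_smul_comm, smul_smul]
    rw [Quaternion.self_mul_star, Quaternion.normSq_eq_norm_mul_self,
      Quaternion.coe_mul_eq_smul, smul_smul]
    field_simp
    simp
  have h2 : ‖(twistS (toSph x hx) y : ℍ[ℝ]) - x‖ = ‖(y : ℍ[ℝ]) - x‖ := by
    rw [← (twist (toSph x hx)).norm_map ((y : ℍ[ℝ]) - x), map_sub, h1]; rfl
  rw [kern_eq, kern_eq, h2, Quaternion.star_smul]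
  congr 1
  rw [twistS_coe]
  simp only [toSph, smul_mul_assoc, mul_smul_comm, smul_smul, mul_assoc, star_sub, star_one,
    StarMul.star_mul, star_star]
  rw [Quaternion.self_mul_star, Quaternion.normSq_eq_norm_mul_self, Quaternion.mul_coe_eq_smul,
    mul_smul_comm, smul_smul]
  field_simp
  simp

lemma star_cauchy_one {x : ℍ[ℝ]} : star (cauchy (fun _ => 1) x) = cauchy (fun _ => 1) x := by
  simp only [cauchy, one_mul]
  rcases eq_or_ne x 0 with rfl | hx
  · simp [kern_eq]
  · have h := integral_twistS (toSph x hx) (kern x)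
    simp_rw [← kern_twist hx] at h
    refine Eq.trans ?_ h
    have h1 := (twist 1).toLinearIsometry.integral_comp_comm (μ := sphMeas) (kern x)
    simp only [LinearIsometryEquiv.coe_toLinearIsometry, twist_apply, USphere.coe_one, one_mul,
      mul_one] at h1
    exact h1.symm

lemma eq_coe_of_star_eq {q : ℍ[ℝ]} (h : star q = q) : q = (q.re : ℍ[ℝ]) := by
  have h1 := congrArg QuaternionAlgebra.imI h
  have h2 := congrArg QuaternionAlgebra.imJ h
  have h3 := congrArg QuaternionAlgebra.imK h
  simp at h1 h2 h3
  apply Quaternion.ext <;> simp <;> linarith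

lemma cauchy_one {x : ℍ[ℝ]} (hx : x ∈ ball (0 : ℍ[ℝ]) 1) : cauchy (fun _ => 1) x = 1 := by
  have hd : DifferentiableOn ℝ (cauchy fun _ => 1) (ball 0 1) :=
    (contDiffOn_cauchy continuous_const).differentiableOn one_ne_zero
  have key : ∀ z ∈ ball (0 : ℍ[ℝ]) 1, fderiv ℝ (cauchy fun _ => 1) z = 0 := by
    intro z hz
    have hz' := (hd z hz).differentiableAt (isOpen_ball.mem_nhds hz)
    have h1 : ∀ v, star (fderiv ℝ (cauchy fun _ => 1) z v) = fderiv ℝ (cauchy fun _ => 1) z v := by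
      intro v
      have h2 : HasFDerivAt (fun w => star (cauchy (fun _ => 1) w))
          ((conjL : EndL ℍ[ℝ]).comp (fderiv ℝ (cauchy fun _ => 1) z)) z :=
        (conjL : EndL ℍ[ℝ]).hasFDerivAt.comp z hz'.hasFDerivAt
      simp_rw [star_cauchy_one] at h2
      have h3 := h2.unique hz'.hasFDerivAt
      exact congrArg (fun L : EndL ℍ[ℝ] => L v) h3
    have h4 := Dirac_cauchy (v := fun _ => 1) continuous_const hz
    simp only [Dirac, Fin.sum_univ_four] at h4
    rw [eq_coe_of_star_eq (h1 (qe 0)), eq_coe_of_star_eq (h1 (qe 1)),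
      eq_coe_of_star_eq (h1 (qe 2)), eq_coe_of_star_eq (h1 (qe 3))] at h4
    have e0 := congrArg QuaternionAlgebra.re h4
    have e1 := congrArg QuaternionAlgebra.imI h4
    have e2 := congrArg QuaternionAlgebra.imJ h4
    have e3 := congrArg QuaternionAlgebra.imK h4
    simp at e0 e1 e2 e3
    ext1 v
    have hv : v = v.re • qe 0 + v.imI • qe 1 + v.imJ • qe 2 + v.imK • qe 3 := by
      apply Quaternion.ext <;> simp
    rw [hv]
    simp only [map_add, map_smul]
    rw [eq_coe_of_star_eq (h1 (qe 0)), eq_coe_of_star_eq (h1 (qe 1)),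
      eq_coe_of_star_eq (h1 (qe 2)), eq_coe_of_star_eq (h1 (qe 3))]
    simp [e0, e1, e2, e3]
  have h5 := isOpen_ball.is_const_of_fderiv_eq_zero (convex_ball (0 : ℍ[ℝ]) 1).isPreconnected hd
    key hx (mem_ball_self one_pos)
  rw [h5]
  simp [cauchy, kern_eq]

lemma re_cauchy_one {x : ℍ[ℝ]} (hx : x ∈ ball (0 : ℍ[ℝ]) 1) :
    ∫ y : USphere, (‖(y : ℍ[ℝ]) - x‖ ^ 4)⁻¹ * (1 - inner ℝ (y : ℍ[ℝ]) x) ∂sphMeas = 1 := by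
  have h := cauchy_one hx
  have h1 := (innerSL ℝ (1 : ℍ[ℝ])).integral_comp_comm (integrable_sph (continuous_kern hx))
  simp only [cauchy, one_mul] at h
  rw [h] at h1
  have h2 : (innerSL ℝ (1 : ℍ[ℝ])) 1 = 1 := by simp
  rw [h2] at h1
  refine Eq.trans ?_ h1
  congr 1
  ext1 y
  simp only [kern_eq, Quaternion.inner_def, innerSL_apply_apply, one_mul, Quaternion.re_star,
    Quaternion.re_smul, smul_eq_mul, Quaternion.re_sub, Quaternion.re_one]

lemma poisson_newton {x : ℍ[ℝ]} (hx : x ∈ ball (0 : ℍ[ℝ]) 1) :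
    (1 - ‖x‖ ^ 2) * ∫ y : USphere, (‖(y : ℍ[ℝ]) - x‖ ^ 4)⁻¹ ∂sphMeas +
      ∫ y : USphere, (‖(y : ℍ[ℝ]) - x‖ ^ 2)⁻¹ ∂sphMeas = 2 := by
  have h := re_cauchy_one hx
  rw [← integral_const_mul, ← integral_add
    ((integrable_sph (continuous_inv_dist hx 4)).const_mul _)
    (integrable_sph (continuous_inv_dist hx 2))]
  refine Eq.trans ?_ ((congrArg (fun t : ℝ => 2 * t) h).trans (mul_one 2))
  rw [← integral_const_mul]
  congr 1
  ext1 y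
  have h1 := norm_sub_sq_sph x y
  have h2 : ‖(y : ℍ[ℝ]) - x‖ ≠ 0 := norm_ne_zero_iff.2 (USphere.sub_ne_zero hx y)
  have h3 : inner ℝ (y : ℍ[ℝ]) x = (1 + ‖x‖ ^ 2 - ‖(y : ℍ[ℝ]) - x‖ ^ 2) / 2 := by linarith
  rw [h3]
  field_simp
  ring

lemma newton_ray_deriv (x : ℍ[ℝ]) {t : ℝ} (ht : t • x ∈ ball (0 : ℍ[ℝ]) 1) :
    HasDerivAt (fun s : ℝ => ∫ y : USphere, (‖(y : ℍ[ℝ]) - s • x‖ ^ 2)⁻¹ ∂sphMeas)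
      (∫ y : USphere, (‖(y : ℍ[ℝ]) - t • x‖ ^ 4)⁻¹ * (2 * inner ℝ ((y : ℍ[ℝ]) - t • x) x)
        ∂sphMeas) t := by
  set U : Set ℝ := {s : ℝ | s • x ∈ ball (0 : ℍ[ℝ]) 1} with hUdef
  have hU : IsOpen U := isOpen_ball.preimage (f := fun s : ℝ => s • x) (by fun_prop)
  have hne : ∀ p ∈ U ×ˢ (Set.univ : Set USphere), ‖(p.2 : ℍ[ℝ]) - p.1 • x‖ ≠ 0 := fun p hp =>
    norm_ne_zero_iff.2 (USphere.sub_ne_zero hp.1 p.2)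
  set G : ℝ → USphere → ℝ := fun s y =>
    (‖(y : ℍ[ℝ]) - s • x‖ ^ 4)⁻¹ * (2 * inner ℝ ((y : ℍ[ℝ]) - s • x) x) with hG
  have hGc : ContinuousOn (Function.uncurry G) (U ×ˢ Set.univ) := by
    refine ContinuousOn.fun_mul (ContinuousOn.fun_inv₀ (by fun_prop) fun p hp =>
      pow_ne_zero _ (hne p hp)) (by fun_prop)
  have h := hasFDerivAt_integral_param (μ := sphMeas) (K := Set.univ) hU isCompact_univ
    MeasurableSet.univ
    (F := fun s y => (‖(y : ℍ[ℝ]) - s • x‖ ^ 2)⁻¹)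
    (F' := fun s y => ContinuousLinearMap.toSpanSingleton ℝ (G s y)) ?_ ?_ ?_ ht
  · rw [hasDerivAt_iff_hasFDerivAt]
    simp only [Measure.restrict_univ] at h
    refine h.congr_fderiv ?_
    ext
    rw [ContinuousLinearMap.integral_apply]
    · simp [hG]
    · apply integrable_sph
      have : Continuous (G t) := by
        rw [← continuousOn_univ]; exact continuousOn_slice hGc ht
      exact (ContinuousLinearMap.toSpanSingletonCLE (𝕜 := ℝ) (E := ℝ)).continuous.comp this
  · exact ContinuousOn.fun_inv₀ (by fun_prop) fun p hp => pow_ne_zero _ (hne p hp)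
  · exact (ContinuousLinearMap.toSpanSingletonCLE (𝕜 := ℝ) (E := ℝ)).continuous.comp_continuousOn hGc
  · intro s hs y _
    have hn := hne (s, y) ⟨hs, trivial⟩
    have h1 : HasDerivAt (fun s : ℝ => (y : ℍ[ℝ]) - s • x) (-x) s := by
      simpa using ((hasDerivAt_id s).smul_const x).const_sub (y : ℍ[ℝ])
    have h2 := (h1.norm_sq).inv (pow_ne_zero 2 hn)
    rw [← hasDerivAt_iff_hasFDerivAt]
    refine h2.congr_deriv ?_
    simp only [hG, inner_neg_right]
    field_simp

lemma newton_eq_one {x : ℍ[ℝ]} (hx : x ∈ ball (0 : ℍ[ℝ]) 1) :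
    ∫ y : USphere, (‖(y : ℍ[ℝ]) - x‖ ^ 2)⁻¹ ∂sphMeas = 1 := by
  have hb : ∀ t ∈ Set.Icc (0 : ℝ) 1, t • x ∈ ball (0 : ℍ[ℝ]) 1 := by
    intro t ht
    rw [mem_ball_zero_iff] at hx ⊢
    rw [norm_smul, Real.norm_of_nonneg ht.1]
    nlinarith [norm_nonneg x, ht.2]
  set φ : ℝ → ℝ := fun s => ∫ y : USphere, (‖(y : ℍ[ℝ]) - s • x‖ ^ 2)⁻¹ ∂sphMeas with hφ
  have hder : ∀ t ∈ Set.Icc (0 : ℝ) 1, HasDerivAt (fun t => t ^ 2 * (φ t - 1)) 0 t := by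
    intro t ht
    have h1 := newton_ray_deriv x (hb t ht)
    have h2 := ((hasDerivAt_pow 2 t).mul (h1.sub_const 1))
    refine h2.congr_deriv ?_
    have h3 := poisson_newton (hb t ht)
    have h4 : t * ∫ y : USphere, (‖(y : ℍ[ℝ]) - t • x‖ ^ 4)⁻¹ *
        (2 * inner ℝ ((y : ℍ[ℝ]) - t • x) x) ∂sphMeas
        = (1 - ‖t • x‖ ^ 2) * (∫ y : USphere, (‖(y : ℍ[ℝ]) - t • x‖ ^ 4)⁻¹ ∂sphMeas) - φ t := by
      rw [hφ, ← integral_const_mul, ← integral_const_mul, ← integral_sub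
        ((integrable_sph (continuous_inv_dist (hb t ht) 4)).const_mul _)
        (integrable_sph (continuous_inv_dist (hb t ht) 2))]
      congr 1
      ext1 y
      have h1 := norm_sub_sq_sph (t • x) y
      have h2 : ‖(y : ℍ[ℝ]) - t • x‖ ≠ 0 := norm_ne_zero_iff.2 (USphere.sub_ne_zero (hb t ht) y)
      have h5 : t * inner ℝ ((y : ℍ[ℝ]) - t • x) x =
          inner ℝ (y : ℍ[ℝ]) (t • x) - ‖t • x‖ ^ 2 := by
        rw [inner_sub_left, ← real_inner_self_eq_norm_sq (t • x)]
        simp only [real_inner_smul_left, real_inner_smul_right]; ring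
      have h3 : inner ℝ (y : ℍ[ℝ]) (t • x) =
          (1 + ‖t • x‖ ^ 2 - ‖(y : ℍ[ℝ]) - t • x‖ ^ 2) / 2 := by linarith
      rw [h3] at h5
      calc _ = (‖(y : ℍ[ℝ]) - t • x‖ ^ 4)⁻¹ * (2 * (t * inner ℝ ((y : ℍ[ℝ]) - t • x) x)) := by ring
        _ = _ := by rw [h5]; field_simp; ring
    change _ + _ = 2 at h3
    have h6 : φ t = ∫ y : USphere, (‖(y : ℍ[ℝ]) - t • x‖ ^ 2)⁻¹ ∂sphMeas := rfl
    rw [← h6] at h3 ⊢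
    simp only [Nat.cast_ofNat]
    rw [sq t, mul_assoc t t, h4]
    generalize (∫ y : USphere, (‖(y : ℍ[ℝ]) - t • x‖ ^ 4)⁻¹ ∂sphMeas) = I at h3
    linear_combination t * h3
  have h7 := constant_of_has_deriv_right_zero
    (fun t ht => (hder t ht).continuousAt.continuousWithinAt)
    (fun t ht => (hder t ⟨ht.1, ht.2.le⟩).hasDerivWithinAt) 1 (by simp)
  simp [hφ] at h7
  linarith

/-- The normalisation of the Poisson kernel. -/
lemma poisson_norm {x : ℍ[ℝ]} (hx : x ∈ ball (0 : ℍ[ℝ]) 1) :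
    ∫ y : USphere, (‖(y : ℍ[ℝ]) - x‖ ^ 4)⁻¹ ∂sphMeas = (1 - ‖x‖ ^ 2)⁻¹ := by
  have h1 := poisson_newton hx
  rw [newton_eq_one hx] at h1
  rw [mem_ball_zero_iff] at hx
  have : 0 < 1 - ‖x‖ ^ 2 := by nlinarith [norm_nonneg x]
  refine eq_inv_of_mul_eq_one_right ?_
  linarith

lemma poisson_norm_le {x : ℍ[ℝ]} (hx : x ∈ ball (0 : ℍ[ℝ]) 1) :
    ∫ y : USphere, (‖(y : ℍ[ℝ]) - x‖ ^ 4)⁻¹ ∂sphMeas ≤ (1 - ‖x‖)⁻¹ := by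
  rw [poisson_norm hx]
  rw [mem_ball_zero_iff] at hx
  apply inv_anti₀ (by linarith)
  nlinarith [norm_nonneg x]

/-- The folding symmetry: `v(y) = v(ȳ) ȳ`. -/
def FoldSym (v : USphere → ℍ[ℝ]) : Prop := ∀ y, v y = v (cj y) * star (y : ℍ[ℝ])

/-- The folded Cauchy integral is the Poisson integral. -/
lemma cauchy_fold {v : USphere → ℍ[ℝ]} (hv : Continuous v) (hs : FoldSym v) {x : ℍ[ℝ]}
    (hx : x ∈ ball (0 : ℍ[ℝ]) 1) :
    cauchy v x + cauchy v (star x) * star x =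
      ∫ y : USphere, ((1 - ‖x‖ ^ 2) * (‖(y : ℍ[ℝ]) - x‖ ^ 4)⁻¹) • v y ∂sphMeas := by
  have hx' : star x ∈ ball (0 : ℍ[ℝ]) 1 := by simpa using hx
  have i1 : Integrable (fun y => v y * kern x y) sphMeas :=
    integrable_sph (hv.mul (continuous_kern hx))
  have e2 : cauchy v (star x) * star x = ∫ y, v y * kern (star x) y * star x ∂sphMeas :=
    (integral_mul_const_of_integrable (integrable_sph (hv.mul (continuous_kern hx')))).symm
  have i3 : Integrable (fun y => v (cj y) * kern (star x) (cj y) * star x) sphMeas :=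
    integrable_sph (((hv.mul (continuous_kern hx')).mul continuous_const).comp continuous_cj)
  rw [e2, ← integral_cj, cauchy, ← integral_add i1 i3]
  congr 1
  ext1 y
  have hn : ‖(cj y : ℍ[ℝ]) - star x‖ = ‖(y : ℍ[ℝ]) - x‖ := by
    rw [cj_coe, ← star_sub, norm_star]
  rw [kern_eq, kern_eq, hn, mul_smul, smul_comm]
  simp only [mul_smul_comm, smul_mul_assoc, cj_coe, star_star]
  rw [← smul_add]
  congr 1
  have h1 : v (cj y) = v y * y := by
    conv_rhs => rw [hs y]
    rw [mul_assoc, y.star_mul, mul_one]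
  have h2 : (x : ℍ[ℝ]) * star x = ((‖x‖ ^ 2 : ℝ) : ℍ[ℝ]) := by
    rw [Quaternion.self_mul_star, Quaternion.normSq_eq_norm_mul_self, sq]
  calc v y * (1 - y * star x) + v (cj y) * (1 - star (y : ℍ[ℝ]) * x) * star x
      = v y * (1 - y * star x) + v y * (y * star x - (y * star (y : ℍ[ℝ])) * (x * star x)) := by
        rw [h1]; noncomm_ring
    _ = v y * (1 - x * star x) := by rw [y.mul_star]; noncomm_ring
    _ = _ := by
        rw [h2, sub_smul, one_smul, mul_sub, mul_one, Quaternion.mul_coe_eq_smul]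

lemma eq_zero_of_fold {a b x : ℍ[ℝ]} (hx : x ∈ ball (0 : ℍ[ℝ]) 1)
    (h1 : a + b * star x = 0) (h2 : b + a * x = 0) : a = 0 := by
  have h : (1 - ‖x‖ ^ 2) • a = 0 := by
    have h3 : (x : ℍ[ℝ]) * star x = ((‖x‖ ^ 2 : ℝ) : ℍ[ℝ]) := by
      rw [Quaternion.self_mul_star, Quaternion.normSq_eq_norm_mul_self, sq]
    rw [sub_smul, one_smul, ← Quaternion.mul_coe_eq_smul, ← h3]
    rw [eq_neg_of_add_eq_zero_left h2] at h1
    rw [← h1]; noncomm_ring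
  rw [mem_ball_zero_iff] at hx
  rcases smul_eq_zero.1 h with h | h
  · nlinarith [norm_nonneg x]
  · exact h

lemma norm_fsol_sub_le {a b : ℍ[ℝ]} (ha : a ≠ 0) (hb : b ≠ 0) :
    ‖fsol a - fsol b‖ ≤ 5 * ‖a - b‖ * ((‖a‖ ^ 4)⁻¹ + (‖b‖ ^ 4)⁻¹) := by
  have hα : 0 < ‖a‖ := norm_pos_iff.2 ha
  have hβ : 0 < ‖b‖ := norm_pos_iff.2 hb
  have e : fsol a - fsol b = (‖a‖ ^ 4)⁻¹ • (star (a - b)) +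
      ((‖a‖ ^ 4)⁻¹ - (‖b‖ ^ 4)⁻¹) • star b := by
    simp only [fsol, ← pow_mul, star_sub, smul_sub, sub_smul]; abel
  have h1 : |‖a‖ - ‖b‖| ≤ ‖a - b‖ := abs_norm_sub_norm_le a b
  have h2 : ‖fsol a - fsol b‖ ≤ (‖a‖ ^ 4)⁻¹ * ‖a - b‖ +
      |(‖a‖ ^ 4)⁻¹ - (‖b‖ ^ 4)⁻¹| * ‖b‖ := by
    rw [e]
    refine (norm_add_le _ _).trans ?_
    rw [norm_smul, norm_smul, norm_star, norm_star, Real.norm_eq_abs, Real.norm_eq_abs,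
      abs_of_pos (by positivity : 0 < (‖a‖ ^ 4)⁻¹)]
  generalize ‖a - b‖ = t at *
  generalize ‖a‖ = α at *
  generalize ‖b‖ = β at *
  have ht : 0 ≤ t := (abs_nonneg _).trans h1
  set p := α⁻¹ with hp
  set q := β⁻¹ with hq
  have hp0 : 0 < p := by positivity
  have hq0 : 0 < q := by positivity
  have e2 : ((α ^ 4)⁻¹ - (β ^ 4)⁻¹) * β = (β - α) * (p ^ 4 + p ^ 3 * q + p ^ 2 * q ^ 2 + p * q ^ 3) := by
    simp only [hp, hq]; field_simp; ring
  have e3 : |(α ^ 4)⁻¹ - (β ^ 4)⁻¹| * β ≤ t * (p ^ 4 + p ^ 3 * q + p ^ 2 * q ^ 2 + p * q ^ 3) := by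
    rw [← abs_of_pos hβ, ← abs_mul, abs_of_pos hβ, e2, abs_mul, abs_sub_comm]
    rw [abs_of_pos (by positivity : 0 < p ^ 4 + p ^ 3 * q + p ^ 2 * q ^ 2 + p * q ^ 3)]
    gcongr
  have e4 : p ^ 4 + p ^ 3 * q + p ^ 2 * q ^ 2 + p * q ^ 3 ≤ 4 * (p ^ 4 + q ^ 4) := by
    nlinarith [sq_nonneg (p ^ 2 - q ^ 2), mul_nonneg (sq_nonneg (p - q)) (sq_nonneg (p + q)),
      mul_nonneg (sq_nonneg (p - q)) (add_nonneg (add_nonneg (sq_nonneg p) (mul_pos hp0 hq0).le)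
        (sq_nonneg q)), pow_pos hp0 4, pow_pos hq0 4]
  rw [← inv_pow, ← inv_pow, ← hp, ← hq] at *
  have e5 := mul_le_mul_of_nonneg_left e4 ht
  nlinarith [mul_nonneg ht (pow_pos hq0 4).le]

/-- The radius `1 - 2⁻ⁿ`. -/
def rad (n : ℕ) : ℝ := 1 - (1 / 2) ^ n

/-- `2^(-1/2)`. -/
def sqh : ℝ := √(1 / 2)

lemma sqh_sq : sqh ^ 2 = 1 / 2 := Real.sq_sqrt (by norm_num)
lemma sqh_pos : 0 < sqh := Real.sqrt_pos.2 (by norm_num)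
lemma sqh_lt : sqh < 3 / 4 := by
  rw [sqh, Real.sqrt_lt' (by norm_num)]; norm_num
lemma sqrt_half_pow (n : ℕ) : √((1 / 2 : ℝ) ^ n) = sqh ^ n := by
  rw [← sqh_sq, ← pow_mul, mul_comm, pow_mul, Real.sqrt_sq (pow_pos sqh_pos n).le]

lemma rad_nonneg (n : ℕ) : 0 ≤ rad n := by
  have : (1 / 2 : ℝ) ^ n ≤ 1 := pow_le_one₀ (by norm_num) (by norm_num)
  unfold rad; linarith

lemma rad_lt (n : ℕ) : rad n < 1 := by
  have : 0 < (1 / 2 : ℝ) ^ n := by positivity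
  unfold rad; linarith

lemma norm_smul_sph {r : ℝ} (hr : 0 ≤ r) (ω : USphere) : ‖r • (ω : ℍ[ℝ])‖ = r := by
  rw [norm_smul, ω.norm_eq, mul_one, Real.norm_of_nonneg hr]

lemma smul_sph_mem {r : ℝ} (hr : 0 ≤ r) (hr' : r < 1) (ω : USphere) :
    r • (ω : ℍ[ℝ]) ∈ ball (0 : ℍ[ℝ]) 1 := by
  rwa [mem_ball_zero_iff, norm_smul_sph hr]

lemma rad_mem (n : ℕ) (ω : USphere) : rad n • (ω : ℍ[ℝ]) ∈ ball (0 : ℍ[ℝ]) 1 :=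
  smul_sph_mem (rad_nonneg n) (rad_lt n) ω

/-- A multiple of the Poisson kernel at `(1 - 2⁻ⁿ) ω`. -/
def pois (n : ℕ) (ω y : USphere) : ℝ := (1 / 2) ^ n * (‖(y : ℍ[ℝ]) - rad n • (ω : ℍ[ℝ])‖ ^ 4)⁻¹

lemma pois_nonneg (n : ℕ) (ω y : USphere) : 0 ≤ pois n ω y := by unfold pois; positivity

lemma continuous_pois (n : ℕ) (ω : USphere) : Continuous (pois n ω) :=
  continuous_const.mul (continuous_inv_dist (rad_mem n ω) 4)

lemma integral_pois_le (n : ℕ) (ω : USphere) : ∫ y, pois n ω y ∂sphMeas ≤ 1 := by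
  have := poisson_norm_le (rad_mem n ω)
  rw [norm_smul_sph (rad_nonneg n), show 1 - rad n = (1 / 2) ^ n by unfold rad; ring] at this
  simp only [pois]
  rw [integral_const_mul]
  calc _ ≤ (1 / 2 : ℝ) ^ n * ((1 / 2 : ℝ) ^ n)⁻¹ := by gcongr
    _ = 1 := mul_inv_cancel₀ (by positivity)

lemma dist_radial_le (y ω : USphere) {r : ℝ} (hr : 0 ≤ r) (hr' : r ≤ 1) :
    ‖(y : ℍ[ℝ]) - ω‖ ≤ 2 * ‖(y : ℍ[ℝ]) - r • (ω : ℍ[ℝ])‖ := by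
  have h1 : ‖(y : ℍ[ℝ])‖ - ‖r • (ω : ℍ[ℝ])‖ ≤ ‖(y : ℍ[ℝ]) - r • (ω : ℍ[ℝ])‖ := norm_sub_norm_le _ _
  rw [y.norm_eq, norm_smul_sph hr] at h1
  have h2 : ‖(y : ℍ[ℝ]) - ω‖ ≤ ‖(y : ℍ[ℝ]) - r • (ω : ℍ[ℝ])‖ + ‖r • (ω : ℍ[ℝ]) - ω‖ :=
    norm_sub_le_norm_sub_add_norm_sub _ _ _
  have h3 : ‖r • (ω : ℍ[ℝ]) - ω‖ = 1 - r := by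
    rw [show r • (ω : ℍ[ℝ]) - ω = (r - 1) • (ω : ℍ[ℝ]) by rw [sub_smul, one_smul], norm_smul,
      ω.norm_eq, mul_one, Real.norm_eq_abs, abs_sub_comm, abs_of_nonneg (by linarith)]
  linarith

lemma one_sub_le_dist (y ω : USphere) {r : ℝ} (hr : 0 ≤ r) :
    1 - r ≤ ‖(y : ℍ[ℝ]) - r • (ω : ℍ[ℝ])‖ := by
  have h1 : ‖(y : ℍ[ℝ])‖ - ‖r • (ω : ℍ[ℝ])‖ ≤ ‖(y : ℍ[ℝ]) - r • (ω : ℍ[ℝ])‖ := norm_sub_norm_le _ _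
  rwa [y.norm_eq, norm_smul_sph hr] at h1

lemma dist_radial_le_add (y ω : USphere) {r : ℝ} (hr' : r ≤ 1) :
    ‖(y : ℍ[ℝ]) - r • (ω : ℍ[ℝ])‖ ≤ ‖(y : ℍ[ℝ]) - ω‖ + (1 - r) := by
  have h2 : ‖(y : ℍ[ℝ]) - r • (ω : ℍ[ℝ])‖ ≤ ‖(y : ℍ[ℝ]) - ω‖ + ‖(ω : ℍ[ℝ]) - r • (ω : ℍ[ℝ])‖ :=
    norm_sub_le_norm_sub_add_norm_sub _ _ _
  have h3 : ‖(ω : ℍ[ℝ]) - r • (ω : ℍ[ℝ])‖ = 1 - r := by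
    rw [show (ω : ℍ[ℝ]) - r • (ω : ℍ[ℝ]) = (1 - r) • (ω : ℍ[ℝ]) by rw [sub_smul, one_smul], norm_smul,
      ω.norm_eq, mul_one, Real.norm_of_nonneg (by linarith)]
  linarith

lemma sqrt_mul_pois_le (n : ℕ) (ω y : USphere) :
    √‖(y : ℍ[ℝ]) - ω‖ * pois n ω y ≤
      2592 * sqh ^ n * ∑ m ∈ Finset.range (n + 1), sqh ^ (n - m) * pois m ω y := by
  set s := ‖(y : ℍ[ℝ]) - ω‖ with hs
  have hs0 : 0 ≤ s := norm_nonneg _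
  have hs2 : s ≤ 2 := by
    have := norm_sub_le (y : ℍ[ℝ]) (ω : ℍ[ℝ])
    rw [y.norm_eq, ω.norm_eq] at this; linarith
  obtain ⟨m, hmn, hm, hm'⟩ : ∃ m ≤ n, s ≤ 2 * (1 / 2) ^ m ∧ (m < n → (1 / 2 : ℝ) ^ m < s) := by
    classical
    let P : ℕ → Prop := fun m => s ≤ 2 * (1 / 2) ^ m
    have hP0 : P 0 := by simpa [P] using hs2
    refine ⟨Nat.findGreatest P n, Nat.findGreatest_le n, Nat.findGreatest_spec (Nat.zero_le n) hP0,
      fun h => ?_⟩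
    have := Nat.findGreatest_is_greatest (P := P) (n := n) (Nat.lt_succ_self _) h
    simp only [P, not_le, pow_succ] at this
    linarith
  have hterm : sqh ^ (n - m) * pois m ω y ≤
      ∑ m ∈ Finset.range (n + 1), sqh ^ (n - m) * pois m ω y :=
    Finset.single_le_sum (f := fun m => sqh ^ (n - m) * pois m ω y)
      (fun i _ => mul_nonneg (pow_pos sqh_pos _).le (pois_nonneg _ _ _))
      (Finset.mem_range.2 (Nat.lt_succ_of_le hmn))
  have hq := sqh_pos
  have hsq : √s ≤ 2 * sqh ^ m := by
    rw [← sqrt_half_pow, Real.sqrt_le_left (by positivity), mul_pow, Real.sq_sqrt (by positivity)]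
    have : 0 < (1 / 2 : ℝ) ^ m := by positivity
    linarith
  suffices h : √s * pois n ω y ≤ 2592 * sqh ^ n * (sqh ^ (n - m) * pois m ω y) from
    h.trans (by gcongr)
  rcases hmn.eq_or_lt with rfl | hlt
  · rw [Nat.sub_self, pow_zero, one_mul]
    apply mul_le_mul_of_nonneg_right _ (pois_nonneg _ _ _)
    nlinarith [pow_pos hq m]
  · have hms := hm' hlt
    have hpow : 0 < (1 / 2 : ℝ) ^ m := by positivity
    have hspos : 0 < s := hpow.trans hms
    have h1 : (‖(y : ℍ[ℝ]) - rad n • (ω : ℍ[ℝ])‖ ^ 4)⁻¹ ≤ 16 * (((1 / 2 : ℝ) ^ m) ^ 4)⁻¹ := by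
      have := dist_radial_le y ω (rad_nonneg n) (rad_lt n).le
      have h2 : (1 / 2 : ℝ) ^ m / 2 ≤ ‖(y : ℍ[ℝ]) - rad n • (ω : ℍ[ℝ])‖ := by linarith
      calc (‖(y : ℍ[ℝ]) - rad n • (ω : ℍ[ℝ])‖ ^ 4)⁻¹ ≤ (((1 / 2 : ℝ) ^ m / 2) ^ 4)⁻¹ := by gcongr
        _ = _ := by field_simp; norm_num
    have h2 : (((1 / 2 : ℝ) ^ m) ^ 4)⁻¹ ≤ 81 * (‖(y : ℍ[ℝ]) - rad m • (ω : ℍ[ℝ])‖ ^ 4)⁻¹ := by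
      have h3 := dist_radial_le_add y ω (rad_lt m).le
      have h4 : ‖(y : ℍ[ℝ]) - rad m • (ω : ℍ[ℝ])‖ ≤ 3 * (1 / 2) ^ m := by
        have : 1 - rad m = (1 / 2) ^ m := by unfold rad; ring
        linarith
      have h5 : 0 < ‖(y : ℍ[ℝ]) - rad m • (ω : ℍ[ℝ])‖ :=
        norm_pos_iff.2 (USphere.sub_ne_zero (rad_mem m ω) y)
      calc (((1 / 2 : ℝ) ^ m) ^ 4)⁻¹ = 81 * ((3 * (1 / 2 : ℝ) ^ m) ^ 4)⁻¹ := by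
            field_simp; norm_num
        _ ≤ _ := by gcongr
    have h3 : pois n ω y ≤ 1296 * sqh ^ (n - m) * sqh ^ (n - m) * pois m ω y := by
      unfold pois
      have e : (1 / 2 : ℝ) ^ n = sqh ^ (n - m) * sqh ^ (n - m) * (1 / 2) ^ m := by
        rw [← sqh_sq, ← pow_mul, ← pow_mul, ← pow_add, ← pow_add]; congr 1; omega
      rw [e]
      calc _ ≤ sqh ^ (n - m) * sqh ^ (n - m) * (1 / 2) ^ m *
            (16 * (81 * (‖(y : ℍ[ℝ]) - rad m • (ω : ℍ[ℝ])‖ ^ 4)⁻¹)) := by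
              gcongr; exact h1.trans (by gcongr)
        _ = _ := by ring
    calc √s * pois n ω y ≤ (2 * sqh ^ m) * (1296 * sqh ^ (n - m) * sqh ^ (n - m) * pois m ω y) :=
          mul_le_mul hsq h3 (pois_nonneg _ _ _) (by positivity)
      _ = 2592 * (sqh ^ m * sqh ^ (n - m)) * (sqh ^ (n - m) * pois m ω y) := by ring
      _ = _ := by rw [← pow_add, Nat.add_sub_cancel' hmn]

lemma sum_geom_sqh_le (n : ℕ) : ∑ m ∈ Finset.range n, sqh ^ m ≤ 4 := by
  have h1 := sqh_lt
  have h2 := sqh_pos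
  have h3 := mul_neg_geom_sum sqh n
  have h4 : 0 < sqh ^ n := pow_pos h2 n
  have h5 : 0 ≤ ∑ m ∈ Finset.range n, sqh ^ m := Finset.sum_nonneg fun i _ => (pow_pos h2 i).le
  nlinarith

lemma geom_sqh_le (n : ℕ) : ∑ m ∈ Finset.range (n + 1), sqh ^ (n - m) ≤ 4 := by
  have := Finset.sum_range_reflect (fun k => sqh ^ k) (n + 1)
  simp only [Nat.add_sub_cancel] at this
  rw [this]
  exact sum_geom_sqh_le _

lemma integral_sqrt_pois_le (n : ℕ) (ω : USphere) :
    ∫ y : USphere, √‖(y : ℍ[ℝ]) - ω‖ * pois n ω y ∂sphMeas ≤ 10368 * sqh ^ n := by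
  have hq := sqh_pos
  have hi : ∀ m, Integrable (pois m ω) sphMeas := fun m => integrable_sph (continuous_pois m ω)
  calc _ ≤ ∫ y, 2592 * sqh ^ n * ∑ m ∈ Finset.range (n + 1), sqh ^ (n - m) * pois m ω y ∂sphMeas := by
        refine integral_mono (integrable_sph ?_) ?_ (sqrt_mul_pois_le n ω)
        · exact Continuous.mul (by fun_prop) (continuous_pois n ω)
        · exact (integrable_finsetSum _ fun m _ => (hi m).const_mul _).const_mul _
    _ = 2592 * sqh ^ n * ∑ m ∈ Finset.range (n + 1), sqh ^ (n - m) * ∫ y, pois m ω y ∂sphMeas := by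
        rw [integral_const_mul, integral_finsetSum _ fun m _ => (hi m).const_mul _]
        simp_rw [integral_const_mul]
    _ ≤ 2592 * sqh ^ n * ∑ m ∈ Finset.range (n + 1), sqh ^ (n - m) * 1 := by
        gcongr with m _; exact integral_pois_le m ω
    _ ≤ 2592 * sqh ^ n * 4 := by
        gcongr; simpa using geom_sqh_le n
    _ = _ := by ring

/-- Hölder continuity of order `1/2` on the sphere. -/
def HolS (A : ℝ) (v : USphere → ℍ[ℝ]) : Prop :=
  0 ≤ A ∧ ∀ y y' : USphere, ‖v y - v y'‖ ≤ A * √‖(y : ℍ[ℝ]) - y'‖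

lemma HolS.continuous {A : ℝ} {v : USphere → ℍ[ℝ]} (h : HolS A v) : Continuous v := by
  refine continuous_iff_continuousAt.2 fun y => ?_
  rw [ContinuousAt, tendsto_iff_norm_sub_tendsto_zero]
  have h2 : Filter.Tendsto (fun y' : USphere => A * √‖(y' : ℍ[ℝ]) - y‖) (nhds y) (nhds 0) := by
    have : Continuous fun y' : USphere => A * √‖(y' : ℍ[ℝ]) - y‖ := by fun_prop
    simpa using this.tendsto y
  exact squeeze_zero (fun _ => norm_nonneg _) (fun y' => h.2 y' y) h2

lemma norm_kern_sub_le (n : ℕ) (ω y : USphere) {r : ℝ} (hr : rad n ≤ r) (hr' : r ≤ rad (n + 1)) :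
    ‖kern (r • (ω : ℍ[ℝ])) y - kern (rad n • (ω : ℍ[ℝ])) y‖ ≤ 43 * pois n ω y := by
  have h0 := rad_nonneg n
  have h1 := rad_lt (n + 1)
  have hx := smul_sph_mem (h0.trans hr) (hr'.trans_lt h1) ω
  have hx' := rad_mem n ω
  have e1 : ‖(y - r • (ω : ℍ[ℝ])) - (y - rad n • (ω : ℍ[ℝ]))‖ = r - rad n := by
    rw [sub_sub_sub_cancel_left, ← sub_smul, norm_smul, ω.norm_eq, mul_one, Real.norm_eq_abs,
      abs_sub_comm, abs_of_nonneg (sub_nonneg.2 hr)]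
  have h2 : r - rad n ≤ (1 / 2) ^ n / 2 := by
    have : rad (n + 1) - rad n = (1 / 2) ^ n / 2 := by unfold rad; ring
    linarith
  have h3 : r - rad n ≤ 1 - r := by
    have : 1 - rad n = (1 / 2) ^ n := by unfold rad; ring
    linarith
  have h4 := one_sub_le_dist y ω (h0.trans hr)
  have hp : 0 < ‖(y : ℍ[ℝ]) - r • (ω : ℍ[ℝ])‖ := norm_pos_iff.2 (USphere.sub_ne_zero hx y)
  have hp' : 0 < ‖(y : ℍ[ℝ]) - rad n • (ω : ℍ[ℝ])‖ := norm_pos_iff.2 (USphere.sub_ne_zero hx' y)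
  have h5 : ‖(y : ℍ[ℝ]) - rad n • (ω : ℍ[ℝ])‖ ≤ 2 * ‖(y : ℍ[ℝ]) - r • (ω : ℍ[ℝ])‖ := by
    have := norm_sub_norm_le (y - rad n • (ω : ℍ[ℝ])) (y - r • (ω : ℍ[ℝ]))
    rw [norm_sub_rev (_ - _) (_ - _), e1] at this
    linarith
  have h6 : (‖(y : ℍ[ℝ]) - r • (ω : ℍ[ℝ])‖ ^ 4)⁻¹ ≤
      16 * (‖(y : ℍ[ℝ]) - rad n • (ω : ℍ[ℝ])‖ ^ 4)⁻¹ := by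
    calc (‖(y : ℍ[ℝ]) - r • (ω : ℍ[ℝ])‖ ^ 4)⁻¹
        = 16 * ((2 * ‖(y : ℍ[ℝ]) - r • (ω : ℍ[ℝ])‖) ^ 4)⁻¹ := by field_simp; norm_num
      _ ≤ _ := by gcongr
  have h7 := norm_fsol_sub_le (USphere.sub_ne_zero hx y) (USphere.sub_ne_zero hx' y)
  rw [e1] at h7
  rw [kern, kern, ← mul_sub, norm_mul, y.norm_eq, one_mul]
  refine h7.trans ?_
  unfold pois
  have h8 : 0 ≤ (‖(y : ℍ[ℝ]) - rad n • (ω : ℍ[ℝ])‖ ^ 4)⁻¹ := by positivity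
  calc 5 * (r - rad n) * ((‖(y : ℍ[ℝ]) - r • (ω : ℍ[ℝ])‖ ^ 4)⁻¹ +
      (‖(y : ℍ[ℝ]) - rad n • (ω : ℍ[ℝ])‖ ^ 4)⁻¹)
      ≤ 5 * ((1 / 2) ^ n / 2) * (16 * (‖(y : ℍ[ℝ]) - rad n • (ω : ℍ[ℝ])‖ ^ 4)⁻¹ +
        (‖(y : ℍ[ℝ]) - rad n • (ω : ℍ[ℝ])‖ ^ 4)⁻¹) := by gcongr
    _ ≤ _ := by nlinarith [mul_nonneg (by positivity : (0 : ℝ) ≤ (1 / 2) ^ n) h8]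

lemma cauchy_sub_const {v : USphere → ℍ[ℝ]} (hv : Continuous v) (c : ℍ[ℝ]) {x : ℍ[ℝ]}
    (hx : x ∈ ball (0 : ℍ[ℝ]) 1) : cauchy v x - c = cauchy (fun y => v y - c) x := by
  have h := cauchy_one hx
  simp only [cauchy, one_mul, sub_mul] at h ⊢
  rw [integral_sub (integrable_sph (hv.fun_mul (continuous_kern hx)))
    (integrable_sph (continuous_const.fun_mul (continuous_kern hx))),
    integral_const_mul_of_integrable (integrable_sph (continuous_kern hx)), h, mul_one]

lemma norm_cauchy_step_le {A : ℝ} {v : USphere → ℍ[ℝ]} (h : HolS A v) (n : ℕ) (ω : USphere) {r : ℝ}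
    (hr : rad n ≤ r) (hr' : r ≤ rad (n + 1)) :
    ‖cauchy v (r • (ω : ℍ[ℝ])) - cauchy v (rad n • (ω : ℍ[ℝ]))‖ ≤ 445824 * A * sqh ^ n := by
  have hx := smul_sph_mem ((rad_nonneg n).trans hr) (hr'.trans_lt (rad_lt _)) ω
  have hx' := rad_mem n ω
  have hv := h.continuous
  have hw : Continuous fun y => v y - v ω := hv.sub continuous_const
  rw [← sub_sub_sub_cancel_right _ _ (v ω), cauchy_sub_const hv _ hx, cauchy_sub_const hv _ hx',
    cauchy, cauchy, ← integral_sub (integrable_sph (hw.fun_mul (continuous_kern hx)))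
      (integrable_sph (hw.fun_mul (continuous_kern hx')))]
  refine (norm_integral_le_integral_norm _).trans ?_
  have hc : Continuous fun y : USphere => √‖(y : ℍ[ℝ]) - ω‖ * pois n ω y :=
    Continuous.mul (by fun_prop) (continuous_pois n ω)
  calc _ ≤ ∫ y : USphere, 43 * A * (√‖(y : ℍ[ℝ]) - ω‖ * pois n ω y) ∂sphMeas := by
        refine integral_mono (integrable_sph ?_) ((integrable_sph hc).const_mul _) fun y => ?_
        · exact ((hw.fun_mul (continuous_kern hx)).sub (hw.fun_mul (continuous_kern hx'))).norm
        · dsimp only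
          rw [← mul_sub, norm_mul]
          calc _ ≤ (A * √‖(y : ℍ[ℝ]) - ω‖) * (43 * pois n ω y) :=
                mul_le_mul (h.2 y ω) (norm_kern_sub_le n ω y hr hr') (norm_nonneg _)
                  (mul_nonneg h.1 (Real.sqrt_nonneg _))
            _ = _ := by ring
    _ ≤ 43 * A * (10368 * sqh ^ n) := by
        rw [integral_const_mul]
        exact mul_le_mul_of_nonneg_left (integral_sqrt_pois_le n ω) (by linarith [h.1])
    _ = _ := by ring

lemma norm_cauchy_chain_le {A : ℝ} {v : USphere → ℍ[ℝ]} (h : HolS A v) (n k : ℕ) (ω : USphere)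
    {r : ℝ} (hr : rad (n + k) ≤ r) (hr' : r ≤ rad (n + k + 1)) :
    ‖cauchy v (r • (ω : ℍ[ℝ])) - cauchy v (rad n • (ω : ℍ[ℝ]))‖ ≤
      445824 * A * sqh ^ n * ∑ i ∈ Finset.range (k + 1), sqh ^ i := by
  induction k generalizing r with
  | zero => simpa using norm_cauchy_step_le h n ω hr hr'
  | succ k ih =>
    have h1 : rad (n + k) ≤ rad (n + (k + 1)) := by
      have : (0 : ℝ) < (1 / 2) ^ (n + k) := by positivity
      unfold rad; rw [← add_assoc, pow_succ]; linarith
    have h2 := ih (r := rad (n + (k + 1))) h1 le_rfl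
    have h3 := norm_cauchy_step_le h _ ω hr hr'
    rw [Finset.sum_range_succ, mul_add, mul_assoc _ (sqh ^ n) (sqh ^ (k + 1)), ← pow_add]
    linarith [norm_sub_le_norm_sub_add_norm_sub (cauchy v (r • (ω : ℍ[ℝ])))
      (cauchy v (rad (n + (k + 1)) • (ω : ℍ[ℝ]))) (cauchy v (rad n • (ω : ℍ[ℝ])))]

lemma exists_rad_le {n : ℕ} {r : ℝ} (hr : rad n ≤ r) (hr' : r < 1) :
    ∃ k, rad (n + k) ≤ r ∧ r ≤ rad (n + k + 1) := by
  have h1 : 1 - r ≤ (1 / 2) ^ n := by unfold rad at hr; linarith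
  obtain ⟨m, hm, hm'⟩ := exists_nat_pow_near_of_lt_one (x := 1 - r) (y := 1 / 2) (by linarith)
    (by linarith [rad_nonneg n]) (by norm_num) (by norm_num)
  rcases le_or_gt n m with h | h
  · refine ⟨m - n, ?_, ?_⟩ <;> rw [Nat.add_sub_cancel' h] <;> unfold rad <;> linarith
  · have : (1 / 2 : ℝ) ^ n ≤ (1 / 2) ^ (m + 1) :=
      pow_le_pow_of_le_one (by norm_num) (by norm_num) h
    linarith

/-- The constant of the near-boundary estimate of the Cauchy integral. -/
def cB : ℝ := 1783296

lemma norm_cauchy_sub_le {A : ℝ} {v : USphere → ℍ[ℝ]} (h : HolS A v) (n : ℕ) (ω : USphere) {r : ℝ}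
    (hr : rad n ≤ r) (hr' : r < 1) :
    ‖cauchy v (r • (ω : ℍ[ℝ])) - cauchy v (rad n • (ω : ℍ[ℝ]))‖ ≤ cB * A * sqh ^ n := by
  obtain ⟨k, hk, hk'⟩ := exists_rad_le hr hr'
  refine (norm_cauchy_chain_le h n k ω hk hk').trans ?_
  have h1 := mul_le_mul_of_nonneg_left (sum_geom_sqh_le (k + 1))
    (mul_nonneg (mul_nonneg (by norm_num : (0 : ℝ) ≤ 445824) h.1) (pow_pos sqh_pos n).le)
  refine h1.trans_eq ?_
  unfold cB; ring

lemma tendsto_sqh_pow : Filter.Tendsto (fun n : ℕ => sqh ^ n) Filter.atTop (nhds 0) :=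
  tendsto_pow_atTop_nhds_zero_of_lt_one sqh_pos.le (sqh_lt.trans (by norm_num))

/-- The Cauchy integral, with its radial limits on the boundary. -/
def cext (v : USphere → ℍ[ℝ]) (z : ℍ[ℝ]) : ℍ[ℝ] :=
  open Classical in
  if ‖z‖ < 1 then cauchy v z else Filter.limUnder Filter.atTop fun n => cauchy v (rad n • z)

lemma cext_eq {v : USphere → ℍ[ℝ]} {z : ℍ[ℝ]} (hz : z ∈ ball (0 : ℍ[ℝ]) 1) :
    cext v z = cauchy v z := if_pos (mem_ball_zero_iff.1 hz)

lemma rad_mono {m n : ℕ} (h : m ≤ n) : rad m ≤ rad n := by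
  have : (1 / 2 : ℝ) ^ n ≤ (1 / 2) ^ m := pow_le_pow_of_le_one (by norm_num) (by norm_num) h
  unfold rad; linarith

lemma tendsto_cext {A : ℝ} {v : USphere → ℍ[ℝ]} (h : HolS A v) (ω : USphere) :
    Filter.Tendsto (fun n => cauchy v (rad n • (ω : ℍ[ℝ]))) Filter.atTop (nhds (cext v ω)) := by
  have h1 : CauchySeq fun n => cauchy v (rad n • (ω : ℍ[ℝ])) := by
    refine cauchySeq_of_le_geometric sqh (cB * A) (sqh_lt.trans (by norm_num)) fun n => ?_
    rw [dist_eq_norm, norm_sub_rev]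
    exact norm_cauchy_sub_le h n ω (rad_mono n.le_succ) (rad_lt _)
  have h2 := h1.tendsto_limUnder
  rwa [cext, if_neg (by simp [ω.norm_eq])]

lemma norm_cext_sub_le {A : ℝ} {v : USphere → ℍ[ℝ]} (h : HolS A v) (n : ℕ) (ω : USphere) {r : ℝ}
    (hr : rad n ≤ r) (hr' : r ≤ 1) :
    ‖cext v (r • (ω : ℍ[ℝ])) - cauchy v (rad n • (ω : ℍ[ℝ]))‖ ≤ cB * A * sqh ^ n := by
  rcases hr'.eq_or_lt with rfl | hlt
  · rw [one_smul]
    refine le_of_tendsto ((tendsto_cext h ω).sub_const _).norm ?_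
    filter_upwards [Filter.eventually_ge_atTop n] with m hm
    exact norm_cauchy_sub_le h n ω (rad_mono hm) (rad_lt m)
  · rw [cext_eq (smul_sph_mem ((rad_nonneg n).trans hr) hlt ω)]
    exact norm_cauchy_sub_le h n ω hr hlt

/-- The radial projection onto the ball of radius `1 - 2⁻ⁿ`. -/
def rproj (n : ℕ) (z : ℍ[ℝ]) : ℍ[ℝ] := (rad n / max (rad n) ‖z‖) • z

lemma rad_pos {n : ℕ} (hn : n ≠ 0) : 0 < rad n := by
  have := pow_lt_one₀ (by norm_num : (0 : ℝ) ≤ 1 / 2) (by norm_num) hn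
  unfold rad; linarith

lemma norm_rproj_le (n : ℕ) (z : ℍ[ℝ]) : ‖rproj n z‖ ≤ rad n := by
  have h := rad_nonneg n
  have h1 : 0 ≤ max (rad n) ‖z‖ := h.trans (le_max_left _ _)
  rw [rproj, norm_smul, Real.norm_of_nonneg (div_nonneg h h1), div_mul_eq_mul_div]
  exact div_le_of_le_mul₀ h1 h (mul_le_mul_of_nonneg_left (le_max_right _ _) h)

lemma rproj_mem (n : ℕ) (z : ℍ[ℝ]) : rproj n z ∈ ball (0 : ℍ[ℝ]) 1 :=
  mem_ball_zero_iff.2 ((norm_rproj_le n z).trans_lt (rad_lt n))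

lemma continuous_rproj {n : ℕ} (hn : n ≠ 0) : Continuous (rproj n) := by
  unfold rproj
  refine Continuous.fun_smul (Continuous.div₀ (by fun_prop) (by fun_prop) fun z => ?_) (by fun_prop)
  exact ((rad_pos hn).trans_le (le_max_left _ _)).ne'

lemma smul_toSph {z : ℍ[ℝ]} (hz : z ≠ 0) : ‖z‖ • (toSph z hz : ℍ[ℝ]) = z := by
  simp [toSph, smul_smul, norm_ne_zero_iff.2 hz]

lemma rproj_of_le {n : ℕ} {z : ℍ[ℝ]} (hz : z ≠ 0) (h : rad n ≤ ‖z‖) :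
    rproj n z = rad n • (toSph z hz : ℍ[ℝ]) := by
  rw [rproj, max_eq_right h]
  simp [toSph, smul_smul, div_eq_mul_inv]

lemma norm_cext_sub_rproj_le {A : ℝ} {v : USphere → ℍ[ℝ]} (h : HolS A v) {n : ℕ} (hn : n ≠ 0)
    {z : ℍ[ℝ]} (hz : ‖z‖ ≤ 1) :
    ‖cext v z - cauchy v (rproj n z)‖ ≤ cB * A * sqh ^ n := by
  have hp := rad_pos hn
  rcases le_total ‖z‖ (rad n) with hle | hle
  · have h1 : rproj n z = z := by rw [rproj, max_eq_left hle, div_self hp.ne', one_smul]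
    rw [h1, cext_eq (mem_ball_zero_iff.2 (hle.trans_lt (rad_lt n))), sub_self, norm_zero]
    exact mul_nonneg (mul_nonneg (by norm_num [cB]) h.1) (pow_pos sqh_pos n).le
  · have hz0 : z ≠ 0 := norm_pos_iff.1 (hp.trans_le hle)
    rw [rproj_of_le hz0 hle]
    have := norm_cext_sub_le h n (toSph z hz0) hle hz
    rwa [smul_toSph] at this

lemma continuousOn_cext {A : ℝ} {v : USphere → ℍ[ℝ]} (h : HolS A v) :
    ContinuousOn (cext v) (closedBall 0 1) := by
  have h1 : TendstoUniformlyOn (fun n z => cauchy v (rproj (n + 1) z)) (cext v) Filter.atTop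
      (closedBall 0 1) := by
    rw [Metric.tendstoUniformlyOn_iff]
    intro ε hε
    have h2 : Filter.Tendsto (fun n : ℕ => cB * A * sqh ^ (n + 1)) Filter.atTop (nhds 0) := by
      simpa using (tendsto_sqh_pow.comp (Filter.tendsto_add_atTop_nat 1)).const_mul (cB * A)
    filter_upwards [h2.eventually (gt_mem_nhds hε)] with n hn z hz
    rw [dist_eq_norm]
    exact (norm_cext_sub_rproj_le h n.succ_ne_zero (by simpa using hz)).trans_lt hn
  refine h1.continuousOn (Filter.Eventually.of_forall fun n => ?_).frequently
  exact ((contDiffOn_cauchy h.continuous).continuousOn.comp_continuous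
    (continuous_rproj n.succ_ne_zero) fun z => rproj_mem _ z).continuousOn

lemma memK_cext {A : ℝ} {v : USphere → ℍ[ℝ]} (h : HolS A v) : memK (cext v) := by
  refine ⟨continuousOn_cext h, (contDiffOn_cauchy h.continuous).congr fun z hz => cext_eq hz,
    fun z hz => ?_⟩
  rw [← Dirac_cauchy h.continuous hz, Dirac, Dirac]
  have : cext v =ᶠ[nhds z] cauchy v := by
    filter_upwards [isOpen_ball.mem_nhds hz] with w hw using cext_eq hw
  rw [this.fderiv_eq]

lemma star_smul_sph (r : ℝ) (ω : USphere) :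
    star (r • (ω : ℍ[ℝ])) = r • (cj ω : ℍ[ℝ]) := by rw [Quaternion.star_smul, cj_coe]

/-- The boundary identity for folded Hölder functions. -/
lemma cext_fold {A : ℝ} {v : USphere → ℍ[ℝ]} (h : HolS A v) (hs : FoldSym v) (ω : USphere) :
    cext v ω + cext v (star (ω : ℍ[ℝ])) * star (ω : ℍ[ℝ]) = v ω := by
  have hv := h.continuous
  have t1 : Filter.Tendsto (fun n => cauchy v (rad n • (ω : ℍ[ℝ])) +
      cauchy v (rad n • (cj ω : ℍ[ℝ])) * (rad n • (cj ω : ℍ[ℝ]))) Filter.atTop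
      (nhds (cext v ω + cext v (cj ω) * (cj ω : ℍ[ℝ]))) := by
    refine (tendsto_cext h ω).add ((tendsto_cext h (cj ω)).mul ?_)
    have h1 : Filter.Tendsto (fun n => rad n) Filter.atTop (nhds 1) := by
      have := tendsto_pow_atTop_nhds_zero_of_lt_one (by norm_num : (0 : ℝ) ≤ 1 / 2) (by norm_num)
      simpa [rad] using this.const_sub 1
    simpa using h1.smul_const (cj ω : ℍ[ℝ])
  refine tendsto_nhds_unique t1 ?_
  rw [tendsto_iff_norm_sub_tendsto_zero]
  refine squeeze_zero (g := fun n => 2 * A * (10368 * sqh ^ n)) (fun _ => norm_nonneg _)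
    (fun n => ?_) (by simpa using (tendsto_sqh_pow.const_mul (10368 : ℝ)).const_mul (2 * A))
  have hx := rad_mem n ω
  rw [← star_smul_sph, cauchy_fold hv hs hx]
  have hr := rad_nonneg n
  have hr' := rad_lt n
  have hP : Continuous fun y : USphere => (1 - ‖rad n • (ω : ℍ[ℝ])‖ ^ 2) *
      (‖(y : ℍ[ℝ]) - rad n • (ω : ℍ[ℝ])‖ ^ 4)⁻¹ := continuous_const.mul (continuous_inv_dist hx 4)
  have e : v ω = ∫ y : USphere, ((1 - ‖rad n • (ω : ℍ[ℝ])‖ ^ 2) *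
      (‖(y : ℍ[ℝ]) - rad n • (ω : ℍ[ℝ])‖ ^ 4)⁻¹) • v ω ∂sphMeas := by
    rw [integral_smul_const, integral_const_mul, poisson_norm hx, mul_inv_cancel₀, one_smul]
    rw [norm_smul_sph hr]; nlinarith
  refine (congrArg (fun c => ‖_ - c‖) e).trans_le ?_
  rw [← integral_sub (integrable_sph (hP.fun_smul hv)) (integrable_sph (hP.fun_smul continuous_const))]
  refine (norm_integral_le_integral_norm _).trans ?_
  have hc : Continuous fun y : USphere => √‖(y : ℍ[ℝ]) - ω‖ * pois n ω y :=
    Continuous.mul (by fun_prop) (continuous_pois n ω)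
  calc _ ≤ ∫ y : USphere, 2 * A * (√‖(y : ℍ[ℝ]) - ω‖ * pois n ω y) ∂sphMeas := by
        refine integral_mono (integrable_sph ?_) ((integrable_sph hc).const_mul _) fun y => ?_
        · exact ((hP.fun_smul hv).sub (hP.fun_smul continuous_const)).norm
        · dsimp only
          rw [← smul_sub, norm_smul, norm_smul_sph hr, norm_mul, norm_inv, norm_pow, norm_norm,
            Real.norm_of_nonneg (by nlinarith)]
          have h2 : 1 - rad n ^ 2 ≤ 2 * (1 / 2) ^ n := by
            have : (1 / 2 : ℝ) ^ n = 1 - rad n := by unfold rad; ring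
            rw [this]; nlinarith
          calc _ ≤ 2 * (1 / 2) ^ n * (‖(y : ℍ[ℝ]) - rad n • (ω : ℍ[ℝ])‖ ^ 4)⁻¹ *
                (A * √‖(y : ℍ[ℝ]) - ω‖) := by
                  have := h.2 y ω
                  gcongr
            _ = _ := by unfold pois; ring
    _ ≤ _ := by
        rw [integral_const_mul]
        exact mul_le_mul_of_nonneg_left (integral_sqrt_pois_le n ω) (by linarith [h.1])

lemma hasDerivAt_integral_sph {U : Set ℝ} (hU : IsOpen U) {F F' : ℝ → USphere → ℍ[ℝ]}
    (hF : ContinuousOn (Function.uncurry F) (U ×ˢ Set.univ))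
    (hF' : ContinuousOn (Function.uncurry F') (U ×ˢ Set.univ))
    (hd : ∀ t ∈ U, ∀ y, HasDerivAt (fun s => F s y) (F' t y) t) {t : ℝ} (ht : t ∈ U) :
    HasDerivAt (fun s => ∫ y, F s y ∂sphMeas) (∫ y, F' t y ∂sphMeas) t := by
  have := hasDerivAt_integral_param (μ := sphMeas) hU isCompact_univ MeasurableSet.univ hF hF'
    (fun t ht y _ => hd t ht y) ht
  simpa only [Measure.restrict_univ] using this

/-- The unit quaternion `cos t + sin t e` for an imaginary unit `e`. -/
def rotor (j : Fin 4) (hj : j ≠ 0) (t : ℝ) : USphere :=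
  ⟨Real.cos t • 1 + Real.sin t • qe j, by
    rw [mem_sphere_zero_iff_norm, ← sq_eq_sq₀ (norm_nonneg _) zero_le_one, sq,
      ← Quaternion.normSq_eq_norm_mul_self, Quaternion.normSq_def', one_pow]
    refine Eq.trans ?_ (Real.cos_sq_add_sin_sq t)
    fin_cases j
    · exact absurd rfl hj
    all_goals simp⟩

/-- Integration by parts on the sphere. -/
lemma integral_tangent {g : ℍ[ℝ] → ℍ[ℝ]} {g' : ℍ[ℝ] → EndL ℍ[ℝ]}
    (hg : ∀ z ∈ sphere (0 : ℍ[ℝ]) 1, HasFDerivAt g (g' z) z)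
    (hg' : ContinuousOn g' (sphere 0 1)) {j : Fin 4} (hj : j ≠ 0) :
    ∫ y : USphere, g' y (y * qe j) ∂sphMeas = 0 := by
  let m : ℝ → USphere → USphere := fun t y => sphIso (rmul (rotor j hj t)) y
  have hm : ∀ t y, (m t y : ℍ[ℝ]) = y * (Real.cos t • 1 + Real.sin t • qe j) := fun t y => rfl
  have hmc : Continuous fun p : ℝ × USphere => (m p.1 p.2 : ℍ[ℝ]) := by
    simp only [hm]; fun_prop
  have hgc : ContinuousOn g (sphere 0 1) := fun z hz => (hg z hz).continuousAt.continuousWithinAt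
  have key := hasDerivAt_integral_sph (U := Set.univ) isOpen_univ
    (F := fun t y => g (m t y))
    (F' := fun t y => g' (m t y) (y * (-Real.sin t • 1 + Real.cos t • qe j))) ?_ ?_ ?_
    (Set.mem_univ 0)
  · have h0 : HasDerivAt (fun s => ∫ y, g (m s y) ∂sphMeas) 0 0 := by
      have : (fun s => ∫ y, g (m s y) ∂sphMeas) = fun _ => ∫ y : USphere, g y ∂sphMeas :=
        funext fun s => integral_sphIso _ fun y : USphere => g y
      rw [this]; exact hasDerivAt_const _ _
    have := key.unique h0
    simpa [hm] using this
  · exact (hgc.comp_continuous hmc fun p => (m p.1 p.2).2).continuousOn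
  · refine Continuous.continuousOn ?_
    exact (hg'.comp_continuous hmc fun p => (m p.1 p.2).2).clm_apply (by fun_prop)
  · intro t _ y
    refine (hg _ (m t y).2).comp_hasDerivAt t ?_
    have h1 := ((Real.hasDerivAt_cos t).smul_const (1 : ℍ[ℝ])).add
      ((Real.hasDerivAt_sin t).smul_const (qe j))
    exact ((ContinuousLinearMap.mul ℝ ℍ[ℝ] (y : ℍ[ℝ])).hasFDerivAt).comp_hasDerivAt t h1

lemma eq_sum_qe (x : ℍ[ℝ]) :
    x = x.re • qe 0 + x.imI • qe 1 + x.imJ • qe 2 + x.imK • qe 3 := by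
  apply Quaternion.ext <;> simp

/-- The Dirac symbol is invariant under left rotation of the frame. -/
lemma symb_frame (L : EndL ℍ[ℝ]) (y : USphere) :
    symb L = ∑ j : Fin 4, L (y * qe j) * (y * qe j) := by
  have hy : (y : ℍ[ℝ]).re ^ 2 + (y : ℍ[ℝ]).imI ^ 2 + (y : ℍ[ℝ]).imJ ^ 2 + (y : ℍ[ℝ]).imK ^ 2 = 1 := by
    rw [← Quaternion.normSq_def', Quaternion.normSq_eq_norm_mul_self, y.norm_eq, one_mul]
  have e : ∀ x : ℍ[ℝ], L x = x.re • L (qe 0) + x.imI • L (qe 1) + x.imJ • L (qe 2) +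
      x.imK • L (qe 3) := fun x => by
    conv_lhs => rw [eq_sum_qe x]
    simp only [map_add, map_smul]
  have h : ∀ k : Fin 4 → ℍ[ℝ],
      k 0 * qe 0 + k 1 * qe 1 + k 2 * qe 2 + k 3 * qe 3 =
      ∑ j : Fin 4, ((y * qe j : ℍ[ℝ]).re • k 0 + (y * qe j : ℍ[ℝ]).imI • k 1 +
        (y * qe j : ℍ[ℝ]).imJ • k 2 + (y * qe j : ℍ[ℝ]).imK • k 3) * (y * qe j) := by
    intro k
    have h0 : ∀ i : Fin 4, (∑ j : Fin 4, (![(y * qe j : ℍ[ℝ]).re, (y * qe j : ℍ[ℝ]).imI,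
        (y * qe j : ℍ[ℝ]).imJ, (y * qe j : ℍ[ℝ]).imK] i) • (y * qe j : ℍ[ℝ])) = qe i := by
      intro i
      fin_cases i <;> apply Quaternion.ext <;> simp [Fin.sum_univ_four] <;>
        first | ring1 | linear_combination hy
    have h1 := h0 0
    have h2 := h0 1
    have h3 := h0 2
    have h4 := h0 3
    simp only [Fin.isValue, Matrix.cons_val] at h1 h2 h3 h4
    rw [← h1, ← h2, ← h3, ← h4]
    simp only [Fin.sum_univ_four, add_mul, mul_add, smul_mul_assoc, mul_smul_comm]
    abel
  rw [symb, Fin.sum_univ_four, h fun j => L (qe j)]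
  exact Finset.sum_congr rfl fun j _ => by rw [e (y * qe j)]

lemma affine_mem {a : ℍ[ℝ]} {t : ℝ} (h : ‖a‖ + |t| < 1) {z : ℍ[ℝ]} (hz : ‖z‖ = 1) :
    a + t • z ∈ ball (0 : ℍ[ℝ]) 1 := by
  rw [mem_ball_zero_iff]
  refine (norm_add_le _ _).trans_lt ?_
  rwa [norm_smul, hz, mul_one, Real.norm_eq_abs]

lemma ContDiffOn.hasFDerivAt_ball {f : ℍ[ℝ] → ℍ[ℝ]} (hf : ContDiffOn ℝ 1 f (ball 0 1)) {z : ℍ[ℝ]}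
    (hz : z ∈ ball (0 : ℍ[ℝ]) 1) : HasFDerivAt f (fderiv ℝ f z) z :=
  ((hf.differentiableOn one_ne_zero).differentiableAt (isOpen_ball.mem_nhds hz)).hasFDerivAt

lemma ContDiffOn.continuousOn_fderiv_ball {f : ℍ[ℝ] → ℍ[ℝ]} (hf : ContDiffOn ℝ 1 f (ball 0 1)) :
    ContinuousOn (fderiv ℝ f) (ball 0 1) :=
  hf.continuousOn_fderiv_of_isOpen isOpen_ball le_rfl

lemma continuousOn_affine {F : Type*} [TopologicalSpace F] {f : ℍ[ℝ] → F}
    (hf : ContinuousOn f (ball 0 1)) {a : ℍ[ℝ]} {t : ℝ} (h : ‖a‖ + |t| < 1) :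
    ContinuousOn (fun z => f (a + t • z)) (sphere 0 1) :=
  hf.comp (f := fun z => a + t • z) (by fun_prop) fun z hz =>
    affine_mem h (mem_sphere_zero_iff_norm.1 hz)

lemma continuous_affine_sph {F : Type*} [TopologicalSpace F] {f : ℍ[ℝ] → F}
    (hf : ContinuousOn f (ball 0 1)) {a : ℍ[ℝ]} {t : ℝ} (h : ‖a‖ + |t| < 1) :
    Continuous fun y : USphere => f (a + t • (y : ℍ[ℝ])) :=
  (continuousOn_affine hf h).comp_continuous continuous_subtype_val fun y => y.2

lemma integral_tangent_mul {f q : ℍ[ℝ] → ℍ[ℝ]} {q' : ℍ[ℝ] → EndL ℍ[ℝ]}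
    (hf : ContDiffOn ℝ 1 f (ball 0 1)) (hq : ∀ z, HasFDerivAt q (q' z) z) (hq' : Continuous q')
    {a : ℍ[ℝ]} {t : ℝ} (h : ‖a‖ + |t| < 1) {j : Fin 4} (hj : j ≠ 0) :
    ∫ y : USphere, (t • (fderiv ℝ f (a + t • (y : ℍ[ℝ])) (y * qe j) * q y) +
      f (a + t • (y : ℍ[ℝ])) * q' y (y * qe j)) ∂sphMeas = 0 := by
  have hqc : Continuous q := continuous_iff_continuousAt.2 fun z => (hq z).continuousAt
  have key := integral_tangent (g := fun z => f (a + t • z) * q z)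
    (g' := fun z => ((ContinuousLinearMap.mul ℝ ℍ[ℝ]).flip (q z)).comp
      (t • fderiv ℝ f (a + t • z)) + (ContinuousLinearMap.mul ℝ ℍ[ℝ] (f (a + t • z))).comp (q' z))
    (fun z hz => ?_) ?_ hj
  · refine Eq.trans (integral_congr_ae (ae_of_all _ fun y => ?_)) key
    simp
  · have h1 : HasFDerivAt (fun z : ℍ[ℝ] => a + t • z) (t • ContinuousLinearMap.id ℝ ℍ[ℝ]) z :=
      ((hasFDerivAt_id z).const_smul t).const_add a
    have h2 := (hf.hasFDerivAt_ball (affine_mem h (mem_sphere_zero_iff_norm.1 hz))).comp z h1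
    refine (h2.mul' (hq z)).congr_fderiv ?_
    ext v : 1
    simp [add_comm]
  · refine ContinuousOn.fun_add (ContinuousOn.clm_comp ?_ ?_) (ContinuousOn.clm_comp ?_ hq'.continuousOn)
    · exact ((ContinuousLinearMap.mul ℝ ℍ[ℝ]).flip.continuous.comp hqc).continuousOn
    · exact (continuousOn_affine hf.continuousOn_fderiv_ball h).const_smul t
    · exact (ContinuousLinearMap.mul ℝ ℍ[ℝ]).continuous.comp_continuousOn
        (continuousOn_affine hf.continuousOn h)

lemma integral_coe_sph : ∫ y : USphere, (y : ℍ[ℝ]) ∂sphMeas = 0 := by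
  have h := integral_sphIso (LinearIsometryEquiv.neg ℝ) fun y : USphere => (y : ℍ[ℝ])
  simp only [sphIso_coe, LinearIsometryEquiv.coe_neg, integral_neg] at h
  generalize (∫ y : USphere, (y : ℍ[ℝ]) ∂sphMeas) = x at h ⊢
  have h2 : (2 : ℝ) • x = 0 := by rw [two_smul]; nth_rewrite 1 [← h]; exact neg_add_cancel x
  exact (smul_eq_zero.1 h2).resolve_left two_ne_zero

lemma frame_sum {f : ℍ[ℝ] → ℍ[ℝ]} {z : ℍ[ℝ]} (h : Dirac f z = 0) (y : USphere) :
    ∑ j : Fin 3, fderiv ℝ f z (y * qe j.succ) * (y * qe j.succ) = -(fderiv ℝ f z y * y) := by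
  have h1 := symb_frame (fderiv ℝ f z) y
  rw [← Dirac_eq_symb, h, Fin.sum_univ_succ] at h1
  simp only [qe_zero, mul_one] at h1
  exact eq_neg_of_add_eq_zero_right h1.symm

lemma qe_succ_mul_self (j : Fin 3) : qe j.succ * qe j.succ = -1 := by
  fin_cases j <;> apply Quaternion.ext <;> simp [show (Fin.succ 1 : Fin 4) = 2 from rfl, show (Fin.succ 2 : Fin 4) = 3 from rfl]

lemma star_qe_succ (j : Fin 3) : star (qe j.succ) = -qe j.succ := by
  fin_cases j <;> apply Quaternion.ext <;> simp [show (Fin.succ 1 : Fin 4) = 2 from rfl, show (Fin.succ 2 : Fin 4) = 3 from rfl]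

lemma integral_fderiv_mul {f : ℍ[ℝ] → ℍ[ℝ]} (hf : ContDiffOn ℝ 1 f (ball 0 1))
    (hD : ∀ z ∈ ball (0 : ℍ[ℝ]) 1, Dirac f z = 0) {a : ℍ[ℝ]} {t : ℝ} (h : ‖a‖ + |t| < 1) :
    ∫ y : USphere, (t • (fderiv ℝ f (a + t • (y : ℍ[ℝ])) y * y) +
      (3 : ℝ) • (f (a + t • (y : ℍ[ℝ])) * y)) ∂sphMeas = 0 := by
  have c1 := continuous_affine_sph hf.continuousOn_fderiv_ball h
  have c2 := continuous_affine_sph hf.continuousOn h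
  have key : ∀ j : Fin 3, ∫ y : USphere, (t • (fderiv ℝ f (a + t • (y : ℍ[ℝ])) (y * qe j.succ) *
      (y * qe j.succ)) + -(f (a + t • (y : ℍ[ℝ])) * y)) ∂sphMeas = 0 := fun j => by
    refine Eq.trans (integral_congr_ae (ae_of_all _ fun y => ?_))
      (integral_tangent_mul (q := fun z => z * qe j.succ)
      (q' := fun _ => (ContinuousLinearMap.mul ℝ ℍ[ℝ]).flip (qe j.succ)) hf
      (fun z => ((ContinuousLinearMap.mul ℝ ℍ[ℝ]).flip (qe j.succ)).hasFDerivAt) continuous_const h (Fin.succ_ne_zero j))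
    simp [mul_assoc, qe_succ_mul_self]
  have hs : ∑ j : Fin 3, ∫ y : USphere, (t • (fderiv ℝ f (a + t • (y : ℍ[ℝ])) (y * qe j.succ) *
      (y * qe j.succ)) + -(f (a + t • (y : ℍ[ℝ])) * y)) ∂sphMeas = 0 := by simp only [key]; simp
  rw [← integral_finsetSum] at hs
  · refine neg_eq_zero.1 ((integral_neg _).symm.trans
      (Eq.trans (integral_congr_ae (ae_of_all _ fun y => ?_)) hs))
    beta_reduce
    rw [Finset.sum_add_distrib, ← Finset.smul_sum, frame_sum (hD _ (affine_mem h y.norm_eq))]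
    simp only [Finset.sum_const, Finset.card_univ, Fintype.card_fin, smul_neg, neg_add,
      ← Nat.cast_smul_eq_nsmul ℝ]
    norm_num
  · intro j _
    refine integrable_sph ?_
    exact (((c1.clm_apply (by fun_prop)).fun_mul (by fun_prop)).const_smul t).add
      ((c2.fun_mul (by fun_prop)).neg)

lemma integral_fderiv {f : ℍ[ℝ] → ℍ[ℝ]} (hf : ContDiffOn ℝ 1 f (ball 0 1))
    (hD : ∀ z ∈ ball (0 : ℍ[ℝ]) 1, Dirac f z = 0) {a : ℍ[ℝ]} {t : ℝ} (h : ‖a‖ + |t| < 1) :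
    ∫ y : USphere, fderiv ℝ f (a + t • (y : ℍ[ℝ])) y ∂sphMeas = 0 := by
  rcases eq_or_ne t 0 with rfl | ht
  · simp only [zero_smul, add_zero]
    rw [ContinuousLinearMap.integral_comp_comm _ (integrable_sph continuous_subtype_val),
      integral_coe_sph, map_zero]
  have c1 := continuous_affine_sph hf.continuousOn_fderiv_ball h
  have key : ∀ j : Fin 3, ∫ y : USphere, t • (fderiv ℝ f (a + t • (y : ℍ[ℝ])) (y * qe j.succ) *
      (y * qe j.succ) * star (y : ℍ[ℝ])) ∂sphMeas = 0 := fun j => by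
    refine Eq.trans (integral_congr_ae (ae_of_all _ fun y => ?_))
      (integral_tangent_mul (q := fun z => z * qe j.succ * star z)
      (q' := fun z => ((ContinuousLinearMap.mul ℝ ℍ[ℝ]) (z * qe j.succ)).comp conjL +
        (ContinuousLinearMap.mul ℝ ℍ[ℝ]).flip (qe j.succ * star z)) hf
      (fun z => ?_) ?_ h (Fin.succ_ne_zero j))
    · beta_reduce
      have e : (y : ℍ[ℝ]) * qe j.succ * star ((y : ℍ[ℝ]) * qe j.succ) +
          (y : ℍ[ℝ]) * qe j.succ * (qe j.succ * star (y : ℍ[ℝ])) = 0 := by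
        rw [StarMul.star_mul, star_qe_succ]; noncomm_ring
      have e' : (((ContinuousLinearMap.mul ℝ ℍ[ℝ]) ((y : ℍ[ℝ]) * qe j.succ)).comp conjL +
        (ContinuousLinearMap.mul ℝ ℍ[ℝ]).flip (qe j.succ * star (y : ℍ[ℝ])))
          ((y : ℍ[ℝ]) * qe j.succ) = 0 := e
      rw [e', mul_zero, add_zero]
      simp only [mul_assoc]
    · have h1 : HasFDerivAt (fun z : ℍ[ℝ] => z * qe j.succ)
        ((ContinuousLinearMap.mul ℝ ℍ[ℝ]).flip (qe j.succ)) z :=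
        ((ContinuousLinearMap.mul ℝ ℍ[ℝ]).flip (qe j.succ)).hasFDerivAt
      refine (h1.mul' conjL.hasFDerivAt).congr_fderiv ?_
      ext v : 1
      simp [mul_assoc]
    · refine Continuous.add (Continuous.clm_comp ?_ continuous_const) ?_
      · exact (ContinuousLinearMap.mul ℝ ℍ[ℝ]).continuous.comp (by fun_prop)
      · exact (ContinuousLinearMap.mul ℝ ℍ[ℝ]).flip.continuous.comp (by fun_prop)
  have hs : ∑ j : Fin 3, ∫ y : USphere, t • (fderiv ℝ f (a + t • (y : ℍ[ℝ])) (y * qe j.succ) *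
      (y * qe j.succ) * star (y : ℍ[ℝ])) ∂sphMeas = 0 := by simp only [key]; simp
  rw [← integral_finsetSum] at hs
  · have e : ∀ y : USphere, ∑ j : Fin 3, t • (fderiv ℝ f (a + t • (y : ℍ[ℝ])) (y * qe j.succ) *
      (y * qe j.succ) * star (y : ℍ[ℝ])) = (-t) • fderiv ℝ f (a + t • (y : ℍ[ℝ])) y := fun y => by
      rw [← Finset.smul_sum, ← Finset.sum_mul, frame_sum (hD _ (affine_mem h y.norm_eq)), neg_mul,
        mul_assoc, y.mul_star, mul_one, smul_neg, neg_smul]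
    simp only [e, integral_smul] at hs
    exact (smul_eq_zero.1 hs).resolve_left (neg_ne_zero.2 ht)
  · intro j _
    refine integrable_sph ?_
    exact ((((c1.clm_apply (by fun_prop)).fun_mul (by fun_prop)).fun_mul (by fun_prop)).const_smul t)

lemma eq_of_hasDerivAt_zero {F : ℝ → ℍ[ℝ]} {R t : ℝ} (hF : ∀ s ∈ Set.Ioo (-R) R, HasDerivAt F 0 s)
    (ht : |t| < R) : F t = F 0 := by
  refine isOpen_Ioo.is_const_of_deriv_eq_zero (isPreconnected_Ioo (a := -R) (b := R))
    (fun s hs => (hF s hs).differentiableAt.differentiableWithinAt) (fun s hs => (hF s hs).deriv)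
    (abs_lt.1 ht) ?_
  have := (abs_nonneg t).trans_lt ht
  constructor <;> linarith

lemma continuousOn_uncurry_affine {F : Type*} [TopologicalSpace F] {g : ℍ[ℝ] → F}
    (hg : ContinuousOn g (ball 0 1)) (a : ℍ[ℝ]) :
    ContinuousOn (fun p : ℝ × USphere => g (a + p.1 • (p.2 : ℍ[ℝ])))
      (Set.Ioo (-(1 - ‖a‖)) (1 - ‖a‖) ×ˢ Set.univ) := by
  refine hg.comp (f := fun p : ℝ × USphere => a + p.1 • (p.2 : ℍ[ℝ])) (by fun_prop) fun p hp => ?_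
  refine affine_mem ?_ p.2.norm_eq
  have := abs_lt.2 hp.1
  linarith

lemma ContDiffOn.hasDerivAt_affine {f : ℍ[ℝ] → ℍ[ℝ]} (hf : ContDiffOn ℝ 1 f (ball 0 1)) {a : ℍ[ℝ]}
    {t : ℝ} (h : ‖a‖ + |t| < 1) (y : USphere) :
    HasDerivAt (fun s : ℝ => f (a + s • (y : ℍ[ℝ]))) (fderiv ℝ f (a + t • (y : ℍ[ℝ])) y) t := by
  have h1 : HasDerivAt (fun s : ℝ => a + s • (y : ℍ[ℝ])) ((1 : ℝ) • (y : ℍ[ℝ])) t :=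
    ((hasDerivAt_id t).smul_const _).const_add a
  rw [one_smul] at h1
  exact (hf.hasFDerivAt_ball (affine_mem h y.norm_eq)).comp_hasDerivAt t h1

lemma integral_affine {f : ℍ[ℝ] → ℍ[ℝ]} (hf : ContDiffOn ℝ 1 f (ball 0 1))
    (hD : ∀ z ∈ ball (0 : ℍ[ℝ]) 1, Dirac f z = 0) {a : ℍ[ℝ]} {t : ℝ} (h : ‖a‖ + |t| < 1) :
    ∫ y : USphere, f (a + t • (y : ℍ[ℝ])) ∂sphMeas = f a := by
  have hU : ∀ s ∈ Set.Ioo (-(1 - ‖a‖)) (1 - ‖a‖), ‖a‖ + |s| < 1 := fun s hs => by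
    have := abs_lt.2 hs
    linarith
  have key := eq_of_hasDerivAt_zero (F := fun s => ∫ y : USphere, f (a + s • (y : ℍ[ℝ])) ∂sphMeas)
    (R := 1 - ‖a‖) (t := t) ?_ (by linarith)
  · refine key.trans ?_
    simp
  · intro s hs
    have := hasDerivAt_integral_sph isOpen_Ioo
      (F := fun s y => f (a + s • (y : ℍ[ℝ])))
      (F' := fun s y => fderiv ℝ f (a + s • (y : ℍ[ℝ])) y)
      (continuousOn_uncurry_affine hf.continuousOn a)
      ((continuousOn_uncurry_affine hf.continuousOn_fderiv_ball a).clm_apply (by fun_prop))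
      (fun s hs y => hf.hasDerivAt_affine (hU s hs) y) hs
    have e := integral_fderiv hf hD (hU s hs)
    exact this.congr_deriv e

lemma integral_affine_mul {f : ℍ[ℝ] → ℍ[ℝ]} (hf : ContDiffOn ℝ 1 f (ball 0 1))
    (hD : ∀ z ∈ ball (0 : ℍ[ℝ]) 1, Dirac f z = 0) {a : ℍ[ℝ]} {t : ℝ} (h : ‖a‖ + |t| < 1) :
    ∫ y : USphere, f (a + t • (y : ℍ[ℝ])) * y ∂sphMeas = 0 := by
  rcases eq_or_ne t 0 with rfl | ht
  · simp only [zero_smul, add_zero]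
    exact (integral_const_mul_of_integrable (integrable_sph continuous_subtype_val)).trans
      ((congrArg _ integral_coe_sph).trans (mul_zero _))
  have hU : ∀ s ∈ Set.Ioo (-(1 - ‖a‖)) (1 - ‖a‖), ‖a‖ + |s| < 1 := fun s hs => by
    have := abs_lt.2 hs
    linarith
  have key := eq_of_hasDerivAt_zero
    (F := fun s => ∫ y : USphere, s ^ 3 • (f (a + s • (y : ℍ[ℝ])) * y) ∂sphMeas)
    (R := 1 - ‖a‖) (t := t) ?_ (by linarith)
  · simp only [integral_smul] at key
    refine (smul_eq_zero.1 (key.trans ?_)).resolve_left (pow_ne_zero 3 ht)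
    simp
  · intro s hs
    have := hasDerivAt_integral_sph isOpen_Ioo
      (F := fun s y => s ^ 3 • (f (a + s • (y : ℍ[ℝ])) * y))
      (F' := fun s y => s ^ 2 • (s • (fderiv ℝ f (a + s • (y : ℍ[ℝ])) y * y) +
        (3 : ℝ) • (f (a + s • (y : ℍ[ℝ])) * y)))
      ?_ ?_ ?_ hs
    · refine HasDerivAt.congr_deriv this ?_
      rw [integral_smul]
      exact (congrArg _ (integral_fderiv_mul hf hD (hU s hs))).trans (smul_zero _)
    · exact ContinuousOn.fun_smul (by fun_prop)
        ((continuousOn_uncurry_affine hf.continuousOn a).fun_mul (by fun_prop))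
    · refine ContinuousOn.fun_smul (by fun_prop) (ContinuousOn.fun_add (ContinuousOn.fun_smul
        (by fun_prop) (ContinuousOn.fun_mul ((continuousOn_uncurry_affine
          hf.continuousOn_fderiv_ball a).clm_apply (by fun_prop)) (by fun_prop)))
          (ContinuousOn.fun_smul (by fun_prop)
        ((continuousOn_uncurry_affine hf.continuousOn a).fun_mul (by fun_prop))))
    · intro s hs y
      have h1 := (hasDerivAt_pow 3 s).smul ((hf.hasDerivAt_affine (hU s hs) y).mul_const (y : ℍ[ℝ]))
      refine h1.congr_deriv ?_
      simp only [smul_add, smul_smul]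
      congr 2
      push_cast; ring

/-- The mean value property over all spheres inside the unit ball. -/
def MeanVal (h : ℍ[ℝ] → ℍ[ℝ]) : Prop :=
  ∀ (a : ℍ[ℝ]) (t : ℝ), 0 < t → ‖a‖ + t < 1 → ∫ y : USphere, h (a + t • (y : ℍ[ℝ])) ∂sphMeas = h a

lemma meanVal_fold {d : ℍ[ℝ] → ℍ[ℝ]} (hd : ContDiffOn ℝ 1 d (ball 0 1))
    (hD : ∀ z ∈ ball (0 : ℍ[ℝ]) 1, Dirac d z = 0) :
    MeanVal fun x => d x + d (star x) * star x := by
  intro a t ht h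
  have h1 : ‖a‖ + |t| < 1 := by rwa [abs_of_pos ht]
  have h2 : ‖star a‖ + |t| < 1 := by rwa [norm_star]
  have c1 := continuous_affine_sph hd.continuousOn h1
  have c2 := continuous_affine_sph hd.continuousOn h2
  have e := integral_cj fun y : USphere => d (star a + t • (y : ℍ[ℝ])) * (star a + t • (y : ℍ[ℝ]))
  have e1 : ∀ y : USphere, d (star (a + t • (y : ℍ[ℝ]))) * star (a + t • (y : ℍ[ℝ])) =
      (fun y : USphere => d (star a + t • (y : ℍ[ℝ])) * (star a + t • (y : ℍ[ℝ]))) (cj y) := by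
    intro y
    simp [star_add, cj_coe]
  simp only [e1]
  rw [integral_add (integrable_sph c1), e]
  · have e2 : ∀ y : USphere, d (star a + t • (y : ℍ[ℝ])) * (star a + t • (y : ℍ[ℝ])) =
      d (star a + t • (y : ℍ[ℝ])) * star a + t • (d (star a + t • (y : ℍ[ℝ])) * y) := fun y => by
      rw [mul_add, mul_smul_comm]
    simp only [e2]
    rw [integral_add, integral_mul_const_of_integrable (integrable_sph c2), integral_smul,
      integral_affine_mul hd hD h2, smul_zero, add_zero, integral_affine hd hD h2,
      integral_affine hd hD h1]
    · exact integrable_sph (c2.fun_mul continuous_const)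
    · exact integrable_sph ((c2.fun_mul continuous_subtype_val).const_smul t)
  · refine integrable_sph ?_
    refine Continuous.comp (g := fun y : USphere => d (star a + t • (y : ℍ[ℝ])) *
      (star a + t • (y : ℍ[ℝ]))) ?_ continuous_cj
    exact c2.fun_mul (by fun_prop)

/-- Maximum principle. -/
lemma MeanVal.norm_le {h : ℍ[ℝ] → ℍ[ℝ]} (hm : MeanVal h) (hc : ContinuousOn h (closedBall 0 1))
    {C : ℝ} (hC : ∀ z ∈ sphere (0 : ℍ[ℝ]) 1, ‖h z‖ ≤ C) {x : ℍ[ℝ]} (hx : ‖x‖ ≤ 1) : ‖h x‖ ≤ C := by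
  have hC0 : 0 ≤ C := (norm_nonneg _).trans (hC 1 (by simp))
  have key : ∀ ε : ℝ, 0 < ε → ‖h x‖ ^ 2 ≤ C ^ 2 + ε := by
    intro ε hε
    have huc : ContinuousOn (fun z => ‖h z‖ ^ 2 + ε * ‖z‖ ^ 2) (closedBall (0 : ℍ[ℝ]) 1) :=
      (hc.norm.pow 2).add (by fun_prop)
    obtain ⟨x0, hx0, hmax⟩ := (isCompact_closedBall (0 : ℍ[ℝ]) 1).exists_isMaxOn
      ⟨x, mem_closedBall_zero_iff.2 hx⟩ huc
    have hle : ∀ z : ℍ[ℝ], ‖z‖ ≤ 1 → ‖h z‖ ^ 2 + ε * ‖z‖ ^ 2 ≤ ‖h x0‖ ^ 2 + ε * ‖x0‖ ^ 2 :=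
      fun z hz => hmax (mem_closedBall_zero_iff.2 hz)
    rw [mem_closedBall_zero_iff] at hx0
    rcases hx0.lt_or_eq with hlt | heq
    · exfalso
      set t := (1 - ‖x0‖) / 2 with ht
      have ht0 : 0 < t := by linarith
      have hs : ‖x0‖ + t < 1 := by linarith
      have hs' : ‖x0‖ + |t| < 1 := by rwa [abs_of_pos ht0]
      have hc' := continuous_affine_sph (hc.mono ball_subset_closedBall) hs'
      have hp : ∀ y : USphere, 2 * inner ℝ (h x0) (h (x0 + t • (y : ℍ[ℝ])))
          + 2 * ε * t * inner ℝ x0 (y : ℍ[ℝ]) ≤ 2 * ‖h x0‖ ^ 2 - ε * t ^ 2 := by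
        intro y
        have h1 := hle _ (mem_ball_zero_iff.1 (affine_mem hs' y.norm_eq)).le
        have h2 : ‖x0 + t • (y : ℍ[ℝ])‖ ^ 2 = ‖x0‖ ^ 2 + 2 * (t * inner ℝ x0 (y : ℍ[ℝ])) + t ^ 2 := by
          rw [norm_add_sq_real, inner_smul_right, norm_smul, y.norm_eq, mul_one, Real.norm_eq_abs,
            sq_abs]
        have h3 := norm_sub_sq_real (h x0) (h (x0 + t • (y : ℍ[ℝ])))
        have h4 := sq_nonneg ‖h x0 - h (x0 + t • (y : ℍ[ℝ]))‖
        rw [h2] at h1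
        linarith
      have hi := integral_mono (μ := sphMeas) ?_ (integrable_const (2 * ‖h x0‖ ^ 2 - ε * t ^ 2)) hp
      · rw [integral_add, integral_const_mul, integral_const_mul, integral_inner (integrable_sph hc'),
          integral_inner (integrable_sph continuous_subtype_val), integral_coe_sph, hm x0 t ht0 hs,
          real_inner_self_eq_norm_sq, inner_zero_right] at hi
        · simp at hi
          have := mul_pos hε (pow_pos ht0 2)
          linarith
        · exact (((innerSL ℝ (h x0)).integrable_comp (integrable_sph hc')).const_mul 2)
        · exact (((innerSL ℝ x0).integrable_comp
            (integrable_sph continuous_subtype_val)).const_mul _)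
      · exact (((innerSL ℝ (h x0)).integrable_comp (integrable_sph hc')).const_mul 2).add
          (((innerSL ℝ x0).integrable_comp (integrable_sph continuous_subtype_val)).const_mul _)
    · have h1 := hle x hx
      have h2 := hC x0 (by rw [mem_sphere_zero_iff_norm, heq])
      have h3 : ‖h x0‖ ^ 2 ≤ C ^ 2 := by gcongr
      rw [heq] at h1
      have : 0 ≤ ε * ‖x‖ ^ 2 := by positivity
      linarith
  exact le_of_sq_le_sq (le_of_forall_pos_le_add key) hC0

/-- The boundary folding `f(y) + f(ȳ)ȳ`. -/
def foldS (f : ℍ[ℝ] → ℍ[ℝ]) (y : USphere) : ℍ[ℝ] := f y + f (star (y : ℍ[ℝ])) * star (y : ℍ[ℝ])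

lemma foldSym_foldS (f : ℍ[ℝ] → ℍ[ℝ]) : FoldSym (foldS f) := by
  intro y
  simp only [foldS, cj_coe, star_star, add_mul, mul_assoc, y.mul_star, mul_one]
  rw [add_comm]

lemma memK.sub {f g : ℍ[ℝ] → ℍ[ℝ]} (hf : memK f) (hg : memK g) : memK fun z => f z - g z := by
  refine ⟨hf.1.fun_sub hg.1, hf.2.1.sub hg.2.1, fun z hz => ?_⟩
  have h1 : fderiv ℝ (fun z => f z - g z) z = fderiv ℝ f z - fderiv ℝ g z :=
    ((hf.2.1.hasFDerivAt_ball hz).fun_sub (hg.2.1.hasFDerivAt_ball hz)).fderiv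
  have h2 := hf.2.2 z hz
  have h3 := hg.2.2 z hz
  unfold Dirac at h2 h3 ⊢
  rw [h1]
  simp only [sub_apply, sub_mul, Finset.sum_sub_distrib, h2, h3, sub_zero]

lemma smul_mem_ball {r : ℝ} (hr : 0 ≤ r) (hr' : r ≤ 1) {z : ℍ[ℝ]} (hz : z ∈ ball (0 : ℍ[ℝ]) 1) :
    r • z ∈ ball (0 : ℍ[ℝ]) 1 := by
  rw [mem_ball_zero_iff] at hz ⊢
  rw [norm_smul, Real.norm_of_nonneg hr]
  nlinarith [norm_nonneg z]

lemma norm_dil_le {r : ℝ} (hr : 0 ≤ r) {z : ℍ[ℝ]} (hz : ‖z‖ ≤ 1) : ‖r • z‖ ≤ r := by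
  rw [norm_smul, Real.norm_of_nonneg hr]
  nlinarith [norm_nonneg z]

lemma memK.dil {f : ℍ[ℝ] → ℍ[ℝ]} (hf : memK f) {r : ℝ} (hr : 0 ≤ r) (hr' : r ≤ 1) :
    memK fun z => f (r • z) := by
  refine ⟨hf.1.comp (f := fun z : ℍ[ℝ] => r • z) (by fun_prop) fun z hz => ?_,
    hf.2.1.comp (f := fun z : ℍ[ℝ] => r • z) (by fun_prop) fun z hz => smul_mem_ball hr hr' hz,
    fun z hz => ?_⟩
  · rw [mem_closedBall_zero_iff] at hz ⊢
    exact (norm_dil_le hr hz).trans hr'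
  · have h1 : HasFDerivAt (fun z : ℍ[ℝ] => r • z) (r • ContinuousLinearMap.id ℝ ℍ[ℝ]) z :=
      (hasFDerivAt_id z).const_smul r
    have h2 := ((hf.2.1.hasFDerivAt_ball (smul_mem_ball hr hr' hz)).comp z h1).fderiv
    have h3 := hf.2.2 _ (smul_mem_ball hr hr' hz)
    unfold Dirac at h3 ⊢
    rw [show (fun z => f (r • z)) = f ∘ fun z : ℍ[ℝ] => r • z from rfl, h2]
    simp only [ContinuousLinearMap.comp_smul, ContinuousLinearMap.comp_id, smul_apply,
      smul_mul_assoc, ← Finset.smul_sum, h3, smul_zero]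

lemma norm_star_sub (x y : ℍ[ℝ]) : ‖star x - star y‖ = ‖x - y‖ := by rw [← star_sub, norm_star]

lemma norm_sph_sub_le (x y : USphere) : ‖(x : ℍ[ℝ]) - y‖ ≤ 2 := by
  refine (norm_sub_le _ _).trans ?_
  rw [x.norm_eq, y.norm_eq]; norm_num

lemma HolS_of_lipschitz {v : USphere → ℍ[ℝ]} {L : ℝ} (hL : 0 ≤ L)
    (h : ∀ y y', ‖v y - v y'‖ ≤ L * ‖(y : ℍ[ℝ]) - y'‖) : HolS (2 * L) v := by
  refine ⟨by positivity, fun y y' => (h y y').trans ?_⟩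
  have h1 := norm_sph_sub_le y y'
  have h2 : ‖(y : ℍ[ℝ]) - y'‖ ≤ 2 * √‖(y : ℍ[ℝ]) - y'‖ := by
    have h3 := Real.sq_sqrt (norm_nonneg ((y : ℍ[ℝ]) - y'))
    have h4 : √‖(y : ℍ[ℝ]) - y'‖ ≤ 2 := Real.sqrt_le_iff.2 ⟨by norm_num, by linarith⟩
    nlinarith [Real.sqrt_nonneg ‖(y : ℍ[ℝ]) - y'‖]
  nlinarith

lemma memK.exists_lipschitz_dil {f : ℍ[ℝ] → ℍ[ℝ]} (hf : memK f) {r : ℝ} (hr : 0 ≤ r) (hr' : r < 1) :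
    ∃ L, 0 ≤ L ∧ ∀ y y' : USphere, ‖foldS (fun z => f (r • z)) y - foldS (fun z => f (r • z)) y'‖ ≤
      L * ‖(y : ℍ[ℝ]) - y'‖ := by
  have hsub : closedBall (0 : ℍ[ℝ]) r ⊆ ball 0 1 := closedBall_subset_ball hr'
  obtain ⟨C, hC⟩ := (isCompact_closedBall (0 : ℍ[ℝ]) r).exists_bound_of_continuousOn
    (E := EndL ℍ[ℝ]) (hf.2.1.continuousOn_fderiv_ball.mono hsub)
  obtain ⟨M, hM⟩ := (isCompact_closedBall (0 : ℍ[ℝ]) r).exists_bound_of_continuousOn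
    (hf.2.1.continuousOn.mono hsub)
  have hC0 : 0 ≤ C := (norm_nonneg _).trans (hC 0 (by simpa using hr))
  have hM0 : 0 ≤ M := (norm_nonneg _).trans (hM 0 (by simpa using hr))
  have hmem : ∀ z : ℍ[ℝ], ‖z‖ = 1 → r • z ∈ closedBall (0 : ℍ[ℝ]) r := fun z hz =>
    mem_closedBall_zero_iff.2 (norm_dil_le hr hz.le)
  have hl : ∀ z w : ℍ[ℝ], ‖z‖ = 1 → ‖w‖ = 1 → ‖f (r • z) - f (r • w)‖ ≤ C * ‖z - w‖ := by
    intro z w hz hw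
    refine ((convex_closedBall (0 : ℍ[ℝ]) r).norm_image_sub_le_of_norm_fderiv_le
      (fun x hx => (hf.2.1.hasFDerivAt_ball (hsub hx)).differentiableAt) hC
      (hmem w hw) (hmem z hz)).trans ?_
    rw [← smul_sub, norm_smul, Real.norm_of_nonneg hr]
    have := mul_nonneg hC0 (norm_nonneg (z - w))
    nlinarith
  refine ⟨C + (C + M), by positivity, fun y y' => ?_⟩
  have hs : ∀ y : USphere, ‖star (y : ℍ[ℝ])‖ = 1 := fun y => by rw [norm_star, y.norm_eq]
  have e : foldS (fun z => f (r • z)) y - foldS (fun z => f (r • z)) y' =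
      (f (r • (y : ℍ[ℝ])) - f (r • (y' : ℍ[ℝ]))) +
      ((f (r • star (y : ℍ[ℝ])) - f (r • star (y' : ℍ[ℝ]))) * star (y : ℍ[ℝ]) +
      f (r • star (y' : ℍ[ℝ])) * (star (y : ℍ[ℝ]) - star (y' : ℍ[ℝ]))) := by
    simp only [foldS]; noncomm_ring
  rw [e]
  refine (norm_add_le _ _).trans ?_
  rw [add_mul]
  refine add_le_add (hl _ _ y.norm_eq y'.norm_eq) ((norm_add_le _ _).trans ?_)
  rw [norm_mul, norm_mul, hs, mul_one, add_mul, norm_star_sub]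
  refine add_le_add ((hl _ _ (hs y) (hs y')).trans (by rw [norm_star_sub])) ?_
  gcongr
  exact hM _ (hmem _ (hs y'))

lemma memK.exists_dil_close {f : ℍ[ℝ] → ℍ[ℝ]} (hf : memK f) {ε : ℝ} (hε : 0 < ε) :
    ∃ r : ℝ, 0 ≤ r ∧ r < 1 ∧ ∀ z ∈ closedBall (0 : ℍ[ℝ]) 1, ‖f (r • z) - f z‖ ≤ ε := by
  have hu := (isCompact_closedBall (0 : ℍ[ℝ]) 1).uniformContinuousOn_of_continuous hf.1
  rw [Metric.uniformContinuousOn_iff_le] at hu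
  obtain ⟨δ, hδ, h⟩ := hu ε hε
  refine ⟨1 - min δ 1, by simp, by simp [hδ], fun z hz => ?_⟩
  rw [← dist_eq_norm]
  have hz' := mem_closedBall_zero_iff.1 hz
  have hm0 : 0 ≤ min δ 1 := le_min hδ.le zero_le_one
  refine h _ ?_ _ hz ?_
  · rw [mem_closedBall_zero_iff]
    refine (norm_dil_le (by simp) hz').trans (by linarith)
  · rw [dist_eq_norm, show (1 - min δ 1) • z - z = -(min δ 1 • z) by rw [sub_smul, one_smul]; abel,
      norm_neg]
    exact (norm_dil_le hm0 hz').trans (min_le_left _ _)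

lemma one_sub_norm_le (x : ℍ[ℝ]) (y : USphere) : 1 - ‖x‖ ≤ ‖(y : ℍ[ℝ]) - x‖ := by
  have := norm_sub_norm_le (y : ℍ[ℝ]) x
  rwa [y.norm_eq] at this

lemma norm_kern_le {x : ℍ[ℝ]} (hx : x ∈ ball (0 : ℍ[ℝ]) 1) (y : USphere) :
    ‖kern x y‖ ≤ ((1 - ‖x‖) ^ 3)⁻¹ := by
  rw [norm_kern]
  have := mem_ball_zero_iff.1 hx
  have h1 := one_sub_norm_le x y
  have h2 : 0 < (1 - ‖x‖) ^ 3 := pow_pos (by linarith) 3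
  gcongr

lemma norm_cauchy_le {v : USphere → ℍ[ℝ]} {S : ℝ} (hv : ∀ y, ‖v y‖ ≤ S) {x : ℍ[ℝ]}
    (hx : x ∈ ball (0 : ℍ[ℝ]) 1) : ‖cauchy v x‖ ≤ S * ((1 - ‖x‖) ^ 3)⁻¹ := by
  have hS : 0 ≤ S := (norm_nonneg _).trans (hv 1)
  have h : ∀ y, ‖v y * kern x y‖ ≤ S * ((1 - ‖x‖) ^ 3)⁻¹ := fun y => by
    rw [norm_mul]
    exact mul_le_mul (hv y) (norm_kern_le hx y) (norm_nonneg _) hS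
  refine (norm_integral_le_of_norm_le_const (μ := sphMeas) (ae_of_all _ h)).trans ?_
  simp

lemma cauchy_sub {v w : USphere → ℍ[ℝ]} (hv : Continuous v) (hw : Continuous w) {x : ℍ[ℝ]}
    (hx : x ∈ ball (0 : ℍ[ℝ]) 1) : cauchy (fun y => v y - w y) x = cauchy v x - cauchy w x := by
  unfold cauchy
  simp only [sub_mul]
  exact integral_sub (integrable_sph (hv.fun_mul (continuous_kern hx)))
    (integrable_sph (hw.fun_mul (continuous_kern hx)))

lemma memK.continuous_foldS {f : ℍ[ℝ] → ℍ[ℝ]} (hf : memK f) : Continuous (foldS f) := by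
  have h1 : Continuous fun y : USphere => f y :=
    hf.1.comp_continuous continuous_subtype_val fun y => by simp
  have h2 : Continuous fun y : USphere => f (star (y : ℍ[ℝ])) :=
    hf.1.comp_continuous (by fun_prop) fun y => by simp
  exact h1.add (h2.fun_mul (by fun_prop))

lemma memK.eq_cauchy_of_HolS {f : ℍ[ℝ] → ℍ[ℝ]} (hf : memK f) {A : ℝ} (hA : HolS A (foldS f)) {x : ℍ[ℝ]}
    (hx : x ∈ ball (0 : ℍ[ℝ]) 1) : f x = cauchy (foldS f) x := by
  have hd := (memK_cext hA).sub hf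
  set d := fun z => cext (foldS f) z - f z with hd'
  have hs : ∀ z ∈ closedBall (0 : ℍ[ℝ]) 1, star z ∈ closedBall (0 : ℍ[ℝ]) 1 := fun z hz => by
    rw [mem_closedBall_zero_iff] at hz ⊢; rwa [norm_star]
  have hc : ContinuousOn (fun z => d z + d (star z) * star z) (closedBall 0 1) :=
    hd.1.fun_add ((hd.1.comp continuous_star.continuousOn hs).fun_mul (by fun_prop))
  have h0 : ∀ z : ℍ[ℝ], ‖z‖ ≤ 1 → d z + d (star z) * star z = 0 := fun z hz => by
    refine norm_le_zero_iff.1 ((meanVal_fold hd.2.1 hd.2.2).norm_le hc (fun w hw => ?_) hz)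
    have e := cext_fold hA (foldSym_foldS f) ⟨w, hw⟩
    simp only [foldS] at e
    rw [norm_le_zero_iff]
    simp only [hd', sub_mul, sub_add_sub_comm, e, sub_self]
  have hx1 := (mem_ball_zero_iff.1 hx).le
  have h1 := h0 (star x) (by rwa [norm_star])
  rw [star_star] at h1
  have := eq_zero_of_fold hx (h0 x hx1) h1
  rw [← cext_eq hx]
  exact (sub_eq_zero.1 this).symm

/-- Every element of `K` is the Cauchy integral of its folded boundary values. -/
lemma memK.eq_cauchy {f : ℍ[ℝ] → ℍ[ℝ]} (hf : memK f) {x : ℍ[ℝ]}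
    (hx : x ∈ ball (0 : ℍ[ℝ]) 1) : f x = cauchy (foldS f) x := by
  have hx1 := mem_ball_zero_iff.1 hx
  have hp : 0 < ((1 - ‖x‖) ^ 3)⁻¹ := inv_pos.2 (pow_pos (by linarith) 3)
  rw [← sub_eq_zero, ← norm_le_zero_iff]
  refine le_of_forall_pos_le_add fun ε hε => ?_
  obtain ⟨r, hr, hr', h⟩ := hf.exists_dil_close (ε := ε / (1 + 2 * ((1 - ‖x‖) ^ 3)⁻¹)) (by positivity)
  set η := ε / (1 + 2 * ((1 - ‖x‖) ^ 3)⁻¹) with hη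
  obtain ⟨L, hL, hLip⟩ := hf.exists_lipschitz_dil hr hr'
  have hg := hf.dil hr hr'.le
  have e := hg.eq_cauchy_of_HolS (HolS_of_lipschitz hL hLip) hx
  have h1 : ∀ y, ‖foldS (fun z => f (r • z)) y - foldS f y‖ ≤ 2 * η := fun y => by
    have e1 : foldS (fun z => f (r • z)) y - foldS f y = (f (r • (y : ℍ[ℝ])) - f y) +
      (f (r • star (y : ℍ[ℝ])) - f (star (y : ℍ[ℝ]))) * star (y : ℍ[ℝ]) := by
      simp only [foldS]; noncomm_ring
    rw [e1, two_mul]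
    refine (norm_add_le _ _).trans (add_le_add (h _ (by simp)) ?_)
    rw [norm_mul, norm_star, y.norm_eq, mul_one]
    exact h _ (by simp)
  have h2 := norm_cauchy_le h1 hx
  rw [cauchy_sub hg.continuous_foldS hf.continuous_foldS hx, ← e] at h2
  have h3 := h x (ball_subset_closedBall hx)
  calc ‖f x - cauchy (foldS f) x‖
      = ‖-(f (r • x) - f x) + (f (r • x) - cauchy (foldS f) x)‖ := by congr 1; abel
    _ ≤ η + 2 * η * ((1 - ‖x‖) ^ 3)⁻¹ := by
      refine (norm_add_le _ _).trans (add_le_add ?_ h2)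
      rwa [norm_neg]
    _ = 0 + ε := by
      generalize ((1 - ‖x‖) ^ 3)⁻¹ = c at hp hη
      rw [hη, zero_add]; field_simp

/-- The (rescaled) distance of the sphere folded by conjugation. -/
def dF (x y : USphere) : ℝ := min ‖(x : ℍ[ℝ]) - y‖ ‖(x : ℍ[ℝ]) - star (y : ℍ[ℝ])‖ / 4

lemma norm_sub_star_comm (x y : ℍ[ℝ]) : ‖x - star y‖ = ‖y - star x‖ := by
  rw [← norm_star, star_sub, star_star, norm_sub_rev]

lemma dF_self (x : USphere) : dF x x = 0 := by simp [dF]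

lemma dF_comm (x y : USphere) : dF x y = dF y x := by
  rw [dF, dF, norm_sub_rev, norm_sub_star_comm]

lemma dF_nonneg (x y : USphere) : 0 ≤ dF x y := by unfold dF; positivity

lemma dF_le (x y : USphere) : dF x y ≤ ‖(x : ℍ[ℝ]) - y‖ / 4 := by
  unfold dF; gcongr; exact min_le_left _ _

lemma dF_cj_left (x y : USphere) : dF (cj x) y = dF x y := by
  simp only [dF, cj_coe, norm_star_sub]
  rw [min_comm, norm_sub_rev (star (x : ℍ[ℝ])), norm_sub_star_comm (y : ℍ[ℝ])]

lemma dF_cj_right (x y : USphere) : dF x (cj y) = dF x y := by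
  rw [dF_comm, dF_cj_left, dF_comm]

lemma dF_cases (x y : USphere) :
    dF x y = ‖(x : ℍ[ℝ]) - y‖ / 4 ∨ dF x y = ‖(x : ℍ[ℝ]) - cj y‖ / 4 := by
  rcases min_choice ‖(x : ℍ[ℝ]) - y‖ ‖(x : ℍ[ℝ]) - star (y : ℍ[ℝ])‖ with h | h
  · exact Or.inl (congrArg (· / 4) h)
  · exact Or.inr (congrArg (· / 4) h)

lemma dF_tri (x y z : USphere) : dF x z ≤ dF x y + dF y z := by
  have key : ∀ x y z : USphere, dF x z ≤ ‖(x : ℍ[ℝ]) - y‖ / 4 + dF y z := fun x y z => by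
    rcases dF_cases y z with h | h
    · rw [h]
      have := norm_sub_le_norm_sub_add_norm_sub (x : ℍ[ℝ]) y z
      linarith [dF_le x z]
    · rw [h]
      have := norm_sub_le_norm_sub_add_norm_sub (x : ℍ[ℝ]) y (cj z)
      have h2 := dF_le x (cj z)
      rw [dF_cj_right] at h2
      linarith
  rcases dF_cases x y with h | h
  · rw [h]; exact key x y z
  · rw [h, ← dF_cj_left y z]; exact key x (cj y) z

lemma continuous_dF (x : USphere) : Continuous fun y => dF y x := by unfold dF; fun_prop

/-- Measure of a spherical cap. -/
def cap (r : ℝ) : ℝ := sphMeas.real {y : USphere | ‖(y : ℍ[ℝ]) - (1 : USphere)‖ ≤ r}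

lemma measurableSet_cap (x : ℍ[ℝ]) (r : ℝ) : MeasurableSet {y : USphere | ‖(y : ℍ[ℝ]) - x‖ ≤ r} :=
  measurableSet_le (continuous_dist_sph x).measurable measurable_const

lemma measureReal_cap (x : USphere) (r : ℝ) :
    sphMeas.real {y : USphere | ‖(y : ℍ[ℝ]) - x‖ ≤ r} = cap r := by
  have h := (sphIso_measurePreserving (rmul x)).measureReal_preimage
    (measurableSet_cap (x : ℍ[ℝ]) r).nullMeasurableSet
  rw [← h, cap]
  congr 1
  ext y
  simp only [Set.mem_preimage, Set.mem_ofPred_eq, sphIso_coe, rmul_apply, USphere.coe_one]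
  rw [show (y : ℍ[ℝ]) * x - x = (y - 1) * x by rw [sub_mul, one_mul], norm_mul, x.norm_eq, mul_one]

lemma exists_cap_doubling {ε : ℝ} (hε : 0 < ε) :
    ∃ n : ℕ, ∀ r : ℝ, 0 < r → cap r ≤ n * cap (ε * r) := by
  obtain ⟨t, -, ht, hc⟩ := (isCompact_closedBall (0 : ℍ[ℝ]) 1).finite_cover_balls (half_pos hε)
  refine ⟨ht.toFinset.card, fun r hr => ?_⟩
  have hsub : {y : USphere | ‖(y : ℍ[ℝ]) - (1 : USphere)‖ ≤ r} ⊆ ⋃ x ∈ ht.toFinset,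
      {y : USphere | ‖r⁻¹ • ((y : ℍ[ℝ]) - 1) - x‖ < ε / 2} := by
    intro y hy
    have : r⁻¹ • ((y : ℍ[ℝ]) - 1) ∈ closedBall (0 : ℍ[ℝ]) 1 := by
      rw [mem_closedBall_zero_iff, norm_smul, norm_inv, Real.norm_of_nonneg hr.le,
        inv_mul_le_one₀ hr]
      exact hy
    obtain ⟨x, hx, hxy⟩ := Set.mem_iUnion₂.1 (hc this)
    exact Set.mem_iUnion₂.2 ⟨x, ht.mem_toFinset.2 hx, mem_ball_iff_norm.1 hxy⟩
  refine (measureReal_mono hsub (measure_ne_top _ _)).trans ((measureReal_biUnion_finset_le _ _).trans ?_)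
  rw [← nsmul_eq_mul]
  refine Finset.sum_le_card_nsmul _ _ _ fun x _ => ?_
  rcases Set.eq_empty_or_nonempty {y : USphere | ‖r⁻¹ • ((y : ℍ[ℝ]) - 1) - x‖ < ε / 2} with h | ⟨z, hz⟩
  · rw [h]; simp [cap]
  · rw [← measureReal_cap z]
    refine measureReal_mono fun y hy => ?_
    have h1 : ‖r⁻¹ • ((y : ℍ[ℝ]) - z)‖ ≤ ε := by
      rw [show r⁻¹ • ((y : ℍ[ℝ]) - z) = (r⁻¹ • ((y : ℍ[ℝ]) - 1) - x) - (r⁻¹ • ((z : ℍ[ℝ]) - 1) - x) by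
        simp only [smul_sub]; abel]
      refine (norm_sub_le _ _).trans ?_
      have h2 : ‖r⁻¹ • ((y : ℍ[ℝ]) - 1) - x‖ < ε / 2 := hy
      have h3 : ‖r⁻¹ • ((z : ℍ[ℝ]) - 1) - x‖ < ε / 2 := hz
      linarith
    rw [norm_smul, norm_inv, Real.norm_of_nonneg hr.le, inv_mul_le_iff₀ hr] at h1
    exact h1.trans_eq (mul_comm _ _)

lemma cap_pos {r : ℝ} (hr : 0 < r) : 0 < cap r := by
  obtain ⟨n, hn⟩ := exists_cap_doubling (half_pos hr)
  have h := hn 2 two_pos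
  have h2 : cap 2 = 1 := by
    unfold cap
    rw [show {y : USphere | ‖(y : ℍ[ℝ]) - (1 : USphere)‖ ≤ 2} = Set.univ from
      Set.eq_univ_of_forall fun y => norm_sph_sub_le y 1]
    simp
  rw [h2, div_mul_cancel₀ _ two_ne_zero] at h
  by_contra hneg
  have : cap r ≤ 0 := not_lt.1 hneg
  have h3 : (n : ℝ) * cap r ≤ 0 := mul_nonpos_of_nonneg_of_nonpos n.cast_nonneg this
  linarith

lemma cap_le_dF_ball (x : USphere) (r : ℝ) : cap (4 * r) ≤ sphMeas.real {y | dF y x ≤ r} := by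
  rw [← measureReal_cap x]
  refine measureReal_mono fun y hy => (dF_le y x).trans ?_
  have : ‖(y : ℍ[ℝ]) - x‖ ≤ 4 * r := hy
  linarith

lemma dF_ball_le_cap (x : USphere) (r : ℝ) : sphMeas.real {y | dF y x ≤ r} ≤ 2 * cap (4 * r) := by
  have hsub : {y | dF y x ≤ r} ⊆ {y : USphere | ‖(y : ℍ[ℝ]) - x‖ ≤ 4 * r} ∪
      {y : USphere | ‖(y : ℍ[ℝ]) - cj x‖ ≤ 4 * r} := by
    intro y hy
    have hy' : dF y x ≤ r := hy
    rcases dF_cases y x with h | h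
    · left; show ‖(y : ℍ[ℝ]) - x‖ ≤ 4 * r; linarith
    · right; show ‖(y : ℍ[ℝ]) - cj x‖ ≤ 4 * r; linarith
  refine (measureReal_mono hsub).trans ((measureReal_union_le _ _).trans ?_)
  rw [measureReal_cap, measureReal_cap, two_mul]

/-- The doubling property of the folded sphere. -/
lemma exists_dF_doubling {ε : ℝ} (hε : 0 < ε) :
    ∃ n : ℕ, ∀ r : ℝ, 0 < r → ∀ x z : USphere,
      sphMeas.real {y | dF y x ≤ r} ≤ n * sphMeas.real {y | dF y z ≤ ε * r} := by
  obtain ⟨n, hn⟩ := exists_cap_doubling hε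
  refine ⟨2 * n, fun r hr x z => (dF_ball_le_cap x r).trans ?_⟩
  have h := hn (4 * r) (by positivity)
  have h2 := cap_le_dF_ball z (ε * r)
  rw [mul_left_comm] at h
  have h3 := mul_le_mul_of_nonneg_left h2 (Nat.cast_nonneg (α := ℝ) n)
  push_cast
  linarith

/-- Dyadic index on `[-1, 1]`, with the right end point put in the last interval. -/
def clipF (M : ℕ) (a : ℝ) : ℤ := min ⌊(M : ℝ) * a⌋ (M - 1)

lemma clipF_le (M : ℕ) (a : ℝ) : (clipF M a : ℝ) ≤ M * a :=
  (Int.cast_le.2 (min_le_left _ _)).trans (Int.floor_le _)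

lemma clipF_le' (M : ℕ) (a : ℝ) : clipF M a ≤ M - 1 := min_le_right _ _

lemma lt_clipF {M : ℕ} {a : ℝ} (h : clipF M a ≠ M - 1) : M * a < clipF M a + 1 := by
  have : clipF M a = ⌊(M : ℝ) * a⌋ := (min_choice _ _).resolve_right h
  rw [this]
  exact Int.lt_floor_add_one _

lemma le_clipF {M : ℕ} {a : ℝ} (ha : a ≤ 1) : M * a ≤ clipF M a + 1 := by
  by_cases h : clipF M a = M - 1
  · rw [h]; push_cast
    have := mul_le_mul_of_nonneg_left ha (Nat.cast_nonneg (α := ℝ) M)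
    linarith
  · exact (lt_clipF h).le

lemma neg_le_clipF {M : ℕ} (hM : 0 < M) {a : ℝ} (ha : -1 ≤ a) : -(M : ℤ) ≤ clipF M a := by
  refine le_min (Int.le_floor.2 ?_) (by omega)
  have := mul_le_mul_of_nonneg_left ha (Nat.cast_nonneg (α := ℝ) M)
  push_cast; linarith

lemma clipF_nest {M N : ℕ} (hN : 0 < N) {a a' : ℝ} (h : clipF (N * M) a = clipF (N * M) a') :
    clipF M a = clipF M a' := by
  have key : ∀ a a' : ℝ, clipF (N * M) a = clipF (N * M) a' → ¬ clipF M a < clipF M a' := by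
    intro a a' h hlt
    have h1 := clipF_le' M a'
    have h2 := lt_clipF (M := M) (a := a) (by omega)
    have h3 := clipF_le M a'
    have h4 : ((clipF M a : ℤ) : ℝ) + 1 ≤ clipF M a' := by exact_mod_cast hlt
    have hN' : (0 : ℝ) < N := by exact_mod_cast hN
    have h5 : (N : ℤ) * (clipF M a + 1) ≤ clipF (N * M) a' := by
      refine le_min (Int.le_floor.2 ?_) ?_
      · push_cast; rw [mul_assoc]; gcongr; linarith
      · push_cast; have : (N : ℤ) * (clipF M a + 1) ≤ N * (M - 1) := by gcongr; omega
        have hN2 : (1 : ℤ) ≤ N := by exact_mod_cast hN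
        linarith
    have h6 : clipF (N * M) a < (N : ℤ) * (clipF M a + 1) := by
      refine lt_of_le_of_lt (min_le_left _ _) (Int.floor_lt.2 ?_)
      push_cast; rw [mul_assoc]; gcongr
    omega
  exact le_antisymm (not_lt.1 (key _ _ h.symm)) (not_lt.1 (key _ _ h))

lemma clipF_mid {M : ℕ} {a a' : ℝ}
    (h : |M * a' - (clipF M a + 1 / 2)| < 1 / 2) : clipF M a' = clipF M a := by
  rw [abs_lt] at h
  have : ⌊(M : ℝ) * a'⌋ = clipF M a := by
    rw [Int.floor_eq_iff]; constructor <;> linarith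
  have h2 := clipF_le' M a
  rw [clipF, this, min_eq_left h2]

lemma clipF_end {M : ℕ} {a a' : ℝ} (ha : |a| = 1) (ha' : |a'| ≤ 1)
    (h : |M * a' - M * a| < 1) : clipF M a' = clipF M a := by
  have h1 := abs_le.1 ha'
  have hM : (0 : ℝ) ≤ M := Nat.cast_nonneg M
  have e1 := mul_le_mul_of_nonneg_left h1.1 hM
  have e2 := mul_le_mul_of_nonneg_left h1.2 hM
  rw [abs_lt] at h
  rcases (abs_eq zero_le_one).1 ha with rfl | rfl
  · have : (M : ℤ) - 1 ≤ ⌊(M : ℝ) * a'⌋ := Int.le_floor.2 (by push_cast; linarith)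
    have h3 : (M : ℤ) - 1 ≤ ⌊(M : ℝ) * 1⌋ := Int.le_floor.2 (by push_cast; linarith)
    rw [clipF, clipF, min_eq_right this, min_eq_right h3]
  · have : ⌊(M : ℝ) * a'⌋ = -(M : ℤ) := by
      rw [Int.floor_eq_iff]; push_cast; constructor <;> linarith
    have h3 : ⌊(M : ℝ) * (-1)⌋ = -(M : ℤ) := by
      rw [Int.floor_eq_iff]; push_cast; constructor <;> linarith
    rw [clipF, clipF, this, h3]

lemma norm_normalize_sub_le {E : Type*} [NormedAddCommGroup E] [NormedSpace ℝ E] {x x' : E}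
    (hx : x ≠ 0) (hx' : x' ≠ 0) : ‖‖x‖⁻¹ • x - ‖x'‖⁻¹ • x'‖ ≤ 2 * ‖x - x'‖ / ‖x‖ := by
  have h := norm_pos_iff.2 hx
  have h' := norm_pos_iff.2 hx'
  have e : ‖x‖⁻¹ • x - ‖x'‖⁻¹ • x' = ‖x‖⁻¹ • (x - x') + (‖x‖⁻¹ - ‖x'‖⁻¹) • x' := by
    module
  have e2 : ‖x‖⁻¹ - ‖x'‖⁻¹ = (‖x'‖ - ‖x‖) / (‖x‖ * ‖x'‖) := by field_simp
  rw [e]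
  refine (norm_add_le _ _).trans ?_
  rw [norm_smul, norm_smul, norm_inv, norm_norm, e2, norm_div, norm_mul, norm_norm, norm_norm]
  have h3 : ‖‖x'‖ - ‖x‖‖ ≤ ‖x - x'‖ := by
    rw [Real.norm_eq_abs, abs_sub_comm]; exact abs_norm_sub_norm_le _ _
  calc _ ≤ ‖x‖⁻¹ * ‖x - x'‖ + ‖x - x'‖ / (‖x‖ * ‖x'‖) * ‖x'‖ := by gcongr
    _ = _ := by field_simp; ring

/-- Coordinates of a quaternion. -/
def crd : ℍ[ℝ] →ₗ[ℝ] (Fin 4 → ℝ) where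
  toFun y := ![y.re, y.imI, y.imJ, y.imK]
  map_add' x y := by ext i; fin_cases i <;> simp
  map_smul' c y := by ext i; fin_cases i <;> simp

/-- The quaternion with given coordinates. -/
def ofCrd (x : Fin 4 → ℝ) : ℍ[ℝ] := ⟨x 0, x 1, x 2, x 3⟩

lemma crd_ofCrd (x : Fin 4 → ℝ) : crd (ofCrd x) = x := by
  ext i; fin_cases i <;> rfl

lemma ofCrd_crd (y : ℍ[ℝ]) : ofCrd (crd y) = y := rfl

lemma crd_one (y : ℍ[ℝ]) : crd y 1 = y.imI := rfl

lemma norm_sq_eq_crd (y : ℍ[ℝ]) :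
    ‖y‖ ^ 2 = crd y 0 ^ 2 + crd y 1 ^ 2 + crd y 2 ^ 2 + crd y 3 ^ 2 := by
  rw [sq, ← Quaternion.normSq_eq_norm_mul_self, Quaternion.normSq_def']; rfl

lemma norm_crd_le (y : ℍ[ℝ]) : ‖crd y‖ ≤ ‖y‖ := by
  rw [pi_norm_le_iff_of_nonneg (norm_nonneg _)]
  intro i
  refine abs_le_of_sq_le_sq ?_ (norm_nonneg _)
  rw [norm_sq_eq_crd]
  fin_cases i <;> simp only [Fin.zero_eta, Fin.mk_one, Fin.reduceFinMk] <;>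
    nlinarith [sq_nonneg (crd y 0), sq_nonneg (crd y 1), sq_nonneg (crd y 2), sq_nonneg (crd y 3)]

lemma norm_le_crd (y : ℍ[ℝ]) : ‖y‖ ≤ 2 * ‖crd y‖ := by
  have h : ∀ i, crd y i ^ 2 ≤ ‖crd y‖ ^ 2 := fun i => sq_le_sq.2 (by
    rw [abs_norm]; exact norm_le_pi_norm (crd y) i)
  refine le_of_sq_le_sq ?_ (by positivity)
  rw [norm_sq_eq_crd]
  linarith [h 0, h 1, h 2, h 3]

/-- Central projection onto the surface of the cube. -/
def cub (y : USphere) : Fin 4 → ℝ := ‖crd y‖⁻¹ • crd y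

lemma half_le_norm_crd (y : USphere) : 1 / 2 ≤ ‖crd y‖ := by
  have := norm_le_crd y
  rw [y.norm_eq] at this
  linarith

lemma crd_ne_zero (y : USphere) : crd y ≠ 0 :=
  norm_ne_zero_iff.1 (by linarith [half_le_norm_crd y])

lemma norm_cub (y : USphere) : ‖cub y‖ = 1 := by
  rw [cub, norm_smul, norm_inv, norm_norm, inv_mul_cancel₀ (norm_ne_zero_iff.2 (crd_ne_zero y))]

lemma abs_cub_le (y : USphere) (i : Fin 4) : |cub y i| ≤ 1 :=
  (norm_le_pi_norm (cub y) i).trans_eq (norm_cub y)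

lemma exists_abs_eq_norm {x : Fin 4 → ℝ} (hx : ‖x‖ = 1) : ∃ i, |x i| = 1 := by
  by_contra! h
  have : ‖x‖ < 1 := (pi_norm_lt_iff one_pos).2 fun i =>
    lt_of_le_of_ne ((norm_le_pi_norm x i).trans_eq hx) (h i)
  exact this.ne hx

lemma norm_cub_sub_le (y y' : USphere) : ‖cub y - cub y'‖ ≤ 4 * ‖(y : ℍ[ℝ]) - y'‖ := by
  refine (norm_normalize_sub_le (crd_ne_zero y) (crd_ne_zero y')).trans ?_
  have h := half_le_norm_crd y
  rw [← map_sub, div_le_iff₀ (by linarith)]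
  have h2 := norm_crd_le ((y : ℍ[ℝ]) - y')
  nlinarith [norm_nonneg ((y : ℍ[ℝ]) - y')]

lemma norm_sub_le_cub (y y' : USphere) : ‖(y : ℍ[ℝ]) - y'‖ ≤ 4 * ‖cub y - cub y'‖ := by
  have key : ∀ y : USphere, 1 ≤ ‖ofCrd (cub y)‖ ∧ (y : ℍ[ℝ]) = ‖ofCrd (cub y)‖⁻¹ • ofCrd (cub y) := by
    intro y
    have e : ofCrd (cub y) = ‖crd y‖⁻¹ • (y : ℍ[ℝ]) := by
      conv_rhs => rw [← ofCrd_crd (y : ℍ[ℝ])]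
      apply Quaternion.ext <;> rfl
    have h1 : ‖crd y‖ ≤ 1 := (norm_crd_le y).trans_eq y.norm_eq
    have h2 := half_le_norm_crd y
    have e2 : ‖ofCrd (cub y)‖ = ‖crd y‖⁻¹ := by
      rw [e, norm_smul, y.norm_eq, mul_one, norm_inv, norm_norm]
    refine ⟨?_, ?_⟩
    · rw [e2]; exact (one_le_inv₀ (by linarith)).2 h1
    · rw [e2, inv_inv, e, smul_smul, mul_inv_cancel₀ (by linarith), one_smul]
  have h0 : ∀ y : USphere, ofCrd (cub y) ≠ 0 := fun y =>
    norm_ne_zero_iff.1 (by linarith [(key y).1])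
  conv_lhs => rw [(key y).2, (key y').2]
  refine (norm_normalize_sub_le (h0 y) (h0 y')).trans ?_
  have h1 := norm_le_crd (ofCrd (cub y) - ofCrd (cub y'))
  rw [map_sub, crd_ofCrd, crd_ofCrd] at h1
  rw [div_le_iff₀ (by linarith [(key y).1])]
  nlinarith [(key y).1, norm_nonneg (cub y - cub y')]

lemma measurable_cub (i : Fin 4) : Measurable fun y : USphere => cub y i := by
  have h : Continuous crd := crd.continuous_of_finiteDimensional
  have h2 : Measurable fun y : USphere => crd y := (h.comp continuous_subtype_val).measurable
  exact (measurable_pi_iff.1 (h2.norm.inv.smul h2)) i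

/-- Folding onto a half sphere. -/
def up (y : USphere) : USphere := if 0 ≤ (y : ℍ[ℝ]).imI then y else cj y

lemma up_cases (y : USphere) : up y = y ∨ up y = cj y := by
  unfold up; split_ifs <;> simp

lemma up_imI (y : USphere) : 0 ≤ (up y : ℍ[ℝ]).imI := by
  unfold up
  split_ifs with h
  · exact h
  · rw [cj_coe, Quaternion.imI_star]; linarith

lemma up_of_pos {y : USphere} (h : 0 < (y : ℍ[ℝ]).imI) : up y = y := if_pos h.le

lemma up_cj_of_pos {y : USphere} (h : 0 < (y : ℍ[ℝ]).imI) : up (cj y) = y := by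
  have : ¬ 0 ≤ (cj y : ℍ[ℝ]).imI := by rw [cj_coe, Quaternion.imI_star]; linarith
  rw [up, if_neg this, cj_cj]

lemma measurable_upS : Measurable up :=
  Measurable.ite (measurableSet_le measurable_const
    (Quaternion.continuous_imI.comp continuous_subtype_val).measurable) measurable_id
    continuous_cj.measurable

lemma dF_up (y y' : USphere) : dF (up y) (up y') = dF y y' := by
  rcases up_cases y with h | h <;> rcases up_cases y' with h' | h' <;> rw [h, h'] <;>
    simp only [dF_cj_left, dF_cj_right]

/-- The lattice index of a point of the folded sphere. -/
def idx (M : ℕ) (y : USphere) : Fin 4 → ℤ := fun i => clipF M (cub (up y) i)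

lemma measurable_idx (M : ℕ) : Measurable (idx M) := by
  refine measurable_pi_iff.2 fun i => ?_
  have h := ((measurable_cub i).comp measurable_upS).const_mul (M : ℝ)
  exact (Int.measurable_floor.comp h).min measurable_const

lemma finite_range_idx {M : ℕ} (hM : 0 < M) : (Set.range (idx M)).Finite := by
  refine (Set.finite_Icc (fun _ : Fin 4 => -(M : ℤ)) (fun _ => (M : ℤ) - 1)).subset ?_
  rintro _ ⟨y, rfl⟩
  exact ⟨fun i => neg_le_clipF hM (abs_le.1 (abs_cub_le _ i)).1, fun i => clipF_le' _ _⟩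

lemma idx_nest {M N : ℕ} (hN : 0 < N) {y y' : USphere} (h : idx (N * M) y = idx (N * M) y') :
    idx M y = idx M y' :=
  funext fun i => clipF_nest hN (congrFun h i)

lemma dF_le_of_idx_eq {M : ℕ} (hM : 0 < M) {y y' : USphere} (h : idx M y = idx M y') :
    dF y y' ≤ 1 / M := by
  have hM' : (0 : ℝ) < M := by exact_mod_cast hM
  rw [← dF_up]
  refine (dF_le _ _).trans ?_
  have h1 := norm_sub_le_cub (up y) (up y')
  have h2 : ‖cub (up y) - cub (up y')‖ ≤ 1 / M := by
    refine (pi_norm_le_iff_of_nonneg (by positivity)).2 fun i => ?_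
    have e1 := clipF_le M (cub (up y) i)
    have e2 := clipF_le M (cub (up y') i)
    have e3 := le_clipF (M := M) (abs_le.1 (abs_cub_le (up y) i)).2
    have e4 := le_clipF (M := M) (abs_le.1 (abs_cub_le (up y') i)).2
    have e5 : clipF M (cub (up y) i) = clipF M (cub (up y') i) := congrFun h i
    rw [e5] at e1 e3
    have e6 : |cub (up y) i - cub (up y') i| * M = |(cub (up y) i - cub (up y') i) * M| := by
      rw [abs_mul, abs_of_pos hM']
    rw [Pi.sub_apply, Real.norm_eq_abs, le_div_iff₀ hM', e6, abs_le]
    constructor <;> linarith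
  linarith

lemma exists_idx_core {M : ℕ} (hM : 0 < M) (y : USphere) : ∃ c : USphere,
    (∀ y', dF y' c < 1 / 32 * (1 / M) → idx M y' = idx M y) ∧ 1 / 32 * (1 / M) ≤ dF (-1) c := by
  have hM' : (0 : ℝ) < M := by exact_mod_cast hM
  set t := cub (up y) with ht
  obtain ⟨i0, hi0⟩ := exists_abs_eq_norm (norm_cub (up y))
  set τ : Fin 4 → ℝ := fun i => if i = i0 then t i0 else (clipF M (t i) + 1 / 2) / M with hτ
  have hτ0 : τ i0 = t i0 := if_pos rfl
  have hτle : ∀ i, |τ i| ≤ 1 := by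
    intro i
    simp only [hτ]
    split_ifs with h
    · exact hi0.le
    · rw [abs_div, abs_of_pos hM', div_le_one hM']
      have h1 : (-(M : ℝ)) ≤ clipF M (t i) := by
        exact_mod_cast neg_le_clipF hM (abs_le.1 (abs_cub_le (up y) i)).1
      have h2 : (clipF M (t i) : ℝ) ≤ M - 1 := by exact_mod_cast clipF_le' M (t i)
      rw [abs_le]; constructor <;> linarith
  have hτn : ‖τ‖ = 1 := by
    refine le_antisymm ((pi_norm_le_iff_of_nonneg zero_le_one).2 hτle) ?_
    have := norm_le_pi_norm τ i0
    rwa [hτ0, Real.norm_eq_abs, hi0] at this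
  have ht1 : 0 ≤ t 1 := by
    have := up_imI y
    rw [ht, cub, Pi.smul_apply, crd_one]
    positivity
  have hτ1 : 1 / 2 * (1 / M) ≤ τ 1 := by
    simp only [hτ]
    split_ifs with h
    · rw [← h] at hi0 ⊢
      rw [show t 1 = 1 by rw [← hi0]; exact (abs_of_nonneg ht1).symm]
      have : (1 : ℝ) / M ≤ 1 := (div_le_one hM').2 (by exact_mod_cast hM)
      linarith
    · have : (0 : ℤ) ≤ clipF M (t 1) := le_min (Int.floor_nonneg.2 (by positivity)) (by omega)
      have h2 : (0 : ℝ) ≤ clipF M (t 1) := by exact_mod_cast this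
      rw [mul_one_div]
      gcongr
      linarith
  have hX1 : ‖ofCrd τ‖ ≤ 2 := by
    have := norm_le_crd (ofCrd τ)
    rwa [crd_ofCrd, hτn, mul_one] at this
  have hX0 : 1 ≤ ‖ofCrd τ‖ := by
    have := norm_crd_le (ofCrd τ)
    rwa [crd_ofCrd, hτn] at this
  have hX : ofCrd τ ≠ 0 := norm_ne_zero_iff.1 (by linarith)
  set c := toSph (ofCrd τ) hX with hc
  have hcc : (c : ℍ[ℝ]) = ‖ofCrd τ‖⁻¹ • ofCrd τ := rfl
  have hcrd : crd c = ‖ofCrd τ‖⁻¹ • τ := by rw [hcc, map_smul, crd_ofCrd]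
  have hcub : cub c = τ := by
    rw [cub, hcrd, norm_smul, hτn, mul_one, norm_inv, norm_norm, inv_inv, smul_smul,
      mul_inv_cancel₀ (by linarith), one_smul]
  have hcI : 1 / 4 * (1 / M) ≤ (c : ℍ[ℝ]).imI := by
    rw [← crd_one, hcrd, Pi.smul_apply, smul_eq_mul, inv_mul_eq_div, le_div_iff₀ (by linarith)]
    have : (0 : ℝ) < 1 / M := by positivity
    nlinarith
  have hI : ∀ x z : ℍ[ℝ], |x.imI - z.imI| ≤ ‖x - z‖ := fun x z =>
    (norm_le_pi_norm (crd (x - z)) 1).trans (norm_crd_le _)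
  have key : ∀ y' : USphere, ‖(y' : ℍ[ℝ]) - c‖ < 1 / 8 * (1 / M) →
      0 < (y' : ℍ[ℝ]).imI ∧ idx M y' = idx M y := by
    intro y' hy'
    have h1 : 0 < (y' : ℍ[ℝ]).imI := by
      have := (abs_le.1 (hI y' c)).1
      have : (0 : ℝ) < 1 / M := by positivity
      linarith
    refine ⟨h1, funext fun i => ?_⟩
    have h2 : |M * cub y' i - M * τ i| < 1 / 2 := by
      rw [← mul_sub, abs_mul, abs_of_pos hM', ← hcub]
      have h3 := (norm_le_pi_norm (cub y' - cub c) i).trans (norm_cub_sub_le y' c)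
      rw [Pi.sub_apply, Real.norm_eq_abs] at h3
      calc _ ≤ M * (4 * ‖(y' : ℍ[ℝ]) - c‖) := by gcongr
        _ < M * (4 * (1 / 8 * (1 / M))) := by gcongr
        _ = 1 / 2 := by field_simp; norm_num
    rw [idx, idx, up_of_pos h1, ← ht]
    by_cases h : i = i0
    · rw [h] at h2 ⊢
      rw [hτ0] at h2
      exact clipF_end hi0 (abs_cub_le _ _) (by linarith)
    · refine clipF_mid ?_
      rw [show τ i = (clipF M (t i) + 1 / 2) / M from if_neg h, mul_div_cancel₀ _ hM'.ne'] at h2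
      exact h2
  refine ⟨c, fun y' hy' => ?_, ?_⟩
  · rcases dF_cases y' c with h | h
    · exact (key y' (by linarith)).2
    · rw [cj_coe, norm_sub_star_comm, norm_sub_rev, ← cj_coe] at h
      obtain ⟨h1, h2⟩ := key (cj y') (by linarith)
      rw [← h2]
      have h3 : up y' = up (cj y') := by
        rw [up_of_pos h1, ← up_cj_of_pos h1, cj_cj]
      unfold idx
      rw [h3]
  · have h0 : (0 : ℝ) < 1 / M := by positivity
    have e0 : (((-1 : USphere) : ℍ[ℝ])).imI = 0 := by
      simp [USphere.coe_one]
    rcases dF_cases (-1) c with h | h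
    · have := (abs_le.1 (hI ((-1 : USphere) : ℍ[ℝ]) c)).1
      rw [e0] at this
      linarith
    · have := (abs_le.1 (hI ((-1 : USphere) : ℍ[ℝ]) (cj c))).2
      rw [e0, cj_coe, Quaternion.imI_star, ← cj_coe] at this
      linarith

/-- A nested sequence of finite partitions of a probability space with a distance, whose cells of
level `j` have size comparable to `θ ^ (2 * j)`, each cell `{y | cen j y = κ}` being represented by
a point `κ` around which it contains a ball. -/
structure Grid (T : Type*) [MeasurableSpace T] (μ : Measure T) where
  d : T → T → ℝ
  o : T
  c : ℝ
  θ : ℝ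
  P : ℝ
  H : ℝ
  Q : ℝ
  cen : ℕ → T → T
  d_self : ∀ x, d x x = 0
  d_comm : ∀ x y, d x y = d y x
  d_nonneg : ∀ x y, 0 ≤ d x y
  d_tri : ∀ x y z, d x z ≤ d x y + d y z
  d_meas : ∀ x, Measurable fun y => d y x
  d_le_one : ∀ x y, d x y ≤ 1
  cen_meas : ∀ j z, MeasurableSet {y | cen j y = z}
  cen_fin : ∀ j, (Set.range (cen j)).Finite
  idem : ∀ j y, cen j (cen j y) = cen j y
  nest : ∀ j y y', cen (j + 1) y = cen (j + 1) y' → cen j y = cen j y'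
  diam : ∀ j y y', cen j y = cen j y' → d y y' ≤ θ ^ (2 * j)
  core : ∀ j y z, d y (cen j z) < c * θ ^ (2 * j) → cen j y = cen j z
  core_o : ∀ j z, c * θ ^ (2 * j) ≤ d o (cen j z)
  pack : ∀ j y (s : Finset T), (∀ κ ∈ s, cen j κ = κ ∧ d y κ ≤ 3 * θ ^ (2 * j)) → (s.card : ℝ) ≤ P
  bump : ∀ j z, μ.real {y | cen j y = cen j z} ≤
    H * μ.real {y | d y (cen j z) ≤ c * θ ^ (2 * j) / 2}
  ratio : ∀ j z, μ.real {y | cen j y = cen j z} ≤ Q * μ.real {y | cen (j + 1) y = cen (j + 1) z}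
  pos : ∀ j z, 0 < μ.real {y | cen j y = cen j z}
  c_pos : 0 < c
  c_le : c ≤ 1
  θ_pos : 0 < θ
  P_nonneg : 0 ≤ P
  H_pos : 0 < H
  small : 6 * (2 * P + 2 + 4 * H / c) * θ ≤ 1

/-- Bounded strongly measurable functions. -/
def Nice {T F : Type*} [MeasurableSpace T] [NormedRing F] (f : T → F) : Prop :=
  StronglyMeasurable f ∧ ∃ C, ∀ y, ‖f y‖ ≤ C

namespace Nice
variable {T F : Type*} [MeasurableSpace T] [NormedRing F] {f h : T → F}

lemma add (hf : Nice f) (hh : Nice h) : Nice fun y => f y + h y := by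
  obtain ⟨⟨hf, C, hC⟩, hh, C', hC'⟩ := hf, hh
  exact ⟨hf.add hh, C + C', fun y => (norm_add_le _ _).trans (add_le_add (hC y) (hC' y))⟩

lemma sub (hf : Nice f) (hh : Nice h) : Nice fun y => f y - h y := by
  obtain ⟨⟨hf, C, hC⟩, hh, C', hC'⟩ := hf, hh
  exact ⟨hf.sub hh, C + C', fun y => (norm_sub_le _ _).trans (add_le_add (hC y) (hC' y))⟩

lemma const_mul (a : F) (hf : Nice f) : Nice fun y => a * f y := by
  obtain ⟨hf, C, hC⟩ := hf
  exact ⟨hf.const_mul a, ‖a‖ * C, fun y =>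
    (norm_mul_le _ _).trans (mul_le_mul_of_nonneg_left (hC y) (norm_nonneg _))⟩

lemma smul [NormedAlgebra ℝ F] {r : T → ℝ} (hr : Nice r) (hf : Nice f) :
    Nice fun y => r y • f y := by
  obtain ⟨⟨hr, C, hC⟩, hf, C', hC'⟩ := hr, hf
  refine ⟨hr.smul hf, C * C', fun y => ?_⟩
  rw [norm_smul]
  exact mul_le_mul (hC y) (hC' y) (norm_nonneg _) ((norm_nonneg _).trans (hC y))

lemma sum {ι : Type*} (s : Finset ι) {f : ι → T → F} (hf : ∀ i ∈ s, Nice (f i)) :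
    Nice fun y => ∑ i ∈ s, f i y := by
  choose! C hC using fun i hi => (hf i hi).2
  refine ⟨?_, ∑ i ∈ s, C i, fun y => (norm_sum_le _ _).trans (Finset.sum_le_sum fun i hi => hC i hi y)⟩
  exact Finset.stronglyMeasurable_fun_sum s fun i hi => (hf i hi).1

lemma integrable (hf : Nice f) (μ : Measure T) [IsFiniteMeasure μ] : Integrable f μ := by
  obtain ⟨hf, C, hC⟩ := hf
  exact Integrable.of_bound hf.aestronglyMeasurable C (Filter.Eventually.of_forall hC)

lemma of_tendsto {f : ℕ → T → F} {h : T → F} (hf : ∀ n, StronglyMeasurable (f n)) {C : ℝ}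
    (hC : ∀ y, ‖h y‖ ≤ C) (hlim : ∀ y, Filter.Tendsto (fun n => f n y) Filter.atTop (nhds (h y))) :
    Nice h :=
  ⟨stronglyMeasurable_of_tendsto Filter.atTop hf (tendsto_pi_nhds.2 hlim), C, hC⟩

end Nice

namespace Grid
variable {T : Type*} [MeasurableSpace T] {μ : Measure T} [IsProbabilityMeasure μ] (g : Grid T μ)
variable {F : Type*} [NormedRing F] [NormedAlgebra ℝ F] [CompleteSpace F] {f h : T → F} {j : ℕ}

/-- The scale of level `j`. -/
def δ (j : ℕ) : ℝ := g.θ ^ (2 * j)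

/-- The cell of level `j` containing `y`. -/
def cell (j : ℕ) (y : T) : Set T := {z | g.cen j z = g.cen j y}

/-- The centers of level `j`. -/
def C (j : ℕ) : Finset T := (g.cen_fin j).toFinset

lemma δ_pos (j : ℕ) : 0 < g.δ j := pow_pos g.θ_pos _

lemma mem_C {κ : T} : κ ∈ g.C j ↔ g.cen j κ = κ := by
  rw [C, Set.Finite.mem_toFinset]
  exact ⟨by rintro ⟨y, rfl⟩; exact g.idem j y, fun h => ⟨κ, h⟩⟩

lemma cen_mem (j : ℕ) (y : T) : g.cen j y ∈ g.C j := g.mem_C.2 (g.idem j y)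

lemma measurableSet_cell (j : ℕ) (y : T) : MeasurableSet (g.cell j y) := g.cen_meas _ _

lemma cell_pos (j : ℕ) (y : T) : 0 < μ.real (g.cell j y) := g.pos j y

lemma nice_of_cells {G : T → T → F} (hG : ∀ κ ∈ g.C j, Nice (G κ)) :
    Nice fun y => G (g.cen j y) y := by
  classical
  have e : (fun y => G (g.cen j y) y) =
      fun y => ∑ κ ∈ g.C j, {z | g.cen j z = κ}.indicator (G κ) y := by
    funext y
    refine Eq.symm ((Finset.sum_eq_single (g.cen j y) (fun κ _ hκ => ?_) fun h =>
      absurd (g.cen_mem j y) h).trans ?_)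
    · exact Set.indicator_of_notMem (s := {z | g.cen j z = κ}) (a := y) (fun h => hκ (Eq.symm h)) _
    · rw [Set.indicator_apply, if_pos (by exact rfl)]
  rw [e]
  refine Nice.sum _ fun κ hκ => ?_
  obtain ⟨h, C, hC⟩ := hG κ hκ
  exact ⟨h.indicator (g.cen_meas j κ), C, fun y => (norm_indicator_le_norm_self _ _).trans (hC y)⟩

/-- Functions that are constant on the cells of level `j`. -/
def Lev {X : Type*} (j : ℕ) (v : T → X) : Prop := ∀ y y', g.cen j y = g.cen j y' → v y = v y'

lemma Lev.cen_eq {g : Grid T μ} {X : Type*} {v : T → X} (hv : g.Lev j v) (y : T) :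
    v (g.cen j y) = v y := hv _ _ (g.idem j y)

lemma Lev.succ {g : Grid T μ} {X : Type*} {v : T → X} (hv : g.Lev j v) : g.Lev (j + 1) v :=
  fun y y' h => hv y y' (g.nest j y y' h)

lemma Lev.nice {g : Grid T μ} {v : T → F} (hv : g.Lev j v) : Nice v := by
  have e : v = fun y => (fun κ (_ : T) => v κ) (g.cen j y) y := funext fun y => (hv.cen_eq y).symm
  rw [e]
  exact g.nice_of_cells fun κ _ => ⟨stronglyMeasurable_const, ‖v κ‖, fun _ => le_rfl⟩

/-- Averages over the cells of level `j`. -/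
def avg (j : ℕ) (f : T → F) (y : T) : F := (μ.real (g.cell j y))⁻¹ • ∫ z in g.cell j y, f z ∂μ

lemma cell_congr {y y' : T} (h : g.cen j y = g.cen j y') : g.cell j y = g.cell j y' := by
  unfold cell; rw [h]

lemma lev_avg (j : ℕ) (f : T → F) : g.Lev j (g.avg j f) := fun y y' h => by
  rw [avg, avg, g.cell_congr h]

lemma setIntegral_cell_lev {v : T → F} (hv : g.Lev j v) (y : T) :
    ∫ z in g.cell j y, v z ∂μ = μ.real (g.cell j y) • v y := by
  rw [setIntegral_congr_fun (g := fun _ => v y) (g.measurableSet_cell j y) fun z hz => hv z y hz,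
    setIntegral_const]

lemma avg_lev {v : T → F} (hv : g.Lev j v) : g.avg j v = v := funext fun y => by
  rw [avg, g.setIntegral_cell_lev hv, smul_smul, inv_mul_cancel₀ (g.cell_pos j y).ne', one_smul]

lemma avg_add (hf : Nice f) (hh : Nice h) (y : T) :
    g.avg j (fun y => f y + h y) y = g.avg j f y + g.avg j h y := by
  rw [avg, integral_add (hf.integrable _) (hh.integrable _), smul_add]; rfl

lemma avg_sub (hf : Nice f) (hh : Nice h) (y : T) :
    g.avg j (fun y => f y - h y) y = g.avg j f y - g.avg j h y := by
  rw [avg, integral_sub (hf.integrable _) (hh.integrable _), smul_sub]; rfl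

lemma avg_const_mul (a : F) (hf : Nice f) (y : T) :
    g.avg j (fun y => a * f y) y = a * g.avg j f y := by
  rw [avg, integral_const_mul_of_integrable (hf.integrable _), ← mul_smul_comm]; rfl

lemma avg_smul_lev {v : T → F} (hv : g.Lev j v) (r : T → ℝ) (y : T) :
    g.avg j (fun y => r y • v y) y = g.avg j r y • v y := by
  rw [avg, setIntegral_congr_fun (g := fun z => r z • v y) (g.measurableSet_cell j y)
    fun z hz => by rw [hv z y hz], integral_smul_const, smul_smul]; rfl

lemma norm_avg_sub_le (hf : Nice f) {y : T} {a : F} {r : ℝ}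
    (hr : ∀ z, g.cen j z = g.cen j y → ‖f z - a‖ ≤ r) : ‖g.avg j f y - a‖ ≤ r := by
  have e : g.avg j f y - a = (μ.real (g.cell j y))⁻¹ • ∫ z in g.cell j y, (f z - a) ∂μ := by
    rw [integral_sub (hf.integrable _) (integrable_const _), setIntegral_const, smul_sub, smul_smul,
      inv_mul_cancel₀ (g.cell_pos j y).ne', one_smul]; rfl
  rw [e, norm_smul, norm_inv, Real.norm_of_nonneg (g.cell_pos j y).le,
    inv_mul_le_iff₀ (g.cell_pos j y), mul_comm]
  exact norm_setIntegral_le_of_norm_le_const (measure_lt_top _ _) fun z hz => hr z hz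

lemma norm_avg_le (hf : Nice f) {y : T} {r : ℝ}
    (hr : ∀ z, g.cen j z = g.cen j y → ‖f z‖ ≤ r) : ‖g.avg j f y‖ ≤ r := by
  simpa using g.norm_avg_sub_le (a := 0) hf (y := y) (r := r) (by simpa using hr)

lemma norm_avg_sub_avg_le (hf : Nice f) {y y' : T} {r : ℝ}
    (hr : ∀ z z', g.cen j z = g.cen j y → g.cen j z' = g.cen j y' → ‖f z - f z'‖ ≤ r) :
    ‖g.avg j f y - g.avg j f y'‖ ≤ r := by
  refine g.norm_avg_sub_le hf fun z hz => ?_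
  rw [norm_sub_rev]
  refine g.norm_avg_sub_le hf fun z' hz' => ?_
  rw [norm_sub_rev]
  exact hr z z' hz hz'

lemma setIntegral_cell_eq_sum (hf : Nice f) (y : T) : ∃ s : Finset T,
    ∫ z in g.cell j y, f z ∂μ = ∑ κ ∈ s, ∫ z in g.cell (j + 1) κ, f z ∂μ ∧
    s = by classical exact (g.C (j + 1)).filter fun κ => g.cen j κ = g.cen j y := by
  classical
  refine ⟨_, ?_, rfl⟩
  rw [← integral_biUnion_finset]
  · congr 2
    ext z
    simp only [Finset.mem_filter, Set.mem_iUnion, exists_prop]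
    constructor
    · intro hz
      exact ⟨g.cen (j + 1) z, ⟨g.cen_mem _ _, (g.nest j _ _ (g.idem _ _)).trans hz⟩,
        (g.idem _ _).symm⟩
    · rintro ⟨κ, ⟨_, h1⟩, h2⟩
      exact (g.nest j _ _ h2).trans h1
  · exact fun κ _ => g.measurableSet_cell _ _
  · intro κ hκ κ' hκ' hne
    refine Set.disjoint_left.2 fun z h1 h2 => hne ?_
    rw [← g.mem_C.1 (Finset.mem_filter.1 hκ).1, ← g.mem_C.1 (Finset.mem_filter.1 hκ').1]
    exact (Eq.symm h1).trans h2
  · exact fun κ _ => (hf.integrable μ).integrableOn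

lemma avg_avg_succ (hf : Nice f) : g.avg j (g.avg (j + 1) f) = g.avg j f := by
  funext y
  obtain ⟨s, h1, hs⟩ := g.setIntegral_cell_eq_sum (j := j) hf y
  obtain ⟨s', h2, hs'⟩ := g.setIntegral_cell_eq_sum (j := j) (g.lev_avg (j + 1) f).nice y
  rw [avg, avg, h1, h2, hs, hs']
  congr 1
  refine Finset.sum_congr rfl fun κ _ => ?_
  rw [g.setIntegral_cell_lev (g.lev_avg _ _), avg, smul_smul,
    mul_inv_cancel₀ (g.cell_pos _ _).ne', one_smul]

end Grid

namespace Grid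
variable {T : Type*} [MeasurableSpace T] {μ : Measure T} [IsProbabilityMeasure μ] (g : Grid T μ)
variable {F : Type*} [NormedRing F] [NormedAlgebra ℝ F] [CompleteSpace F] {v w : T → F} {j : ℕ}
variable {A : ℝ} {y y' : T}

/-- Cut-off near the base point. -/
def chi (j : ℕ) (y : T) : ℝ := min (g.d y g.o / g.δ j) 1

/-- Hat function around a center. -/
def hat (j : ℕ) (κ y : T) : ℝ := max (2 - g.d y κ / g.δ j) 0

/-- Smoothing of a function given on the centers. -/
def smth (j : ℕ) (v : T → F) (y : T) : F :=
  (∑ κ ∈ g.C j, g.hat j κ y)⁻¹ • ∑ κ ∈ g.C j, g.hat j κ y • v κ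

/-- Hat functions supported in the cells. -/
def bet (j : ℕ) (y : T) : ℝ := max (1 - g.d y (g.cen j y) / (g.c * g.δ j)) 0

/-- Normalized hat functions supported in the cells. -/
def bmp (j : ℕ) (y : T) : ℝ := (g.avg j (g.bet j) y)⁻¹ * g.bet j y

/-- Smoothing followed by cut-off. -/
def pre (j : ℕ) (v : T → F) (y : T) : F := g.chi j y • g.smth j v y

/-- Regularization of a level function preserving the averages over cells. -/
def reg (j : ℕ) (v : T → F) (y : T) : F := g.pre j v y + g.bmp j y • (v y - g.avg j (g.pre j v) y)

/-- Oscillation bound at the scale of level `j`. -/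
def Osc (j : ℕ) (A : ℝ) (v : T → F) : Prop :=
  (∀ y y', g.d y y' ≤ 4 * g.δ j → ‖v y - v y'‖ ≤ A) ∧ ∀ y, g.d y g.o ≤ 4 * g.δ j → ‖v y‖ ≤ A

/-- The constant in the estimates. -/
def L : ℝ := 2 * g.P + 2 + 4 * g.H / g.c

lemma two_le_L : 2 ≤ g.L := by
  have h1 := g.P_nonneg
  have h2 := div_pos g.H_pos g.c_pos
  unfold L; rw [mul_div_assoc]; linarith

lemma L_pos : 0 < g.L := two_pos.trans_le g.two_le_L

lemma L_θ : 6 * g.L * g.θ ≤ 1 := g.small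

lemma θ_le : g.θ ≤ 1 / 12 := by
  have h1 := g.L_θ
  have h2 := g.two_le_L
  nlinarith [g.θ_pos]

lemma Osc.nonneg {g : Grid T μ} (h : g.Osc j A v) : 0 ≤ A :=
  (norm_nonneg _).trans (h.2 g.o (by rw [g.d_self]; have := g.δ_pos j; linarith))

lemma abs_d_sub_le (y y' κ : T) : |g.d y κ - g.d y' κ| ≤ g.d y y' := by
  have h1 := g.d_tri y y' κ
  have h2 := g.d_tri y' y κ
  rw [g.d_comm y' y] at h2
  rw [abs_le]; constructor <;> linarith

lemma d_cen_le (j : ℕ) (y : T) : g.d y (g.cen j y) ≤ g.δ j := g.diam j _ _ (g.idem j y).symm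

lemma hat_nonneg (κ y : T) : 0 ≤ g.hat j κ y := le_max_right _ _

lemma hat_le (κ y : T) : g.hat j κ y ≤ 2 :=
  max_le (by have := div_nonneg (g.d_nonneg y κ) (g.δ_pos j).le; linarith) two_pos.le

lemma hat_eq_zero {κ : T} (h : 2 * g.δ j ≤ g.d y κ) : g.hat j κ y = 0 :=
  max_eq_right (by rw [sub_nonpos, le_div_iff₀ (g.δ_pos j)]; exact h)

lemma abs_hat_sub_le (κ y y' : T) : |g.hat j κ y - g.hat j κ y'| ≤ g.d y y' / g.δ j := by
  refine (abs_max_sub_max_le_abs _ _ _).trans ?_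
  rw [sub_sub_sub_cancel_left, ← sub_div, abs_div, abs_of_pos (g.δ_pos j), abs_sub_comm]
  exact div_le_div_of_nonneg_right (g.abs_d_sub_le y y' κ) (g.δ_pos j).le

lemma one_le_sum_hat (j : ℕ) (y : T) : 1 ≤ ∑ κ ∈ g.C j, g.hat j κ y := by
  refine le_trans ?_ (Finset.single_le_sum (fun κ _ => g.hat_nonneg (j := j) κ y) (g.cen_mem j y))
  refine le_max_of_le_left ?_
  have := (div_le_one (g.δ_pos j)).2 (g.d_cen_le j y)
  linarith

lemma sum_abs_hat_sub_le (h : g.d y y' ≤ g.δ j) :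
    ∑ κ ∈ g.C j, |g.hat j κ y - g.hat j κ y'| ≤ g.P * (g.d y y' / g.δ j) := by
  classical
  have h0 : ∀ κ ∈ g.C j, |g.hat j κ y - g.hat j κ y'| ≠ 0 → g.d y κ ≤ 3 * g.δ j := by
    intro κ _ hne
    by_contra hlt
    have h1 := g.d_tri y y' κ
    refine hne ?_
    rw [g.hat_eq_zero, g.hat_eq_zero, sub_zero, abs_zero] <;> linarith [g.δ_pos j]
  rw [← Finset.sum_filter_of_ne h0]
  refine (Finset.sum_le_card_nsmul _ _ _ fun κ _ => g.abs_hat_sub_le κ y y').trans ?_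
  rw [nsmul_eq_mul]
  refine mul_le_mul_of_nonneg_right (g.pack j y _ fun κ hκ => ?_)
    (div_nonneg (g.d_nonneg _ _) (g.δ_pos j).le)
  obtain ⟨h1, h2⟩ := Finset.mem_filter.1 hκ
  exact ⟨g.mem_C.1 h1, h2⟩

lemma smth_sub (v : T → F) (a : F) (y : T) : g.smth j v y - a =
    (∑ κ ∈ g.C j, g.hat j κ y)⁻¹ • ∑ κ ∈ g.C j, g.hat j κ y • (v κ - a) := by
  have h := g.one_le_sum_hat j y
  simp only [smul_sub]
  rw [Finset.sum_sub_distrib, ← Finset.sum_smul, smul_sub, smul_smul,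
    inv_mul_cancel₀ (by linarith), one_smul]
  rfl

lemma norm_sum_hat_le {a : F} (hA : ∀ κ, g.d y κ ≤ 2 * g.δ j → ‖v κ - a‖ ≤ A) :
    ‖∑ κ ∈ g.C j, g.hat j κ y • (v κ - a)‖ ≤ (∑ κ ∈ g.C j, g.hat j κ y) * A := by
  rw [Finset.sum_mul]
  refine norm_sum_le_of_le _ fun κ _ => ?_
  rw [norm_smul, Real.norm_of_nonneg (g.hat_nonneg κ y)]
  by_cases h : g.d y κ ≤ 2 * g.δ j
  · exact mul_le_mul_of_nonneg_left (hA κ h) (g.hat_nonneg κ y)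
  · rw [g.hat_eq_zero (by linarith), zero_mul, zero_mul]

lemma norm_smth_sub_le {a : F} (hA : ∀ κ, g.d y κ ≤ 2 * g.δ j → ‖v κ - a‖ ≤ A) :
    ‖g.smth j v y - a‖ ≤ A := by
  have h := g.one_le_sum_hat j y
  rw [smth_sub, norm_smul, norm_inv, Real.norm_of_nonneg (by linarith), inv_mul_le_iff₀ (by linarith)]
  exact g.norm_sum_hat_le hA

lemma norm_smth_sub_smth_le (hv : g.Osc j A v) (h : g.d y y' ≤ g.δ j) :
    ‖g.smth j v y - g.smth j v y'‖ ≤ 2 * g.P * (g.d y y' / g.δ j) * A := by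
  have hδ := g.δ_pos j
  have hS := g.one_le_sum_hat j y
  have hS' := g.one_le_sum_hat j y'
  have hd := g.sum_abs_hat_sub_le h
  have hN' : ‖∑ κ ∈ g.C j, g.hat j κ y' • (v κ - v y)‖ ≤ (∑ κ ∈ g.C j, g.hat j κ y') * A :=
    g.norm_sum_hat_le fun κ hκ => hv.1 _ _ (by
      have := g.d_tri y y' κ
      rw [g.d_comm]; linarith)
  have hNN : ‖∑ κ ∈ g.C j, g.hat j κ y • (v κ - v y) - ∑ κ ∈ g.C j, g.hat j κ y' • (v κ - v y)‖ ≤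
      (∑ κ ∈ g.C j, |g.hat j κ y - g.hat j κ y'|) * A := by
    rw [← Finset.sum_sub_distrib, Finset.sum_mul]
    refine norm_sum_le_of_le _ fun κ _ => ?_
    rw [← sub_smul, norm_smul, Real.norm_eq_abs]
    by_cases h1 : g.d y κ ≤ 4 * g.δ j
    · exact mul_le_mul_of_nonneg_left (hv.1 _ _ (by rwa [g.d_comm])) (abs_nonneg _)
    · have h2 := g.d_tri y y' κ
      rw [g.hat_eq_zero, g.hat_eq_zero, sub_zero, abs_zero, zero_mul, zero_mul] <;> linarith
  have hSS : |(∑ κ ∈ g.C j, g.hat j κ y) - ∑ κ ∈ g.C j, g.hat j κ y'| ≤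
      ∑ κ ∈ g.C j, |g.hat j κ y - g.hat j κ y'| := by
    rw [← Finset.sum_sub_distrib]; exact Finset.abs_sum_le_sum_abs _ _
  rw [← sub_sub_sub_cancel_right _ _ (v y), smth_sub, smth_sub]
  set S := ∑ κ ∈ g.C j, g.hat j κ y
  set S' := ∑ κ ∈ g.C j, g.hat j κ y'
  set N := ∑ κ ∈ g.C j, g.hat j κ y • (v κ - v y)
  set N' := ∑ κ ∈ g.C j, g.hat j κ y' • (v κ - v y)
  have hA := hv.nonneg
  rw [show S⁻¹ • N - S'⁻¹ • N' = S⁻¹ • (N - N') + (S⁻¹ - S'⁻¹) • N' by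
    rw [smul_sub, sub_smul]; abel]
  have hi : S⁻¹ ≤ 1 := inv_le_one_of_one_le₀ hS
  have hi0 : 0 ≤ S⁻¹ := inv_nonneg.2 (by linarith)
  have e1 : ‖S⁻¹ • (N - N')‖ ≤ g.P * (g.d y y' / g.δ j) * A := by
    rw [norm_smul, Real.norm_of_nonneg hi0]
    refine (mul_le_of_le_one_left (norm_nonneg _) hi).trans (hNN.trans ?_)
    gcongr
  have e2 : ‖(S⁻¹ - S'⁻¹) • N'‖ ≤ g.P * (g.d y y' / g.δ j) * A := by
    rw [norm_smul, inv_sub_inv (zero_lt_one.trans_le hS).ne' (zero_lt_one.trans_le hS').ne', Real.norm_eq_abs, abs_div, abs_sub_comm,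
      abs_of_pos (mul_pos (zero_lt_one.trans_le hS) (zero_lt_one.trans_le hS'))]
    have : |S - S'| / (S * S') * ‖N'‖ ≤ |S - S'| / (S * S') * (S' * A) := by gcongr
    refine this.trans ?_
    have e : |S - S'| / (S * S') * (S' * A) = S⁻¹ * (|S - S'| * A) := by
      have : S ≠ 0 := by linarith
      have : S' ≠ 0 := by linarith
      field_simp
    rw [e]
    refine (mul_le_of_le_one_left (by positivity) hi).trans ?_
    gcongr
    exact hSS.trans hd
  refine (norm_add_le _ _).trans ?_
  linarith

lemma chi_nonneg (y : T) : 0 ≤ g.chi j y :=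
  le_min (div_nonneg (g.d_nonneg _ _) (g.δ_pos j).le) zero_le_one

lemma chi_le (y : T) : g.chi j y ≤ 1 := min_le_right _ _

lemma chi_o : g.chi j g.o = 0 := by rw [chi, g.d_self, zero_div, min_eq_left zero_le_one]

lemma chi_far (h : g.δ j ≤ g.d y g.o) : g.chi j y = 1 :=
  min_eq_right ((one_le_div (g.δ_pos j)).2 h)

lemma abs_chi_sub_le (y y' : T) : |g.chi j y - g.chi j y'| ≤ g.d y y' / g.δ j := by
  refine (abs_min_sub_min_le_max _ _ _ _).trans (max_le ?_ ?_)
  · rw [← sub_div, abs_div, abs_of_pos (g.δ_pos j)]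
    exact div_le_div_of_nonneg_right (g.abs_d_sub_le y y' _) (g.δ_pos j).le
  · rw [sub_self, abs_zero]; exact div_nonneg (g.d_nonneg _ _) (g.δ_pos j).le

lemma norm_pre_sub_le (hv : g.Osc j A v) (y : T) : ‖g.pre j v y - v y‖ ≤ A := by
  have hδ := g.δ_pos j
  have h1 : ‖g.smth j v y - v y‖ ≤ A :=
    g.norm_smth_sub_le fun κ hκ => hv.1 _ _ (by rw [g.d_comm]; linarith)
  by_cases h : g.δ j ≤ g.d y g.o
  · rwa [pre, g.chi_far h, one_smul]
  · have h2 := hv.2 y (by linarith)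
    have h3 := g.chi_nonneg (j := j) y
    have h4 := g.chi_le (j := j) y
    rw [pre, show g.chi j y • g.smth j v y - v y =
      g.chi j y • (g.smth j v y - v y) - (1 - g.chi j y) • v y by
        rw [smul_sub, sub_smul, one_smul]; abel]
    refine (norm_sub_le _ _).trans ?_
    rw [norm_smul, norm_smul, Real.norm_of_nonneg h3, Real.norm_of_nonneg (by linarith)]
    nlinarith

lemma norm_pre_sub_pre_le (hv : g.Osc j A v) (h : g.d y y' ≤ g.δ j) :
    ‖g.pre j v y - g.pre j v y'‖ ≤ (2 * g.P + 2) * (g.d y y' / g.δ j) * A := by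
  have hδ := g.δ_pos j
  have hA := hv.nonneg
  have h1 := g.norm_smth_sub_smth_le hv h
  have h2 : ‖(g.chi j y - g.chi j y') • g.smth j v y'‖ ≤ 2 * (g.d y y' / g.δ j) * A := by
    rw [norm_smul, Real.norm_eq_abs]
    by_cases hf : g.δ j ≤ g.d y g.o ∧ g.δ j ≤ g.d y' g.o
    · rw [g.chi_far hf.1, g.chi_far hf.2, sub_self, abs_zero, zero_mul]
      have := g.d_nonneg y y'
      positivity
    · have h3 : g.d y' g.o ≤ 2 * g.δ j := by
        by_contra hlt
        have := g.d_tri y' y g.o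
        rw [g.d_comm y' y] at this
        exact hf ⟨by linarith, by linarith⟩
      have h4 : ‖g.smth j v y' - v y'‖ ≤ A :=
        g.norm_smth_sub_le fun κ hκ => hv.1 _ _ (by rw [g.d_comm]; linarith)
      have h5 := hv.2 y' (by linarith)
      have h6 : ‖g.smth j v y'‖ ≤ 2 * A := by
        have := norm_le_norm_sub_add (g.smth j v y') (v y')
        linarith
      have := mul_le_mul (g.abs_chi_sub_le (j := j) y y') h6 (norm_nonneg _)
        (div_nonneg (g.d_nonneg _ _) hδ.le)
      linarith
  have h3 : ‖g.chi j y • (g.smth j v y - g.smth j v y')‖ ≤ 2 * g.P * (g.d y y' / g.δ j) * A := by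
    rw [norm_smul, Real.norm_of_nonneg (g.chi_nonneg y)]
    exact (mul_le_of_le_one_left (norm_nonneg _) (g.chi_le y)).trans h1
  rw [pre, pre, show g.chi j y • g.smth j v y - g.chi j y' • g.smth j v y' =
    g.chi j y • (g.smth j v y - g.smth j v y') + (g.chi j y - g.chi j y') • g.smth j v y' by
      rw [smul_sub, sub_smul]; abel]
  refine (norm_add_le _ _).trans ?_
  linarith

lemma nice_hat (κ : T) : Nice (g.hat j κ) :=
  ⟨((measurable_const.sub ((g.d_meas κ).div_const _)).max measurable_const).stronglyMeasurable, 2,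
    fun y => by rw [Real.norm_of_nonneg (g.hat_nonneg _ _)]; exact g.hat_le _ _⟩

lemma nice_chi : Nice (g.chi j) :=
  ⟨(((g.d_meas g.o).div_const _).min measurable_const).stronglyMeasurable, 1,
    fun y => by rw [Real.norm_of_nonneg (g.chi_nonneg _)]; exact g.chi_le _⟩

lemma nice_smth (v : T → F) : Nice (g.smth j v) := by
  have h0 := Nice.sum (g.C j) (f := g.hat j) fun κ _ => g.nice_hat κ
  have h1 : Nice fun y => (∑ κ ∈ g.C j, g.hat j κ y)⁻¹ :=
    ⟨h0.1.inv₀, 1, fun y => by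
      have := g.one_le_sum_hat j y
      rw [norm_inv, Real.norm_of_nonneg (by linarith)]
      exact inv_le_one_of_one_le₀ this⟩
  exact h1.smul (Nice.sum _ fun κ _ => (g.nice_hat κ).smul ⟨stronglyMeasurable_const, ‖v κ‖, fun _ => le_rfl⟩)

lemma nice_pre (v : T → F) : Nice (g.pre j v) := g.nice_chi.smul (g.nice_smth v)

lemma bet_nonneg (y : T) : 0 ≤ g.bet j y := le_max_right _ _

lemma cδ_pos (j : ℕ) : 0 < g.c * g.δ j := mul_pos g.c_pos (g.δ_pos j)

lemma bet_le (y : T) : g.bet j y ≤ 1 :=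
  max_le (by have := div_nonneg (g.d_nonneg y (g.cen j y)) (g.cδ_pos j).le; linarith) zero_le_one

lemma nice_bet : Nice (g.bet j) := by
  refine g.nice_of_cells (G := fun κ y => max (1 - g.d y κ / (g.c * g.δ j)) 0) fun κ _ => ?_
  refine ⟨((measurable_const.sub ((g.d_meas κ).div_const _)).max measurable_const).stronglyMeasurable,
    1, fun y => ?_⟩
  rw [Real.norm_of_nonneg (le_max_right _ _)]
  exact max_le (by have := div_nonneg (g.d_nonneg y κ) (g.cδ_pos j).le; linarith) zero_le_one

lemma le_avg_bet (j : ℕ) (y : T) : (2 * g.H)⁻¹ ≤ g.avg j (g.bet j) y := by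
  have hc := g.cell_pos j y
  have hH := g.H_pos
  have hcd := g.cδ_pos j
  have hb : g.c * g.δ j / 2 < g.c * g.δ j := by linarith
  set b : Set T := {z | g.d z (g.cen j y) ≤ g.c * g.δ j / 2} with hbdef
  have hbm : MeasurableSet b := measurableSet_le (g.d_meas _) measurable_const
  have hsub : b ⊆ g.cell j y := fun z hz => g.core j z y (lt_of_le_of_lt hz hb)
  have h1 : ∫ z in g.cell j y, b.indicator (fun _ => (1 / 2 : ℝ)) z ∂μ = μ.real b * (1 / 2) := by
    rw [integral_indicator hbm, Measure.restrict_restrict hbm, Set.inter_eq_left.2 hsub,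
      setIntegral_const, smul_eq_mul]
  have h2 : ∫ z in g.cell j y, b.indicator (fun _ => (1 / 2 : ℝ)) z ∂μ ≤
      ∫ z in g.cell j y, g.bet j z ∂μ := by
    refine setIntegral_mono_on ((integrable_const _).indicator hbm).integrableOn
      (g.nice_bet.integrable μ).integrableOn (g.measurableSet_cell j y) fun z hz => ?_
    by_cases hzb : z ∈ b
    · rw [Set.indicator_of_mem hzb]
      refine le_max_of_le_left ?_
      have : g.d z (g.cen j z) / (g.c * g.δ j) ≤ 1 / 2 := by
        rw [div_le_iff₀ hcd, show g.cen j z = g.cen j y from hz]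
        have : g.d z (g.cen j y) ≤ g.c * g.δ j / 2 := hzb
        linarith
      linarith
    · rw [Set.indicator_of_notMem hzb]; exact g.bet_nonneg z
  have h3 : μ.real (g.cell j y) ≤ g.H * μ.real b := g.bump j y
  rw [h1] at h2
  have h4 : g.H⁻¹ * μ.real (g.cell j y) ≤ μ.real b := (inv_mul_le_iff₀ hH).2 h3
  have h5 : (2 * g.H)⁻¹ * μ.real (g.cell j y) ≤ ∫ z in g.cell j y, g.bet j z ∂μ := by
    rw [mul_inv, mul_assoc]; linarith
  rw [avg, smul_eq_mul]
  refine le_trans (le_of_eq ?_) (mul_le_mul_of_nonneg_left h5 (inv_nonneg.2 hc.le))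
  field_simp

lemma avg_bet_pos (j : ℕ) (y : T) : 0 < g.avg j (g.bet j) y :=
  lt_of_lt_of_le (inv_pos.2 (mul_pos two_pos g.H_pos)) (g.le_avg_bet j y)

lemma inv_avg_bet_le (j : ℕ) (y : T) : (g.avg j (g.bet j) y)⁻¹ ≤ 2 * g.H :=
  inv_le_of_inv_le₀ (mul_pos two_pos g.H_pos) (g.le_avg_bet j y)

lemma bmp_nonneg (y : T) : 0 ≤ g.bmp j y :=
  mul_nonneg (inv_nonneg.2 (g.avg_bet_pos j y).le) (g.bet_nonneg y)

lemma bmp_le_bet (y : T) : g.bmp j y ≤ 2 * g.H * g.bet j y :=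
  mul_le_mul_of_nonneg_right (g.inv_avg_bet_le j y) (g.bet_nonneg y)

lemma bmp_le (y : T) : g.bmp j y ≤ 2 * g.H :=
  (g.bmp_le_bet y).trans (mul_le_of_le_one_right (by have := g.H_pos; linarith) (g.bet_le y))

lemma nice_bmp : Nice (g.bmp j) :=
  Nice.smul (F := ℝ) (r := fun y => (g.avg j (g.bet j) y)⁻¹)
    (Lev.nice (g := g) (j := j) fun y y' h => by
      simp only [g.lev_avg j (g.bet j) y y' h]) g.nice_bet

lemma avg_bmp (y : T) : g.avg j (g.bmp j) y = 1 := by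
  have h1 : g.Lev j fun y => (g.avg j (g.bet j) y)⁻¹ := fun y y' h => by
    simp only [g.lev_avg j (g.bet j) y y' h]
  have h2 := g.avg_smul_lev h1 (g.bet j) y
  have e : g.bmp j = fun y => g.bet j y • (g.avg j (g.bet j) y)⁻¹ := funext fun y => mul_comm _ _
  rw [e, h2, smul_eq_mul, mul_inv_cancel₀ (g.avg_bet_pos j y).ne']

lemma nice_reg (hv : g.Lev j v) : Nice (g.reg j v) :=
  (g.nice_pre v).add (g.nice_bmp.smul (hv.nice.sub (g.lev_avg j _).nice))

lemma avg_reg (hv : g.Lev j v) : g.avg j (g.reg j v) = v := by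
  funext y
  have hl : g.Lev j fun y => v y - g.avg j (g.pre j v) y := fun y y' h => by
    simp only [hv y y' h, g.lev_avg j _ y y' h]
  have h := g.avg_add (j := j) (g.nice_pre (j := j) v) ((g.nice_bmp (j := j)).smul hl.nice) y
  refine h.trans ?_
  rw [g.avg_smul_lev hl, avg_bmp, one_smul]
  exact add_sub_cancel _ _

lemma bet_o : g.bet j g.o = 0 := by
  refine max_eq_right ?_
  rw [sub_nonpos, one_le_div (g.cδ_pos j)]
  exact g.core_o j _

lemma reg_o (v : T → F) : g.reg j v g.o = 0 := by
  rw [reg, pre, chi_o, bmp, bet_o, mul_zero, zero_smul, zero_smul, add_zero]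

lemma norm_sub_avg_pre_le (hv : g.Osc j A v) (hl : g.Lev j v) (y : T) :
    ‖v y - g.avg j (g.pre j v) y‖ ≤ A := by
  rw [norm_sub_rev]
  refine g.norm_avg_sub_le (g.nice_pre v) fun z hz => ?_
  rw [← hl z y hz]
  exact g.norm_pre_sub_le hv z

lemma norm_reg_sub_le (hv : g.Osc j A v) (hl : g.Lev j v) (y : T) :
    ‖g.reg j v y - v y‖ ≤ g.L * A := by
  have hA := hv.nonneg
  have hH := g.H_pos
  have h1 : ‖g.bmp j y • (v y - g.avg j (g.pre j v) y)‖ ≤ 2 * g.H * A := by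
    rw [norm_smul, Real.norm_of_nonneg (g.bmp_nonneg y)]
    exact mul_le_mul (g.bmp_le y) (g.norm_sub_avg_pre_le hv hl y) (norm_nonneg _) (by linarith)
  have h2 : g.H ≤ g.H / g.c := (le_div_iff₀ g.c_pos).2 (mul_le_of_le_one_right hH.le g.c_le)
  have h3 := g.P_nonneg
  rw [reg, add_sub_right_comm]
  refine (norm_add_le _ _).trans ((add_le_add (g.norm_pre_sub_le hv y) h1).trans ?_)
  unfold L
  rw [mul_div_assoc]
  nlinarith

lemma bet_le_of_ne (h : g.cen j y ≠ g.cen j y') : g.bet j y ≤ g.d y y' / (g.c * g.δ j) := by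
  have hcd := g.cδ_pos j
  refine max_le ?_ (div_nonneg (g.d_nonneg _ _) hcd.le)
  rw [sub_le_iff_le_add, ← add_div, one_le_div hcd]
  have h1 : g.c * g.δ j ≤ g.d y' (g.cen j y) := not_lt.1 fun hlt => h (g.core j y' y hlt).symm
  have h2 := g.d_tri y' y (g.cen j y)
  rw [g.d_comm y' y] at h2
  linarith

lemma norm_reg_sub_reg_le (hv : g.Osc j A v) (hl : g.Lev j v) (h : g.d y y' ≤ g.δ j) :
    ‖g.reg j v y - g.reg j v y'‖ ≤ g.L * (g.d y y' / g.δ j) * A := by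
  have hA := hv.nonneg
  have hH := g.H_pos
  have hcd := g.cδ_pos j
  have hd := g.d_nonneg y y'
  have h1 := g.norm_pre_sub_pre_le hv h
  have key : ∀ y, ‖g.bmp j y • (v y - g.avg j (g.pre j v) y)‖ ≤ 2 * g.H * g.bet j y * A := fun y => by
    rw [norm_smul, Real.norm_of_nonneg (g.bmp_nonneg y)]
    exact mul_le_mul (g.bmp_le_bet y) (g.norm_sub_avg_pre_le hv hl y) (norm_nonneg _)
      (by have := g.bet_nonneg (j := j) y; positivity)
  have e : 4 * g.H / g.c * (g.d y y' / g.δ j) * A = 4 * g.H * (g.d y y' / (g.c * g.δ j)) * A := by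
    have := g.c_pos.ne'
    have := (g.δ_pos j).ne'
    field_simp
  have h2 : ‖g.bmp j y • (v y - g.avg j (g.pre j v) y) -
      g.bmp j y' • (v y' - g.avg j (g.pre j v) y')‖ ≤ 4 * g.H / g.c * (g.d y y' / g.δ j) * A := by
    rw [e]
    by_cases hc : g.cen j y = g.cen j y'
    · rw [← hl y y' hc, ← g.lev_avg j (g.pre j v) y y' hc, ← sub_smul, norm_smul, Real.norm_eq_abs]
      have h3 : |g.bmp j y - g.bmp j y'| ≤ 4 * g.H * (g.d y y' / (g.c * g.δ j)) := by
        rw [bmp, bmp, ← g.lev_avg j (g.bet j) y y' hc, ← mul_sub, abs_mul,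
          abs_of_pos (inv_pos.2 (g.avg_bet_pos j y))]
        refine mul_le_mul ((g.inv_avg_bet_le j y).trans (by linarith)) ?_ (abs_nonneg _) (by linarith)
        refine (abs_max_sub_max_le_abs _ _ _).trans ?_
        rw [sub_sub_sub_cancel_left, ← hc, ← sub_div, abs_div, abs_of_pos hcd, abs_sub_comm]
        exact div_le_div_of_nonneg_right (g.abs_d_sub_le y y' _) hcd.le
      exact mul_le_mul h3 (g.norm_sub_avg_pre_le hv hl y) (norm_nonneg _) (by positivity)
    · refine (norm_sub_le _ _).trans ((add_le_add (key y) (key y')).trans ?_)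
      have b1 := g.bet_le_of_ne hc
      have b2 := g.bet_le_of_ne (Ne.symm hc)
      rw [g.d_comm y' y] at b2
      rw [← add_mul, ← mul_add]
      refine mul_le_mul_of_nonneg_right ?_ hA
      nlinarith
  rw [reg, reg, add_sub_add_comm]
  refine (norm_add_le _ _).trans ((add_le_add h1 h2).trans (le_of_eq ?_))
  unfold L; ring

end Grid

namespace Grid
variable {T : Type*} [MeasurableSpace T] {μ : Measure T} [IsProbabilityMeasure μ] (g : Grid T μ)
variable {F : Type*} [NormedRing F] [NormedAlgebra ℝ F] [CompleteSpace F] {v w ψ : T → F} {j : ℕ}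
variable {A S : ℝ} {y y' : T}

/-- Transfer of a level function to the next level. -/
def step (j : ℕ) (v : T → F) : T → F := g.avg (j + 1) (g.reg j v)

/-- Iterated transfer. -/
def it : ℕ → ℕ → (T → F) → T → F
  | 0, _, v => v
  | k + 1, j, v => it k (j + 1) (g.step j v)

/-- Hölder continuous extension of a level function. -/
def V (j : ℕ) (v : T → F) (y : T) : F :=
  Classical.epsilon fun l => Filter.Tendsto (fun k => g.it k j v y) Filter.atTop (nhds l)

lemma lev_step (j : ℕ) (v : T → F) : g.Lev (j + 1) (g.step j v) := g.lev_avg _ _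

lemma δ_succ (j : ℕ) : g.δ (j + 1) = g.θ ^ 2 * g.δ j := by
  unfold δ; ring

lemma six_δ_succ_le (j : ℕ) : 6 * g.δ (j + 1) ≤ g.δ j := by
  rw [δ_succ]
  have h1 := g.θ_le
  have h2 := g.θ_pos
  have h3 := g.δ_pos j
  have : 6 * g.θ ^ 2 ≤ 1 := by nlinarith
  nlinarith

lemma osc_step (hv : g.Osc j A v) (hl : g.Lev j v) : g.Osc (j + 1) (g.θ * A) (g.step j v) := by
  have hA := hv.nonneg
  have hδ := g.δ_pos j
  have hδ' := g.δ_pos (j + 1)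
  have h6 := g.six_δ_succ_le j
  have hL := g.L_pos
  have hθ := g.θ_pos
  have key : ∀ z z', g.d z z' ≤ 6 * g.δ (j + 1) → ‖g.reg j v z - g.reg j v z'‖ ≤ g.θ * A := by
    intro z z' h
    refine (g.norm_reg_sub_reg_le hv hl (h.trans h6)).trans (mul_le_mul_of_nonneg_right ?_ hA)
    have h1 : g.d z z' / g.δ j ≤ 6 * g.θ ^ 2 := by
      rw [div_le_iff₀ hδ]; rw [δ_succ] at h; linarith
    calc g.L * (g.d z z' / g.δ j) ≤ g.L * (6 * g.θ ^ 2) := by gcongr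
      _ = (6 * g.L * g.θ) * g.θ := by ring
      _ ≤ g.θ := mul_le_of_le_one_left hθ.le g.L_θ
  have hd : ∀ z y, g.cen (j + 1) z = g.cen (j + 1) y → g.d z y ≤ g.δ (j + 1) := fun z y h =>
    g.diam _ _ _ h
  refine ⟨fun y y' h => g.norm_avg_sub_avg_le (g.nice_reg hl) fun z z' hz hz' => key z z' ?_,
    fun y h => g.norm_avg_le (g.nice_reg hl) fun z hz => ?_⟩
  · have h1 := hd z y hz
    have h2 := hd z' y' hz'
    have h3 := g.d_tri z y z'
    have h4 := g.d_tri y y' z'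
    rw [g.d_comm y' z'] at h4
    linarith
  · have h1 := hd z y hz
    have h2 := g.d_tri z y g.o
    have h3 := key z g.o (by linarith)
    rwa [g.reg_o, sub_zero] at h3

lemma norm_step_sub_le (hv : g.Osc j A v) (hl : g.Lev j v) (y : T) :
    ‖g.step j v y - v y‖ ≤ g.L * A :=
  g.norm_avg_sub_le (g.nice_reg hl) fun z hz => by
    rw [← hl z y (g.nest j _ _ hz)]; exact g.norm_reg_sub_le hv hl z

lemma avg_step (hl : g.Lev j v) : g.avg j (g.step j v) = v := by
  rw [step, g.avg_avg_succ (g.nice_reg hl), g.avg_reg hl]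

lemma lev_it (hl : g.Lev j v) (k : ℕ) : g.Lev (j + k) (g.it k j v) := by
  induction k generalizing j v with
  | zero => exact hl
  | succ k ih =>
    have := ih (g.lev_step j v)
    rwa [Nat.add_right_comm] at this

lemma osc_it (hv : g.Osc j A v) (hl : g.Lev j v) (k : ℕ) :
    g.Osc (j + k) (A * g.θ ^ k) (g.it k j v) := by
  induction k generalizing j v A with
  | zero => rw [pow_zero, mul_one]; exact hv
  | succ k ih =>
    have := ih (g.osc_step hv hl) (g.lev_step j v)
    rw [Nat.add_right_comm, mul_comm g.θ A, mul_assoc, ← pow_succ'] at this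
    exact this

lemma norm_it_succ_sub_le (hv : g.Osc j A v) (hl : g.Lev j v) (y : T) (k : ℕ) :
    ‖g.it (k + 1) j v y - g.it k j v y‖ ≤ g.L * A * g.θ ^ k := by
  induction k generalizing j v A with
  | zero => rw [pow_zero, mul_one]; exact g.norm_step_sub_le hv hl y
  | succ k ih =>
    refine (ih (g.osc_step hv hl) (g.lev_step j v)).trans (le_of_eq ?_)
    ring

lemma avg_it (hl : g.Lev j v) (k : ℕ) : g.avg j (g.it k j v) = v := by
  induction k generalizing j v with
  | zero => exact g.avg_lev hl
  | succ k ih =>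
    rw [it, ← g.avg_avg_succ (g.lev_it (g.lev_step j v) k).nice, ih (g.lev_step j v), g.avg_step hl]

lemma osc_of_le (hS : ∀ y, ‖v y‖ ≤ S) : g.Osc j (2 * S) v :=
  ⟨fun y y' _ => (norm_sub_le _ _).trans (by linarith [hS y, hS y']),
    fun y _ => by linarith [hS y, norm_nonneg (v y)]⟩

lemma tendsto_it (hl : g.Lev j v) (y : T) :
    Filter.Tendsto (fun k => g.it k j v y) Filter.atTop (nhds (g.V j v y)) := by
  obtain ⟨S, hS⟩ := hl.nice.2
  have hv := g.osc_of_le (j := j) hS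
  have : CauchySeq fun k => g.it k j v y :=
    cauchySeq_of_le_geometric g.θ (g.L * (2 * S)) (by linarith [g.θ_le]) fun k => by
      rw [dist_comm, dist_eq_norm]; exact g.norm_it_succ_sub_le hv hl y k
  exact Classical.epsilon_spec (cauchySeq_tendsto_of_complete this)

lemma norm_V_sub_it_le (hv : g.Osc j A v) (hl : g.Lev j v) (y : T) (k : ℕ) :
    ‖g.V j v y - g.it k j v y‖ ≤ 2 * g.L * A * g.θ ^ k := by
  have h := dist_le_of_le_geometric_of_tendsto (f := fun k => g.it k j v y) g.θ (g.L * A)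
    (by linarith [g.θ_le]) (fun k => by
      rw [dist_comm, dist_eq_norm]; exact g.norm_it_succ_sub_le hv hl y k) (g.tendsto_it hl y) k
  rw [dist_comm, dist_eq_norm] at h
  refine h.trans ?_
  have h1 := g.θ_le
  have : 0 ≤ g.L * A * g.θ ^ k := by
    have := hv.nonneg; have := g.L_pos; have := g.θ_pos; positivity
  rw [div_le_iff₀ (by linarith)]
  nlinarith

lemma norm_V_sub_le (hv : g.Osc j A v) (hl : g.Lev j v) (y : T) :
    ‖g.V j v y - v y‖ ≤ 2 * g.L * A := by
  simpa using! g.norm_V_sub_it_le hv hl y 0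

lemma norm_V_le (hS : ∀ y, ‖v y‖ ≤ S) (hl : g.Lev j v) (y : T) :
    ‖g.V j v y‖ ≤ (4 * g.L + 1) * S := by
  have h1 := g.norm_V_sub_le (g.osc_of_le hS) hl y
  have h2 := norm_le_norm_sub_add (g.V j v y) (v y)
  linarith [hS y]

lemma nice_V (hl : g.Lev j v) : Nice (g.V j v) := by
  obtain ⟨S, hS⟩ := hl.nice.2
  exact Nice.of_tendsto (fun k => (g.lev_it hl k).nice.1) (g.norm_V_le hS hl) (g.tendsto_it hl)

lemma tendsto_pow_θ (a : ℝ) : Filter.Tendsto (fun k => a * g.θ ^ k) Filter.atTop (nhds 0) := by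
  have := (tendsto_pow_atTop_nhds_zero_of_lt_one g.θ_pos.le
    (show g.θ < 1 by linarith [g.θ_le])).const_mul a
  rwa [mul_zero] at this

lemma avg_V (hl : g.Lev j v) : g.avg j (g.V j v) = v := by
  funext y
  obtain ⟨S, hS⟩ := hl.nice.2
  have key : ∀ k, ‖g.avg j (g.V j v) y - v y‖ ≤ 2 * g.L * (2 * S) * g.θ ^ k := fun k => by
    have h1 := g.avg_sub (j := j) (g.nice_V hl) (g.lev_it hl k).nice y
    rw [g.avg_it hl] at h1
    rw [← h1]
    exact g.norm_avg_le ((g.nice_V hl).sub (g.lev_it hl k).nice) fun z _ =>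
      g.norm_V_sub_it_le (g.osc_of_le hS) hl z k
  exact sub_eq_zero.1 (norm_le_zero_iff.1 (ge_of_tendsto' (g.tendsto_pow_θ _) key))

lemma V_step (hl : g.Lev j v) : g.V (j + 1) (g.step j v) = g.V j v := funext fun y =>
  tendsto_nhds_unique (g.tendsto_it (g.lev_step j v) y)
    ((g.tendsto_it hl y).comp (Filter.tendsto_add_atTop_nat 1))

lemma V_o (hl : g.Lev j v) : g.V j v g.o = 0 := by
  obtain ⟨S, hS⟩ := hl.nice.2
  have h0 : Filter.Tendsto (fun k => g.it k j v g.o) Filter.atTop (nhds 0) := by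
    refine squeeze_zero_norm (fun k => ?_) (g.tendsto_pow_θ (2 * S))
    refine (g.osc_it (g.osc_of_le hS) hl k).2 _ ?_
    rw [g.d_self]; linarith [g.δ_pos (j + k)]
  exact tendsto_nhds_unique (g.tendsto_it hl _) h0

lemma norm_V_sub_V_le_pow (hv : g.Osc j A v) (hl : g.Lev j v) {k : ℕ} (h : g.d y y' ≤ g.δ (j + k)) :
    ‖g.V j v y - g.V j v y'‖ ≤ (4 * g.L + 1) * A * g.θ ^ k := by
  have h1 := g.norm_V_sub_it_le hv hl y k
  have h2 := g.norm_V_sub_it_le hv hl y' k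
  have h3 := (g.osc_it hv hl k).1 y y' (by linarith [g.δ_pos (j + k)])
  have e : g.V j v y - g.V j v y' = (g.V j v y - g.it k j v y) - (g.V j v y' - g.it k j v y') +
    (g.it k j v y - g.it k j v y') := by abel
  rw [e]
  refine (norm_add_le _ _).trans ((add_le_add (norm_sub_le _ _) h3).trans ?_)
  linarith

lemma sqrt_δ (j : ℕ) : √(g.δ j) = g.θ ^ j := by
  rw [δ, mul_comm, pow_mul, Real.sqrt_sq (pow_pos g.θ_pos _).le]

lemma norm_V_sub_V_le_sqrt (hv : g.Osc j A v) (hl : g.Lev j v) (h : g.d y y' ≤ g.δ j) :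
    ‖g.V j v y - g.V j v y'‖ ≤ (4 * g.L + 1) * g.θ⁻¹ * A * (g.θ ^ j)⁻¹ * √(g.d y y') := by
  have hA := hv.nonneg
  have hθ := g.θ_pos
  have hL := g.L_pos
  rcases (g.d_nonneg y y').eq_or_lt with h0 | h0
  · rw [← h0, Real.sqrt_zero, mul_zero]
    refine ge_of_tendsto' (g.tendsto_pow_θ ((4 * g.L + 1) * A)) fun k =>
      g.norm_V_sub_V_le_pow hv hl ?_
    rw [← h0]; exact (g.δ_pos _).le
  · have hj : 0 < g.θ ^ j := pow_pos hθ j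
    obtain ⟨k, hk1, hk2⟩ := exists_nat_pow_near_of_lt_one (x := √(g.d y y') / g.θ ^ j)
      (div_pos (Real.sqrt_pos.2 h0) hj)
      ((div_le_one hj).2 (by rw [← sqrt_δ]; exact Real.sqrt_le_sqrt h)) hθ
      (by linarith [g.θ_le])
    rw [lt_div_iff₀ hj] at hk1
    rw [div_le_iff₀ hj, ← pow_add, add_comm, ← sqrt_δ, Real.sqrt_le_sqrt_iff (g.δ_pos _).le] at hk2
    refine (g.norm_V_sub_V_le_pow hv hl hk2).trans ?_
    have e : (4 * g.L + 1) * A * g.θ ^ k =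
        (4 * g.L + 1) * g.θ⁻¹ * A * (g.θ ^ j)⁻¹ * (g.θ ^ (k + 1) * g.θ ^ j) := by
      rw [pow_succ]
      field_simp
    rw [e]
    gcongr

lemma norm_V_sub_V_le (hS : ∀ y, ‖v y‖ ≤ S) (hl : g.Lev j v) (y y' : T) :
    ‖g.V j v y - g.V j v y'‖ ≤ 2 * (4 * g.L + 1) * g.θ⁻¹ * S * (g.θ ^ j)⁻¹ * √(g.d y y') := by
  have hS0 : 0 ≤ S := (norm_nonneg _).trans (hS y)
  have hθ := g.θ_pos
  have hL := g.L_pos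
  by_cases h : g.d y y' ≤ g.δ j
  · exact (g.norm_V_sub_V_le_sqrt (g.osc_of_le hS) hl h).trans (le_of_eq (by ring))
  · refine (norm_sub_le _ _).trans
      ((add_le_add (g.norm_V_le hS hl y) (g.norm_V_le hS hl y')).trans ?_)
    have h1 : 1 ≤ g.θ⁻¹ := (one_le_inv₀ hθ).2 (by linarith [g.θ_le])
    have h2 : 1 ≤ (g.θ ^ j)⁻¹ * √(g.d y y') := by
      rw [le_inv_mul_iff₀ (pow_pos hθ j), mul_one, ← sqrt_δ]
      exact Real.sqrt_le_sqrt (by linarith)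
    calc _ = 2 * (4 * g.L + 1) * 1 * S * 1 := by ring
      _ ≤ 2 * (4 * g.L + 1) * g.θ⁻¹ * S * ((g.θ ^ j)⁻¹ * √(g.d y y')) := by gcongr
      _ = _ := by ring

section Lipschitz
variable {L₀ : ℝ}

lemma osc_avg (hψ : Nice ψ) (hL₀ : ∀ y y', ‖ψ y - ψ y'‖ ≤ L₀ * g.d y y') (h0 : 0 ≤ L₀)
    (ho : ψ g.o = 0) (j : ℕ) :
    g.Osc j (6 * L₀ * g.δ j) (g.avg j ψ) := by
  have hδ := g.δ_pos j
  have hd : ∀ z y, g.cen j z = g.cen j y → g.d z y ≤ g.δ j := fun z y h => g.diam _ _ _ h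
  refine ⟨fun y y' h => g.norm_avg_sub_avg_le hψ fun z z' hz hz' => (hL₀ z z').trans ?_,
    fun y h => g.norm_avg_le hψ fun z hz => ?_⟩
  · have h1 := hd z y hz
    have h2 := hd z' y' hz'
    have h3 := g.d_tri z y z'
    have h4 := g.d_tri y y' z'
    rw [g.d_comm y' z'] at h4
    rw [mul_comm 6, mul_assoc]
    exact mul_le_mul_of_nonneg_left (by linarith) h0
  · have h1 := hd z y hz
    have h2 := g.d_tri z y g.o
    have h3 := hL₀ z g.o
    rw [ho, sub_zero] at h3
    refine h3.trans ?_
    rw [mul_comm 6, mul_assoc]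
    exact mul_le_mul_of_nonneg_left (by linarith) h0

lemma norm_V_avg_sub_le (hψ : Nice ψ) (hL₀ : ∀ y y', ‖ψ y - ψ y'‖ ≤ L₀ * g.d y y') (h0 : 0 ≤ L₀)
    (ho : ψ g.o = 0) (j : ℕ) (y : T) :
    ‖g.V j (g.avg j ψ) y - ψ y‖ ≤ (12 * g.L + 1) * L₀ * g.δ j := by
  have h1 := g.norm_V_sub_le (g.osc_avg hψ hL₀ h0 ho j) (g.lev_avg j ψ) y
  have h2 : ‖g.avg j ψ y - ψ y‖ ≤ L₀ * g.δ j := g.norm_avg_sub_le hψ fun z hz =>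
    (hL₀ z y).trans (mul_le_mul_of_nonneg_left (g.diam _ _ _ hz) h0)
  have h3 := norm_sub_le_norm_sub_add_norm_sub (g.V j (g.avg j ψ) y) (g.avg j ψ y) (ψ y)
  linarith

lemma exists_holder_V_avg (hψ : Nice ψ) (hL₀ : ∀ y y', ‖ψ y - ψ y'‖ ≤ L₀ * g.d y y') (h0 : 0 ≤ L₀)
    (ho : ψ g.o = 0) :
    ∃ K, 0 ≤ K ∧ ∀ j y y',
    ‖g.V j (g.avg j ψ) y - g.V j (g.avg j ψ) y'‖ ≤ K * √(g.d y y') := by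
  have hθ := g.θ_pos
  have hL := g.L_pos
  refine ⟨6 * (4 * g.L + 1) * g.θ⁻¹ * L₀ + (24 * g.L + 3) * L₀, by positivity, fun j y y' => ?_⟩
  have hs := Real.sqrt_nonneg (g.d y y')
  have hd := g.d_nonneg y y'
  have hds : g.d y y' ≤ √(g.d y y') := by
    refine Real.le_sqrt_of_sq_le ?_
    have := g.d_le_one y y'
    nlinarith
  rw [add_mul]
  by_cases h : g.d y y' ≤ g.δ j
  · refine (g.norm_V_sub_V_le_sqrt (g.osc_avg hψ hL₀ h0 ho j) (g.lev_avg j ψ) h).trans ?_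
    refine le_add_of_le_of_nonneg (mul_le_mul_of_nonneg_right ?_ hs) (by positivity)
    have h1 : g.θ ^ j ≤ 1 := pow_le_one₀ hθ.le (by linarith [g.θ_le])
    have e : (4 * g.L + 1) * g.θ⁻¹ * (6 * L₀ * g.δ j) * (g.θ ^ j)⁻¹ =
        6 * (4 * g.L + 1) * g.θ⁻¹ * L₀ * g.θ ^ j := by
      rw [δ, two_mul, pow_add]; field_simp
    rw [e]
    exact mul_le_of_le_one_right (by positivity) h1
  · refine le_add_of_nonneg_of_le (by positivity) ?_
    have h1 := g.norm_V_avg_sub_le hψ hL₀ h0 ho j y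
    have h2 := g.norm_V_avg_sub_le hψ hL₀ h0 ho j y'
    have h3 := hL₀ y y'
    have e : g.V j (g.avg j ψ) y - g.V j (g.avg j ψ) y' = (g.V j (g.avg j ψ) y - ψ y) -
      (g.V j (g.avg j ψ) y' - ψ y') + (ψ y - ψ y') := by abel
    have h4 : ‖g.V j (g.avg j ψ) y - g.V j (g.avg j ψ) y'‖ ≤
        (12 * g.L + 1) * L₀ * g.δ j + (12 * g.L + 1) * L₀ * g.δ j + L₀ * g.d y y' := by
      rw [e]
      exact (norm_add_le _ _).trans (add_le_add ((norm_sub_le _ _).trans (add_le_add h1 h2)) h3)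
    refine h4.trans ?_
    have h5 : g.δ j ≤ √(g.d y y') := by linarith
    calc _ = (24 * g.L + 2) * L₀ * g.δ j + L₀ * g.d y y' := by ring
      _ ≤ (24 * g.L + 2) * L₀ * √(g.d y y') + L₀ * √(g.d y y') := by gcongr
      _ = _ := by ring

end Lipschitz

lemma smth_add (v w : T → F) (y : T) :
    g.smth j (fun y => v y + w y) y = g.smth j v y + g.smth j w y := by
  simp only [smth, smul_add, Finset.sum_add_distrib]

lemma smth_mul (a : F) (v : T → F) (y : T) :
    g.smth j (fun y => a * v y) y = a * g.smth j v y := by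
  simp only [smth, mul_smul_comm, Finset.mul_sum]

lemma pre_add (v w : T → F) :
    g.pre j (fun y => v y + w y) = fun y => g.pre j v y + g.pre j w y := funext fun y => by
  rw [pre, smth_add, smul_add]; rfl

lemma pre_mul (a : F) (v : T → F) :
    g.pre j (fun y => a * v y) = fun y => a * g.pre j v y := funext fun y => by
  rw [pre, smth_mul, ← mul_smul_comm]; rfl

lemma reg_add (v w : T → F) :
    g.reg j (fun y => v y + w y) = fun y => g.reg j v y + g.reg j w y := funext fun y => by
  simp only [reg]
  rw [pre_add, g.avg_add (g.nice_pre v) (g.nice_pre w), add_sub_add_comm, smul_add]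
  exact add_add_add_comm _ _ _ _

lemma reg_mul (a : F) (v : T → F) :
    g.reg j (fun y => a * v y) = fun y => a * g.reg j v y := funext fun y => by
  simp only [reg]
  rw [pre_mul, g.avg_const_mul _ (g.nice_pre v), mul_add, ← mul_sub, mul_smul_comm]

lemma step_add (hv : g.Lev j v) (hw : g.Lev j w) :
    g.step j (fun y => v y + w y) = fun y => g.step j v y + g.step j w y := funext fun y => by
  rw [step, reg_add, g.avg_add (g.nice_reg hv) (g.nice_reg hw)]; rfl

lemma step_mul (a : F) (hv : g.Lev j v) :
    g.step j (fun y => a * v y) = fun y => a * g.step j v y := funext fun y => by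
  rw [step, reg_mul, g.avg_const_mul _ (g.nice_reg hv)]; rfl

lemma it_add (hv : g.Lev j v) (hw : g.Lev j w) (k : ℕ) :
    g.it k j (fun y => v y + w y) = fun y => g.it k j v y + g.it k j w y := by
  induction k generalizing j v w with
  | zero => rfl
  | succ k ih => rw [it, g.step_add hv hw]; exact ih (g.lev_step j v) (g.lev_step j w)

lemma it_mul (a : F) (hv : g.Lev j v) (k : ℕ) :
    g.it k j (fun y => a * v y) = fun y => a * g.it k j v y := by
  induction k generalizing j v with
  | zero => rfl
  | succ k ih => rw [it, g.step_mul a hv]; exact ih (g.lev_step j v)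

lemma Lev.add {g : Grid T μ} (hv : g.Lev j v) (hw : g.Lev j w) : g.Lev j fun y => v y + w y :=
  fun y y' h => by simp only [hv y y' h, hw y y' h]

lemma Lev.mul {g : Grid T μ} (a : F) (hv : g.Lev j v) : g.Lev j fun y => a * v y :=
  fun y y' h => by simp only [hv y y' h]

lemma V_add (hv : g.Lev j v) (hw : g.Lev j w) (y : T) :
    g.V j (fun y => v y + w y) y = g.V j v y + g.V j w y := by
  refine tendsto_nhds_unique (g.tendsto_it (hv.add hw) y) ?_
  simp only [g.it_add hv hw]
  exact (g.tendsto_it hv y).add (g.tendsto_it hw y)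

lemma V_mul (a : F) (hv : g.Lev j v) (y : T) :
    g.V j (fun y => a * v y) y = a * g.V j v y := by
  refine tendsto_nhds_unique (g.tendsto_it (hv.mul a) y) ?_
  simp only [g.it_mul a hv]
  exact (g.tendsto_it hv y).const_mul a

end Grid

namespace Grid
open scoped Classical in
/-- Indices of the basis functions of a level: the centers of the cells, omitting beyond level `0`
one cell in every cell of the preceding level. -/
def I {T : Type*} [MeasurableSpace T] {μ : Measure T} (g : Grid T μ) : ℕ → Finset T
  | 0 => (g.cen_fin 0).toFinset
  | l + 1 => (g.cen_fin (l + 1)).toFinset.filter fun κ => κ ≠ g.cen (l + 1) (g.cen l κ)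

variable {T : Type*} [MeasurableSpace T] {μ : Measure T} [IsProbabilityMeasure μ] (g : Grid T μ)
variable {F : Type*} [NormedRing F] [NormedAlgebra ℝ F] [CompleteSpace F] {v w ψ : T → F} {j l : ℕ}
variable {S : ℝ} {y y' κ κ' : T} {s : Finset T}

open scoped Classical in
/-- Coefficients of the basis functions of a level with respect to indicator functions. -/
def e₀ : ℕ → T → T → ℝ
  | 0, κ, k => if k = κ then 1 else 0
  | l + 1, κ, k => (if k = κ then 1 else 0) -
    if k = g.cen (l + 1) (g.cen l κ) then
      μ.real (g.cell (l + 1) κ) / μ.real (g.cell (l + 1) (g.cen l κ)) else 0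

/-- Basis of the level functions with vanishing averages over the cells of the preceding level. -/
def e (l : ℕ) (κ y : T) : ℝ := g.e₀ l κ (g.cen l y)

/-- The new information in the averages of a given level. -/
def D : ℕ → (T → F) → T → F
  | 0, ψ => g.avg 0 ψ
  | l + 1, ψ => fun y => g.avg (l + 1) ψ y - g.step l (g.avg l ψ) y

/-- Hölder continuous basis functions. -/
def W (F : Type*) [NormedRing F] [NormedAlgebra ℝ F] (l : ℕ) (κ : T) : T → F :=
  g.V l fun y => g.e l κ y • (1 : F)

/-- Partial expansion of the new information of a level. -/
def blk (l : ℕ) (s : Finset T) (ψ : T → F) (y : T) : F := ∑ κ ∈ s, g.e l κ y • g.D l ψ κ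

/-- Level function whose extension is a partial sum of the expansion. -/
def prt : ℕ → Finset T → (T → F) → T → F
  | 0, s, ψ => g.blk 0 s ψ
  | l + 1, s, ψ => fun y => g.step l (g.avg l ψ) y + g.blk (l + 1) s ψ y

open scoped Classical in
lemma I_subset (l : ℕ) : g.I l ⊆ g.C l := by
  cases l with
  | zero => exact subset_rfl
  | succ l => exact Finset.filter_subset _ _

lemma cen_of_mem_I (h : κ ∈ g.I l) : g.cen l κ = κ := g.mem_C.1 (g.I_subset l h)

open scoped Classical in
lemma mem_I_succ : κ ∈ g.I (l + 1) ↔ g.cen (l + 1) κ = κ ∧ κ ≠ g.cen (l + 1) (g.cen l κ) := by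
  rw [← g.mem_C]; exact Finset.mem_filter

lemma special (h : g.cen (l + 1) κ' = g.cen (l + 1) (g.cen l κ)) : g.cen l κ' = g.cen l κ :=
  (g.nest l _ _ h).trans (g.idem l κ)

lemma ne_special (h : κ' ∈ g.I (l + 1)) : κ' ≠ g.cen (l + 1) (g.cen l κ) := fun e => by
  obtain ⟨h1, h2⟩ := g.mem_I_succ.1 h
  rw [g.special (h1.trans e)] at h2
  exact h2 e

lemma lev_e (l : ℕ) (κ : T) : g.Lev l (g.e l κ) := fun y y' h => by
  rw [e, e, h]

lemma Lev.const {X : Type*} {g : Grid T μ} (a : X) : g.Lev j fun _ => a := fun _ _ _ => rfl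

lemma Lev.sum {ι : Type*} {g : Grid T μ} {s : Finset ι} {v : ι → T → F}
    (h : ∀ i ∈ s, g.Lev j (v i)) : g.Lev j fun y => ∑ i ∈ s, v i y :=
  fun y y' hy => Finset.sum_congr rfl fun i hi => h i hi y y' hy

lemma Lev.smul_const {g : Grid T μ} {r : T → ℝ} (h : g.Lev j r) (a : F) :
    g.Lev j fun y => r y • a := fun y y' hy => by simp only [h y y' hy]

lemma lev_D (l : ℕ) (ψ : T → F) : g.Lev l (g.D l ψ) := by
  cases l with
  | zero => exact g.lev_avg 0 ψ
  | succ l =>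
    intro y y' h
    simp only [D]
    rw [g.lev_avg (l + 1) ψ y y' h, g.lev_step l (g.avg l ψ) y y' h]

lemma lev_blk (l : ℕ) (s : Finset T) (ψ : T → F) : g.Lev l (g.blk l s ψ) :=
  Lev.sum fun κ _ => (g.lev_e l κ).smul_const _

lemma lev_prt (l : ℕ) (s : Finset T) (ψ : T → F) : g.Lev l (g.prt l s ψ) := by
  cases l with
  | zero => exact g.lev_blk 0 s ψ
  | succ l => exact (g.lev_step l _).add (g.lev_blk (l + 1) s ψ)

open scoped Classical in
lemma setIntegral_cell_lev_succ (hv : g.Lev (l + 1) v) (y : T) :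
    ∫ z in g.cell l y, v z ∂μ = ∑ κ ∈ (g.C (l + 1)).filter (fun κ => g.cen l κ = g.cen l y),
      μ.real (g.cell (l + 1) κ) • v κ := by
  obtain ⟨s, h, hs⟩ := g.setIntegral_cell_eq_sum (j := l) hv.nice y
  rw [h, hs]
  exact Finset.sum_congr rfl fun κ _ => g.setIntegral_cell_lev hv κ

open scoped Classical in
lemma sum_cell (l : ℕ) (y : T) :
    ∑ κ ∈ (g.C (l + 1)).filter (fun κ => g.cen l κ = g.cen l y), μ.real (g.cell (l + 1) κ) =
      μ.real (g.cell l y) := by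
  have h := g.setIntegral_cell_lev_succ (l := l) (v := fun _ => (1 : ℝ)) (Lev.const _) y
  rw [setIntegral_const] at h
  simpa using h.symm

lemma setIntegral_eq_zero (hv : g.avg l v = 0) (y : T) : ∫ z in g.cell l y, v z ∂μ = 0 := by
  have h := congrFun hv y
  exact (smul_eq_zero.1 h).resolve_left (inv_ne_zero (g.cell_pos l y).ne')

lemma avg_D (hψ : Nice ψ) : g.avg l (g.D (l + 1) ψ) = 0 := funext fun y => by
  rw [D, g.avg_sub (g.lev_avg _ _).nice (g.lev_step _ _).nice, g.avg_avg_succ hψ,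
    g.avg_step (g.lev_avg _ _)]
  exact sub_self _

lemma e_of_mem (hκ' : κ' ∈ g.I l) [DecidableEq T] :
    g.e l κ κ' = if κ' = κ then 1 else 0 := by
  have h := g.cen_of_mem_I hκ'
  cases l with
  | zero => simp only [e, e₀, h]
  | succ l => simp only [e, e₀, h, g.ne_special hκ', if_false, sub_zero]

lemma sum_e_of_mem (hκ' : κ' ∈ g.I l) (v : T → F) [DecidableEq T] :
    ∑ κ ∈ s, g.e l κ κ' • v κ = if κ' ∈ s then v κ' else 0 := by
  simp only [g.e_of_mem hκ', ite_smul, one_smul, zero_smul, Finset.sum_ite_eq]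

open scoped Classical in
lemma sum_e_of_special (hs : s ⊆ g.I (l + 1)) (h : κ' = g.cen (l + 1) (g.cen l κ')) (v : T → F) :
    ∑ κ ∈ s, g.e (l + 1) κ κ' • v κ = -∑ κ ∈ s.filter (fun κ => g.cen l κ = g.cen l κ'),
      (μ.real (g.cell (l + 1) κ) / μ.real (g.cell (l + 1) κ')) • v κ := by
  have h0 : g.cen (l + 1) κ' = κ' := by rw [h]; exact g.idem _ _
  rw [Finset.sum_filter, ← Finset.sum_neg_distrib]
  refine Finset.sum_congr rfl fun κ hκ => ?_
  have h1 : κ' ≠ κ := fun e => g.ne_special (hs hκ) (e ▸ h)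
  by_cases h2 : g.cen l κ = g.cen l κ'
  · rw [if_pos h2]
    have h3 : g.cell (l + 1) (g.cen l κ) = g.cell (l + 1) κ' := by
      rw [h2]; exact g.cell_congr (h.symm.trans h0.symm)
    have h4 : κ' = g.cen (l + 1) (g.cen l κ) := by rw [h2]; exact h
    simp only [e, e₀, h0, h1, ← h4, h3, if_true, if_false, zero_sub, neg_smul]
  · rw [if_neg h2]
    have h4 : κ' ≠ g.cen (l + 1) (g.cen l κ) := fun e => h2 (g.special (h0.trans e)).symm
    simp only [e, e₀, h0, h1, h4, if_false, sub_zero, zero_smul, neg_zero]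

lemma blk_full (hψ : Nice ψ) : g.blk l (g.I l) ψ = g.D l ψ := by
  classical
  funext y
  rw [← (g.lev_blk l (g.I l) ψ).cen_eq, ← (g.lev_D l ψ).cen_eq]
  set k := g.cen l y with hk
  have hkk : g.cen l k = k := g.idem l y
  by_cases hI : k ∈ g.I l
  · rw [blk, g.sum_e_of_mem hI, if_pos hI]
  · cases l with
    | zero => exact absurd (g.mem_C.2 hkk) hI
    | succ l =>
      have hsp : k = g.cen (l + 1) (g.cen l k) := by
        by_contra h; exact hI (g.mem_I_succ.2 ⟨hkk, h⟩)
      have hpos := g.cell_pos (l + 1) k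
      have h0 := g.setIntegral_cell_lev_succ (g.lev_D (l + 1) ψ) k
      rw [g.setIntegral_eq_zero (g.avg_D hψ)] at h0
      have hmem : k ∈ (g.C (l + 1)).filter (fun κ => g.cen l κ = g.cen l k) :=
        Finset.mem_filter.2 ⟨g.mem_C.2 hkk, rfl⟩
      rw [← Finset.add_sum_erase _ _ hmem] at h0
      rw [blk, g.sum_e_of_special subset_rfl hsp]
      have hE : ((g.C (l + 1)).filter (fun κ => g.cen l κ = g.cen l k)).erase k =
          (g.I (l + 1)).filter fun κ => g.cen l κ = g.cen l k := by
        ext κ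
        simp only [Finset.mem_erase, Finset.mem_filter, g.mem_I_succ, g.mem_C]
        constructor
        · rintro ⟨h1, h2, h3⟩
          refine ⟨⟨h2, ?_⟩, h3⟩
          rw [h3, ← hsp]; exact h1
        · rintro ⟨⟨h1, h2⟩, h3⟩
          refine ⟨?_, h1, h3⟩
          rw [h3, ← hsp] at h2; exact h2
      rw [hE] at h0
      have h1 := eq_neg_of_add_eq_zero_left h0.symm
      rw [← smul_right_inj hpos.ne', h1, smul_neg, Finset.smul_sum]
      congr 1
      refine Finset.sum_congr rfl fun κ _ => ?_
      rw [smul_smul, mul_div_cancel₀ _ hpos.ne']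

lemma Q_pos : 0 < g.Q := by
  have h1 := g.ratio 0 g.o
  have h2 := g.pos 0 g.o
  have h3 := g.pos 1 g.o
  by_contra h
  nlinarith

lemma norm_sum_e_le (hs : s ⊆ g.I l) (hS : ∀ κ, ‖v κ‖ ≤ S) (y : T) :
    ‖∑ κ ∈ s, g.e l κ y • v κ‖ ≤ (1 + g.Q) * S := by
  classical
  have hS0 : 0 ≤ S := (norm_nonneg _).trans (hS y)
  have hQ := g.Q_pos
  have hl : g.Lev l fun y => ∑ κ ∈ s, g.e l κ y • v κ := Lev.sum fun κ _ => (g.lev_e l κ).smul_const _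
  rw [← hl.cen_eq]
  set k := g.cen l y with hk
  have hkk : g.cen l k = k := g.idem l y
  by_cases hI : k ∈ g.I l
  · simp only [g.sum_e_of_mem hI]
    split_ifs
    · nlinarith [hS k]
    · rw [norm_zero]; positivity
  · cases l with
    | zero => exact absurd (g.mem_C.2 hkk) hI
    | succ l =>
      have hsp : k = g.cen (l + 1) (g.cen l k) := by
        by_contra h; exact hI (g.mem_I_succ.2 ⟨hkk, h⟩)
      have hpos := g.cell_pos (l + 1) k
      simp only [g.sum_e_of_special hs hsp, norm_neg]
      refine (norm_sum_le _ _).trans ?_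
      calc _ ≤ ∑ κ ∈ s.filter (fun κ => g.cen l κ = g.cen l k),
            (μ.real (g.cell (l + 1) κ) / μ.real (g.cell (l + 1) k)) * S := by
            refine Finset.sum_le_sum fun κ _ => ?_
            rw [norm_smul, Real.norm_of_nonneg (by positivity)]
            exact mul_le_mul_of_nonneg_left (hS κ) (by positivity)
        _ ≤ ∑ κ ∈ (g.C (l + 1)).filter (fun κ => g.cen l κ = g.cen l k),
            (μ.real (g.cell (l + 1) κ) / μ.real (g.cell (l + 1) k)) * S := by
            refine Finset.sum_le_sum_of_subset_of_nonneg
              (Finset.filter_subset_filter _ (hs.trans (g.I_subset _))) fun κ _ _ => by positivity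
        _ = μ.real (g.cell l k) / μ.real (g.cell (l + 1) k) * S := by
            rw [← Finset.sum_mul, ← Finset.sum_div, g.sum_cell]
        _ ≤ (1 + g.Q) * S := by
            refine mul_le_mul_of_nonneg_right ?_ hS0
            rw [div_le_iff₀ hpos]
            have h1 : μ.real (g.cell l k) ≤ g.Q * μ.real (g.cell (l + 1) k) := g.ratio l k
            linarith

lemma norm_step_le (hS : ∀ y, ‖v y‖ ≤ S) (hl : g.Lev j v) (y : T) :
    ‖g.step j v y‖ ≤ (2 * g.L + 1) * S :=
  g.norm_avg_le (g.nice_reg hl) fun z _ => by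
    have h1 := g.norm_reg_sub_le (g.osc_of_le (j := j) hS) hl z
    have h2 := norm_le_norm_sub_add (g.reg j v z) (v z)
    linarith [hS z]

lemma norm_D_le (hψ : Nice ψ) (hS : ∀ y, ‖ψ y‖ ≤ S) (l : ℕ) (y : T) :
    ‖g.D l ψ y‖ ≤ (2 * g.L + 2) * S := by
  have hS0 : 0 ≤ S := (norm_nonneg _).trans (hS y)
  have hL := g.L_pos
  have ha : ∀ j y, ‖g.avg j ψ y‖ ≤ S := fun j y => g.norm_avg_le hψ fun z _ => hS z
  cases l with
  | zero => exact (ha 0 y).trans (by nlinarith)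
  | succ l =>
    refine (norm_sub_le _ _).trans ?_
    have := g.norm_step_le (ha l) (g.lev_avg l ψ) y
    linarith [ha (l + 1) y]

lemma norm_prt_le (hψ : Nice ψ) (hS : ∀ y, ‖ψ y‖ ≤ S) (hs : s ⊆ g.I l) (y : T) :
    ‖g.prt l s ψ y‖ ≤ (2 * g.L + 1 + (1 + g.Q) * (2 * g.L + 2)) * S := by
  have hS0 : 0 ≤ S := (norm_nonneg _).trans (hS y)
  have hL := g.L_pos
  have hb := g.norm_sum_e_le hs (g.norm_D_le hψ hS l) y
  cases l with
  | zero =>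
    refine hb.trans ?_
    nlinarith
  | succ l =>
    refine (norm_add_le _ _).trans ((add_le_add (g.norm_step_le
      (fun y => g.norm_avg_le hψ fun z _ => hS z) (g.lev_avg l ψ) y) hb).trans (le_of_eq ?_))
    ring

lemma prt_full (hψ : Nice ψ) : g.prt l (g.I l) ψ = g.avg l ψ := by
  have h := g.blk_full (l := l) hψ
  cases l with
  | zero => exact h
  | succ l => funext y; rw [prt, h, D]; exact add_sub_cancel _ _

lemma avg_e (hκ : κ ∈ g.I (l + 1)) : g.avg l (g.e (l + 1) κ) = 0 := by
  classical
  funext y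
  have hc := g.cen_of_mem_I hκ
  set κs := g.cen (l + 1) (g.cen l κ) with hs
  have hcs : g.cen (l + 1) κs = κs := g.idem _ _
  have hls : g.cen l κs = g.cen l κ := g.special hcs
  have hcell : g.cell (l + 1) (g.cen l κ) = g.cell (l + 1) κs := g.cell_congr hcs.symm
  have hpos := g.cell_pos (l + 1) κs
  have key : ∫ z in g.cell l y, g.e (l + 1) κ z ∂μ = 0 := by
    rw [g.setIntegral_cell_lev_succ (g.lev_e (l + 1) κ)]
    have : ∀ κ' ∈ (g.C (l + 1)).filter (fun κ => g.cen l κ = g.cen l y),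
        μ.real (g.cell (l + 1) κ') • g.e (l + 1) κ κ' =
        (if κ' = κ then μ.real (g.cell (l + 1) κ) else 0) -
          if κ' = κs then μ.real (g.cell (l + 1) κ) else 0 := fun κ' hκ' => by
      have hc' := g.mem_C.1 (Finset.mem_filter.1 hκ').1
      simp only [e, e₀, hc', ← hs, hcell, smul_eq_mul, mul_sub, mul_ite, mul_one, mul_zero]
      congr 1
      · split_ifs with h1
        · rw [h1]
        · rfl
      · split_ifs with h1
        · rw [h1]; field_simp
        · rfl
    rw [Finset.sum_congr rfl this, Finset.sum_sub_distrib, Finset.sum_ite_eq', Finset.sum_ite_eq']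
    simp only [Finset.mem_filter, g.mem_C, hc, hcs, hls, true_and, sub_self]
  rw [avg, key, smul_zero]; rfl

lemma avg_sum {ι : Type*} {s : Finset ι} {v : ι → T → F} (h : ∀ i ∈ s, Nice (v i)) (y : T) :
    g.avg j (fun y => ∑ i ∈ s, v i y) y = ∑ i ∈ s, g.avg j (v i) y := by
  rw [avg, integral_finsetSum _ fun i hi => ((h i hi).integrable μ).integrableOn, Finset.smul_sum]
  rfl

lemma avg_e_smul (hκ : κ ∈ g.I (l + 1)) (a : F) (y : T) :
    g.avg l (fun y => g.e (l + 1) κ y • a) y = 0 := by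
  rw [g.avg_smul_lev (v := fun _ => a) (Lev.const a), g.avg_e hκ]
  exact zero_smul _ _

lemma avg_prt (hs : s ⊆ g.I (l + 1)) : g.avg l (g.prt (l + 1) s ψ) = g.avg l ψ := by
  funext y
  rw [prt, g.avg_add (g.lev_step _ _).nice (g.lev_blk _ _ _).nice, g.avg_step (g.lev_avg _ _)]
  have : g.avg l (g.blk (l + 1) s ψ) y = 0 := by
    refine (g.avg_sum (fun κ _ => ((g.lev_e (l + 1) κ).smul_const _).nice) y).trans ?_
    exact Finset.sum_eq_zero fun κ hκ => g.avg_e_smul (hs hκ) _ y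
  rw [this, add_zero]

lemma step_zero : g.step j (fun _ => (0 : F)) = fun _ => 0 := by
  have h := g.step_mul (j := j) (v := fun _ => (0 : F)) 0 (Lev.const 0)
  simpa only [zero_mul] using h

lemma V_zero (y : T) : g.V j (fun _ => (0 : F)) y = 0 := by
  have h := g.V_mul (j := j) (v := fun _ => (0 : F)) 0 (Lev.const 0) y
  simpa only [zero_mul] using h

lemma V_blk (l : ℕ) (s : Finset T) (ψ : T → F) (y : T) :
    g.V l (g.blk l s ψ) y = ∑ κ ∈ s, g.D l ψ κ * g.W F l κ y := by
  classical
  have aux : ∀ s : Finset T, g.V l (fun y => ∑ κ ∈ s, g.e l κ y • g.D l ψ κ) y =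
      ∑ κ ∈ s, g.D l ψ κ * g.W F l κ y := fun s => by
    induction s using Finset.induction_on with
    | empty => simp only [Finset.sum_empty]; exact g.V_zero y
    | insert a s ha ih =>
      simp only [Finset.sum_insert ha]
      rw [g.V_add ((g.lev_e l a).smul_const _) (Lev.sum fun κ _ => (g.lev_e l κ).smul_const _), ih, W,
        ← g.V_mul _ ((g.lev_e l a).smul_const _)]
      simp only [mul_smul_comm, mul_one]
  exact aux s

lemma V_prt (hψ : Nice ψ) (l : ℕ) (s : Finset T) (y : T) :
    g.V l (g.prt l s ψ) y = ∑ i ∈ Finset.range l, ∑ κ ∈ g.I i, g.D i ψ κ * g.W F i κ y +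
      ∑ κ ∈ s, g.D l ψ κ * g.W F l κ y := by
  induction l generalizing s with
  | zero => rw [Finset.range_zero, Finset.sum_empty, zero_add]; exact g.V_blk 0 s ψ y
  | succ l ih =>
    rw [Finset.sum_range_succ, ← ih, g.prt_full hψ, prt,
      g.V_add (g.lev_step _ _) (g.lev_blk _ _ _), g.V_step (g.lev_avg _ _), V_blk]

lemma avg_eq_zero_of_le {f : T → F} (hf : Nice f) (h : g.avg j f = 0) (hl : l ≤ j) :
    g.avg l f = 0 := by
  induction hl using Nat.decreasingInduction with
  | self => exact h
  | of_succ k _ ih =>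
    rw [← g.avg_avg_succ hf, ih]
    exact funext fun y => by rw [avg]; simp

lemma D_eq_zero_of_le {f : T → F} (hf : Nice f) (h : g.avg j f = 0) (hl : l ≤ j) (y : T) :
    g.D l f y = 0 := by
  have h1 := g.avg_eq_zero_of_le hf h hl
  cases l with
  | zero => exact congrFun h1 y
  | succ l =>
    rw [D, h1, g.avg_eq_zero_of_le hf h (l.le_succ.trans hl)]
    have := congrFun (g.step_zero (F := F) (j := l)) y
    exact sub_eq_zero.2 this.symm

lemma D_V_succ (hl : g.Lev j v) (y : T) : g.D (j + 1) (g.V j v) y = 0 := by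
  rw [D, g.avg_V hl, ← g.V_step hl, g.avg_V (g.lev_step j v)]
  exact sub_self _

lemma exists_V_eq (hl : g.Lev j v) (k : ℕ) : ∃ v', g.Lev (j + k) v' ∧ g.V (j + k) v' = g.V j v := by
  induction k with
  | zero => exact ⟨v, hl, rfl⟩
  | succ k ih =>
    obtain ⟨v', h1, h2⟩ := ih
    exact ⟨_, g.lev_step _ v', (g.V_step h1).trans h2⟩

lemma D_V_of_lt (hl : g.Lev j v) (h : j < l) (y : T) : g.D l (g.V j v) y = 0 := by
  obtain ⟨k, rfl⟩ := Nat.exists_eq_add_of_lt h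
  obtain ⟨v', h1, h2⟩ := g.exists_V_eq hl k
  rw [← h2]; exact g.D_V_succ h1 y

lemma nice_W (l : ℕ) (κ : T) : Nice (g.W F l κ) := g.nice_V ((g.lev_e l κ).smul_const _)

lemma avg_W_succ (hκ : κ ∈ g.I (l + 1)) : g.avg l (g.W F (l + 1) κ) = 0 := by
  rw [← g.avg_avg_succ (g.nice_W _ _), W, g.avg_V ((g.lev_e _ κ).smul_const _)]
  exact funext fun y => g.avg_e_smul hκ _ y

lemma D_W (hκ : κ ∈ g.I l) (hκ' : κ' ∈ g.I j) [DecidableEq T] :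
    g.D j (g.W F l κ) κ' = if j = l ∧ κ' = κ then 1 else 0 := by
  have hl := (g.lev_e l κ).smul_const (1 : F)
  rcases lt_trichotomy j l with h | rfl | h
  · rw [if_neg fun h' => h.ne h'.1]
    obtain ⟨k, rfl⟩ := Nat.exists_eq_add_of_lt h
    exact g.D_eq_zero_of_le (g.nice_W _ _) (g.avg_W_succ hκ) (by omega) _
  · have h1 : g.D j (g.W F j κ) κ' = g.e j κ κ' • (1 : F) := by
      cases j with
      | zero => rw [D, W, g.avg_V hl]
      | succ j =>
        have h2 := congrFun (g.step_zero (F := F) (j := j)) κ'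
        rw [D, g.avg_W_succ hκ, W, g.avg_V hl]
        exact (congrArg _ h2).trans (sub_zero _)
    rw [h1, g.e_of_mem hκ', ite_smul, one_smul, zero_smul]
    simp only [true_and]
  · rw [if_neg fun h' => h.ne' h'.1]
    exact g.D_V_of_lt hl h _

lemma exists_I_nonempty (hT : ∀ s : Finset T, ∃ y, ∀ z ∈ s, g.d y z ≠ 0) (l : ℕ) :
    ∃ i ≥ l, (g.I i).Nonempty := by
  by_contra! h
  have hc : ∀ k y, g.cen (l + k) y = g.cen (l + k) (g.cen l y) := fun k y => by
    induction k with
    | zero => exact (g.idem l y).symm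
    | succ k ih =>
      have h1 : ∀ z, g.cen (l + k + 1) z = g.cen (l + k + 1) (g.cen (l + k) z) := fun z => by
        by_contra hne
        have hmem : g.cen (l + k + 1) z ∈ g.I (l + k + 1) := by
          refine g.mem_I_succ.2 ⟨g.idem _ _, ?_⟩
          rw [g.nest (l + k) _ _ (g.idem (l + k + 1) z)]; exact hne
        have h2 := h (l + k + 1) (by omega)
        rw [h2] at hmem
        exact absurd hmem (Finset.notMem_empty _)
      rw [← add_assoc, h1, ih, ← h1]
  obtain ⟨y, hy⟩ := hT (g.C l)
  refine hy _ (g.cen_mem l y) (le_antisymm ?_ (g.d_nonneg _ _))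
  have hθ : g.θ ^ 2 < 1 := by nlinarith [g.θ_le, g.θ_pos]
  refine ge_of_tendsto' (tendsto_pow_atTop_nhds_zero_of_lt_one (sq_nonneg g.θ) hθ) fun k => ?_
  refine (g.diam (l + k) _ _ (hc k y)).trans ?_
  rw [← pow_mul]
  exact pow_le_pow_of_le_one g.θ_pos.le (by linarith [g.θ_le]) (by omega)

end Grid

open scoped Classical in
/-- A point representing the cell with a given index. -/
def cenI (M : ℕ) (i : Fin 4 → ℤ) : USphere :=
  if h : ∃ c : USphere, (∀ y', dF y' c < 1 / 32 * (1 / M) → idx M y' = i) ∧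
    1 / 32 * (1 / M) ≤ dF (-1) c then h.choose else 1

/-- The point representing the cell which contains `y`. -/
def cenF (M : ℕ) (y : USphere) : USphere := cenI M (idx M y)

lemma cenF_spec {M : ℕ} (hM : 0 < M) (y : USphere) :
    (∀ y', dF y' (cenF M y) < 1 / 32 * (1 / M) → idx M y' = idx M y) ∧
      1 / 32 * (1 / M) ≤ dF (-1) (cenF M y) := by
  have h := exists_idx_core hM y
  rw [cenF, cenI, dif_pos h]
  exact h.choose_spec

lemma idx_cenF {M : ℕ} (hM : 0 < M) (y : USphere) : idx M (cenF M y) = idx M y := by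
  refine (cenF_spec hM y).1 _ ?_
  rw [dF_self]
  have : (0 : ℝ) < M := by exact_mod_cast hM
  positivity

lemma cenF_eq_iff {M : ℕ} (hM : 0 < M) {y z : USphere} :
    cenF M y = cenF M z ↔ idx M y = idx M z :=
  ⟨fun h => by rw [← idx_cenF hM y, h, idx_cenF hM], fun h => by rw [cenF, h, cenF]⟩

lemma measurableSet_dF_ball (x : USphere) (r : ℝ) : MeasurableSet {y | dF y x ≤ r} :=
  measurableSet_le (continuous_dF x).measurable measurable_const

lemma dF_ball_pos (x : USphere) {r : ℝ} (hr : 0 < r) : 0 < sphMeas.real {y | dF y x ≤ r} :=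
  (cap_pos (by positivity)).trans_le (cap_le_dF_ball x r)

lemma measurableSet_cenF (M : ℕ) (z : USphere) : MeasurableSet {y | cenF M y = z} :=
  measurable_idx M (MeasurableSet.of_discrete (s := {i | cenI M i = z}))

lemma cenF_cenF {M : ℕ} (hM : 0 < M) (y : USphere) : cenF M (cenF M y) = cenF M y :=
  (cenF_eq_iff hM).2 (idx_cenF hM y)

lemma cenF_core {M : ℕ} (hM : 0 < M) {y z : USphere} (h : dF y (cenF M z) < 1 / 32 * (1 / M)) :
    cenF M y = cenF M z := (cenF_eq_iff hM).2 ((cenF_spec hM z).1 y h)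

lemma card_le_of_dF_le {n : ℕ} (hn : ∀ r : ℝ, 0 < r → ∀ x z : USphere,
    sphMeas.real {y | dF y x ≤ r} ≤ n * sphMeas.real {y | dF y z ≤ 1 / 256 * r})
    {M : ℕ} (hM : 0 < M) (y : USphere) (s : Finset USphere)
    (hs : ∀ κ ∈ s, cenF M κ = κ ∧ dF y κ ≤ 3 * (1 / M)) : (s.card : ℝ) ≤ n := by
  have hM' : (0 : ℝ) < M := by exact_mod_cast hM
  have hδ : (0 : ℝ) < 1 / M := by positivity
  set δ : ℝ := 1 / M
  have hpos := dF_ball_pos y (r := 4 * δ) (by positivity)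
  have h1 : ∑ κ ∈ s, sphMeas.real {z | dF z κ ≤ 1 / 256 * (4 * δ)} ≤
      sphMeas.real {z | dF z y ≤ 4 * δ} := by
    rw [← measureReal_biUnion_finset]
    · refine measureReal_mono (Set.iUnion₂_subset fun κ hκ z hz => ?_) (measure_ne_top _ _)
      have hz' : dF z κ ≤ 1 / 256 * (4 * δ) := hz
      have h1 := (hs κ hκ).2
      have h2 := dF_tri z κ y
      rw [dF_comm κ y] at h2
      show dF z y ≤ 4 * δ
      linarith
    · intro κ hκ κ' hκ' hne
      refine Set.disjoint_left.2 fun z h1 h2 => hne ?_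
      have h1' : dF z κ ≤ 1 / 256 * (4 * δ) := h1
      have h2' : dF z κ' ≤ 1 / 256 * (4 * δ) := h2
      have e1 := (hs κ hκ).1
      have e2 := (hs κ' hκ').1
      have c1 : cenF M z = cenF M κ := cenF_core hM (by rw [e1]; linarith)
      have c2 : cenF M z = cenF M κ' := cenF_core hM (by rw [e2]; linarith)
      rw [← e1, ← e2, ← c1, c2]
    · exact fun κ _ => measurableSet_dF_ball κ _
  have h2 : (s.card : ℝ) * sphMeas.real {z | dF z y ≤ 4 * δ} ≤
      n * ∑ κ ∈ s, sphMeas.real {z | dF z κ ≤ 1 / 256 * (4 * δ)} := by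
    rw [Finset.mul_sum, ← nsmul_eq_mul]
    exact Finset.card_nsmul_le_sum _ _ _ fun κ _ => hn _ (by positivity) y κ
  have h3 : (n : ℝ) * ∑ κ ∈ s, sphMeas.real {z | dF z κ ≤ 1 / 256 * (4 * δ)} ≤
      n * sphMeas.real {z | dF z y ≤ 4 * δ} := by gcongr
  exact le_of_mul_le_mul_right (h2.trans h3) hpos

/-- The partitions of the sphere, with conjugate points identified. -/
theorem exists_grid : ∃ g : Grid USphere sphMeas, g.d = dF ∧ g.o = -1 := by
  obtain ⟨P, hP⟩ := exists_dF_doubling (ε := 1 / 256) (by norm_num)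
  obtain ⟨H, hH⟩ := exists_dF_doubling (ε := 1 / 64) (by norm_num)
  set B : ℝ := 6 * (2 * P + 2 + 4 * (H + 1 : ℝ) / (1 / 32)) with hB
  have hBpos : 0 < B := by positivity
  obtain ⟨m, hm⟩ := exists_pow_lt_of_lt_one (one_div_pos.2 hBpos) (show (1 / 2 : ℝ) < 1 by norm_num)
  set θ : ℝ := (1 / 2) ^ m with hθ
  have hθ0 : 0 < θ := by positivity
  obtain ⟨Q, hQ⟩ := exists_dF_doubling (ε := 1 / 64 * θ ^ 2) (by positivity)
  set M : ℕ → ℕ := fun j => (4 ^ m) ^ j with hM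
  have hM0 : ∀ j, 0 < M j := fun j => by positivity
  have hM1 : ∀ j, M (j + 1) = 4 ^ m * M j := fun j => pow_succ' _ _
  have hδ : ∀ j, (1 : ℝ) / M j = θ ^ (2 * j) := fun j => by
    rw [hM, hθ, ← pow_mul, mul_left_comm, pow_mul, pow_mul _ m j]
    push_cast
    rw [← pow_mul, ← pow_mul, one_div, ← inv_pow]
    norm_num
  have hcell : ∀ j z, {y | dF y (cenF (M j) z) ≤ 1 / 64 * θ ^ (2 * j)} ⊆
      {y | cenF (M j) y = cenF (M j) z} := fun j z y hy => by
    have hy' : dF y (cenF (M j) z) ≤ 1 / 64 * θ ^ (2 * j) := hy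
    refine cenF_core (hM0 j) ?_
    rw [hδ]
    have : 0 < θ ^ (2 * j) := by positivity
    linarith
  have hdiam : ∀ j y z, cenF (M j) y = cenF (M j) z → dF y z ≤ θ ^ (2 * j) := fun j y z h => by
    rw [← hδ]; exact dF_le_of_idx_eq (hM0 j) ((cenF_eq_iff (hM0 j)).1 h)
  refine ⟨{ d := dF, o := -1, c := 1 / 32, θ := θ, P := P, H := H + 1, Q := Q
            cen := fun j => cenF (M j)
            d_self := dF_self
            d_comm := dF_comm
            d_nonneg := dF_nonneg
            d_tri := dF_tri
            d_meas := fun x => (continuous_dF x).measurable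
            d_le_one := fun x y => (dF_le x y).trans (by linarith [norm_sph_sub_le x y])
            cen_meas := fun j z => measurableSet_cenF _ _
            cen_fin := fun j => ((finite_range_idx (hM0 j)).image (cenI (M j))).subset ?_
            idem := fun j y => cenF_cenF (hM0 j) y
            nest := fun j y y' h => ?_
            diam := hdiam
            core := fun j y z h => cenF_core (hM0 j) (by rw [hδ]; exact h)
            core_o := fun j z => by rw [← hδ]; exact (cenF_spec (hM0 j) z).2
            pack := fun j y s hs => card_le_of_dF_le hP (hM0 j) y s (by rw [hδ]; exact hs)
            bump := fun j z => ?_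
            ratio := fun j z => ?_
            pos := fun j z => ?_
            c_pos := by norm_num
            c_le := by norm_num
            θ_pos := hθ0
            P_nonneg := by positivity
            H_pos := by positivity
            small := ?_ }, rfl, rfl⟩
  · rintro _ ⟨y, rfl⟩
    exact ⟨_, ⟨y, rfl⟩, rfl⟩
  · rw [hM1] at h
    refine (cenF_eq_iff (hM0 j)).2 (idx_nest (N := 4 ^ m) (by positivity) ((cenF_eq_iff ?_).1 h))
    have := hM0 j
    positivity
  · have h0 : (0 : ℝ) < θ ^ (2 * j) := by positivity
    calc sphMeas.real {y | cenF (M j) y = cenF (M j) z}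
        ≤ sphMeas.real {y | dF y (cenF (M j) z) ≤ θ ^ (2 * j)} :=
          measureReal_mono (fun y hy => hdiam j _ _ (Eq.trans hy (cenF_cenF (hM0 j) z).symm))
            (measure_ne_top _ _)
      _ ≤ H * sphMeas.real {y | dF y (cenF (M j) z) ≤ 1 / 64 * θ ^ (2 * j)} := hH _ h0 _ _
      _ ≤ (H + 1 : ℝ) * sphMeas.real {y | dF y (cenF (M j) z) ≤ 1 / 64 * θ ^ (2 * j)} := by
          gcongr; linarith
      _ = _ := by
          rw [show (1 : ℝ) / 64 * θ ^ (2 * j) = 1 / 32 * θ ^ (2 * j) / 2 by ring]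
  · have h0 : (0 : ℝ) < θ ^ (2 * j) := by positivity
    calc sphMeas.real {y | cenF (M j) y = cenF (M j) z}
        ≤ sphMeas.real {y | dF y z ≤ θ ^ (2 * j)} :=
          measureReal_mono (fun y hy => hdiam j _ _ hy) (measure_ne_top _ _)
      _ ≤ Q * sphMeas.real {y | dF y (cenF (M (j + 1)) z) ≤ 1 / 64 * θ ^ 2 * θ ^ (2 * j)} :=
          hQ _ h0 _ _
      _ ≤ Q * sphMeas.real {y | cenF (M (j + 1)) y = cenF (M (j + 1)) z} := by
          refine mul_le_mul_of_nonneg_left (measureReal_mono ?_ (measure_ne_top _ _)) (by positivity)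
          refine subset_trans ?_ (hcell (j + 1) z)
          rw [show (1 : ℝ) / 64 * θ ^ 2 * θ ^ (2 * j) = 1 / 64 * θ ^ (2 * (j + 1)) by ring]
  · exact (dF_ball_pos (cenF (M j) z) (by positivity)).trans_le
      (measureReal_mono (hcell j z) (measure_ne_top _ _))
  · rw [← hB]
    have := (lt_div_iff₀ hBpos).1 hm
    linarith

/-- A unit function on the sphere with the folding symmetry, set to `0` at `-1`. -/
def un (y : USphere) : ℍ[ℝ] := ‖1 + (y : ℍ[ℝ])‖⁻¹ • (1 + star (y : ℍ[ℝ]))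

lemma norm_one_add_star (y : USphere) : ‖1 + star (y : ℍ[ℝ])‖ = ‖1 + (y : ℍ[ℝ])‖ := by
  rw [← norm_star]; simp

lemma un_eq (y : USphere) : un y = ‖1 + star (y : ℍ[ℝ])‖⁻¹ • (1 + star (y : ℍ[ℝ])) := by
  rw [un, norm_one_add_star]

lemma norm_un {y : USphere} (h : 1 + (y : ℍ[ℝ]) ≠ 0) : ‖un y‖ = 1 := by
  rw [un, norm_smul, norm_one_add_star, norm_inv, norm_norm, inv_mul_cancel₀ (norm_ne_zero_iff.2 h)]

lemma un_of_eq {y : USphere} (h : 1 + (y : ℍ[ℝ]) = 0) : un y = 0 := by rw [un, h]; simp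

lemma norm_un_le (y : USphere) : ‖un y‖ ≤ 1 := by
  by_cases h : 1 + (y : ℍ[ℝ]) = 0
  · rw [un_of_eq h]; simp
  · exact (norm_un h).le

lemma un_cj (y : USphere) : un (cj y) = un y * y := by
  rw [un, un, cj_coe, star_star, norm_one_add_star, smul_mul_assoc, add_mul, y.star_mul, one_mul,
    add_comm]

lemma foldSym_un : FoldSym un := fun y => by
  rw [un_cj, mul_assoc, y.mul_star, mul_one]

lemma un_mul_star {y : USphere} (h : 1 + (y : ℍ[ℝ]) ≠ 0) : star (un y) * un y = 1 := by
  rw [Quaternion.star_mul_self, Quaternion.normSq_eq_norm_mul_self, norm_un h]; simp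

lemma norm_one_add_mul_un_sub_le (y y' : USphere) :
    ‖1 + (y : ℍ[ℝ])‖ * ‖un y - un y'‖ ≤ 2 * ‖(y : ℍ[ℝ]) - y'‖ := by
  by_cases h : 1 + (y : ℍ[ℝ]) = 0
  · rw [h, norm_zero, zero_mul]; positivity
  by_cases h' : 1 + (y' : ℍ[ℝ]) = 0
  · rw [un_of_eq h', sub_zero, norm_un h, mul_one, (eq_neg_of_add_eq_zero_right h'), sub_neg_eq_add,
      add_comm]
    linarith [norm_nonneg ((y : ℍ[ℝ]) + 1)]
  · have hs : ∀ {z : USphere}, 1 + (z : ℍ[ℝ]) ≠ 0 → 1 + star (z : ℍ[ℝ]) ≠ 0 := fun {z} hz => by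
      rw [← norm_ne_zero_iff] at hz ⊢; rwa [norm_one_add_star]
    have h1 := norm_normalize_sub_le (hs h) (hs h')
    rw [← un_eq, ← un_eq, add_sub_add_left_eq_sub, norm_star_sub, norm_one_add_star] at h1
    rwa [le_div_iff₀ (norm_pos_iff.2 h), mul_comm] at h1

lemma norm_un_sub_le (y y' : USphere) : ‖un y - un y'‖ ≤ 2 :=
  (norm_sub_le _ _).trans (by linarith [norm_un_le y, norm_un_le y'])

lemma nice_un : Nice un := by
  refine ⟨?_, 1, norm_un_le⟩
  have h1 : Continuous fun y : USphere => ‖1 + (y : ℍ[ℝ])‖ := by fun_prop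
  have h2 : Continuous fun y : USphere => 1 + star (y : ℍ[ℝ]) := by fun_prop
  exact h1.measurable.inv.stronglyMeasurable.smul h2.stronglyMeasurable

lemma dF_neg_one (y : USphere) : dF y (-1) ≤ ‖1 + (y : ℍ[ℝ])‖ / 4 := by
  refine (dF_le _ _).trans (le_of_eq ?_)
  rw [coe_neg_sphere, USphere.coe_one, sub_neg_eq_add, add_comm]

section Holder
variable {ψ v : USphere → ℍ[ℝ]} {K : ℝ}

lemma even_of_holder (h : ∀ y y', ‖ψ y - ψ y'‖ ≤ K * √(dF y y')) (y : USphere) :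
    ψ (cj y) = ψ y := by
  have := h (cj y) y
  rw [dF_cj_left, dF_self, Real.sqrt_zero, mul_zero, norm_le_zero_iff] at this
  exact sub_eq_zero.1 this

lemma foldSym_mul_un (h : ∀ y, ψ (cj y) = ψ y) : FoldSym fun y => ψ y * un y := fun y => by
  simp only [h, mul_assoc, ← foldSym_un y]

lemma sqrt_mul_norm_un_sub_le (y y' : USphere) :
    √‖1 + (y : ℍ[ℝ])‖ * ‖un y - un y'‖ ≤ 2 * √‖(y : ℍ[ℝ]) - y'‖ := by
  have h1 := norm_one_add_mul_un_sub_le y y'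
  have h2 := norm_un_sub_le y y'
  set a := ‖1 + (y : ℍ[ℝ])‖
  set t := ‖(y : ℍ[ℝ]) - y'‖
  rcases le_total a t with h | h
  · have := Real.sqrt_le_sqrt h
    have h3 := Real.sqrt_nonneg a
    have h4 := norm_nonneg (un y - un y')
    nlinarith
  · have h3 := Real.sqrt_le_sqrt h
    have ha : a = √a * √a := (Real.mul_self_sqrt (norm_nonneg _)).symm
    have ht : t = √t * √t := (Real.mul_self_sqrt (norm_nonneg _)).symm
    rcases (Real.sqrt_nonneg a).eq_or_lt with h0 | h0
    · rw [← h0, zero_mul]; positivity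
    · refine le_of_mul_le_mul_left ?_ h0
      calc √a * (√a * ‖un y - un y'‖) = a * ‖un y - un y'‖ := by rw [← mul_assoc, ← ha]
        _ ≤ 2 * t := h1
        _ = 2 * (√t * √t) := by rw [← ht]
        _ ≤ √a * (2 * √t) := by nlinarith [Real.sqrt_nonneg t]

lemma holS_mul_un (hK : 0 ≤ K) (h : ∀ y y', ‖ψ y - ψ y'‖ ≤ K * √(dF y y')) (h0 : ψ (-1) = 0) :
    HolS (3 * K) fun y => ψ y * un y := by
  refine ⟨by positivity, fun y y' => ?_⟩
  have e : ψ y * un y - ψ y' * un y' = ψ y * (un y - un y') + (ψ y - ψ y') * un y' := by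
    noncomm_ring
  have h1 : ‖ψ y - ψ y'‖ ≤ K * √‖(y : ℍ[ℝ]) - y'‖ := (h y y').trans <| by
    gcongr; exact (dF_le y y').trans (by linarith [norm_nonneg ((y : ℍ[ℝ]) - y')])
  have h2 : ‖ψ y‖ ≤ K * √‖1 + (y : ℍ[ℝ])‖ := by
    have := h y (-1)
    rw [h0, sub_zero] at this
    refine this.trans ?_
    gcongr; exact (dF_neg_one y).trans (by linarith [norm_nonneg (1 + (y : ℍ[ℝ]))])
  have h3 := sqrt_mul_norm_un_sub_le y y'
  rw [e]
  refine (norm_add_le _ _).trans ?_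
  rw [norm_mul, norm_mul]
  calc _ ≤ K * √‖1 + (y : ℍ[ℝ])‖ * ‖un y - un y'‖ + K * √‖(y : ℍ[ℝ]) - y'‖ * 1 :=
        add_le_add (mul_le_mul_of_nonneg_right h2 (norm_nonneg _))
          (mul_le_mul h1 (norm_un_le y') (norm_nonneg _) (by positivity))
    _ = K * (√‖1 + (y : ℍ[ℝ])‖ * ‖un y - un y'‖) + K * √‖(y : ℍ[ℝ]) - y'‖ := by ring
    _ ≤ K * (2 * √‖(y : ℍ[ℝ]) - y'‖) + K * √‖(y : ℍ[ℝ]) - y'‖ := by gcongr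
    _ = _ := by ring

/-- Quotient by the unit function. -/
def unfold (v : USphere → ℍ[ℝ]) (y : USphere) : ℍ[ℝ] := v y * star (un y)

lemma norm_unfold_le (v : USphere → ℍ[ℝ]) (y : USphere) : ‖unfold v y‖ ≤ ‖v y‖ := by
  rw [unfold, norm_mul, norm_star]
  exact mul_le_of_le_one_right (norm_nonneg _) (norm_un_le y)

lemma FoldSym.eq_zero (hv : FoldSym v) {y : USphere} (h : 1 + (y : ℍ[ℝ]) = 0) : v y = 0 := by
  have hy : (y : ℍ[ℝ]) = -1 := eq_neg_of_add_eq_zero_right h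
  have hcj : cj y = y := Subtype.ext (by rw [cj_coe, hy]; simp)
  have h1 := hv y
  rw [hcj, hy, star_neg, star_one, mul_neg, mul_one] at h1
  have h2 : (2 : ℝ) • v y = 0 := by
    rw [two_smul]; nth_rewrite 1 [h1]; exact neg_add_cancel _
  exact (smul_eq_zero.1 h2).resolve_left two_ne_zero

lemma unfold_mul_un (hv : FoldSym v) (y : USphere) : unfold v y * un y = v y := by
  by_cases h : 1 + (y : ℍ[ℝ]) = 0
  · rw [un_of_eq h, mul_zero, hv.eq_zero h]
  · rw [unfold, mul_assoc, un_mul_star h, mul_one]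

lemma unfold_cj (hv : FoldSym v) (y : USphere) : unfold v (cj y) = unfold v y := by
  rw [unfold, unfold, hv y, un_cj, star_mul, mul_assoc]

lemma unfold_neg_one (v : USphere → ℍ[ℝ]) : unfold v (-1) = 0 := by
  rw [unfold, un_of_eq, star_zero, mul_zero]
  rw [coe_neg_sphere, USphere.coe_one, add_neg_cancel]

lemma nice_unfold (hv : Continuous v) : Nice (unfold v) := by
  obtain ⟨C, hC⟩ := isCompact_univ.exists_bound_of_continuousOn (hv.norm.continuousOn (s := Set.univ))
  refine ⟨hv.stronglyMeasurable.mul (continuous_star.comp_stronglyMeasurable nice_un.1), C,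
    fun y => (norm_unfold_le v y).trans ?_⟩
  simpa using hC y trivial

lemma norm_unfold_sub_le {L : ℝ} (hL : 0 ≤ L) (hv : FoldSym v)
    (h : ∀ y y', ‖v y - v y'‖ ≤ L * ‖(y : ℍ[ℝ]) - y'‖) (y y' : USphere) :
    ‖unfold v y - unfold v y'‖ ≤ 12 * L * dF y y' := by
  have key : ∀ y y', ‖unfold v y - unfold v y'‖ ≤ 3 * L * ‖(y : ℍ[ℝ]) - y'‖ := fun y y' => by
    have e : unfold v y - unfold v y' = v y * star (un y - un y') + (v y - v y') * star (un y') := by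
      simp only [unfold, star_sub]; noncomm_ring
    have h1 : ‖v y‖ ≤ L * ‖1 + (y : ℍ[ℝ])‖ := by
      have h2 := h y (-1)
      rwa [hv.eq_zero (y := -1) (by rw [coe_neg_sphere, USphere.coe_one, add_neg_cancel]), sub_zero,
        coe_neg_sphere, USphere.coe_one, sub_neg_eq_add, add_comm (y : ℍ[ℝ])] at h2
    rw [e]
    refine (norm_add_le _ _).trans ?_
    rw [norm_mul, norm_mul, norm_star, norm_star]
    calc _ ≤ L * ‖1 + (y : ℍ[ℝ])‖ * ‖un y - un y'‖ + L * ‖(y : ℍ[ℝ]) - y'‖ * 1 :=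
          add_le_add (mul_le_mul_of_nonneg_right h1 (norm_nonneg _))
            (mul_le_mul (h y y') (norm_un_le y') (norm_nonneg _) (by positivity))
      _ = L * (‖1 + (y : ℍ[ℝ])‖ * ‖un y - un y'‖) + L * ‖(y : ℍ[ℝ]) - y'‖ := by ring
      _ ≤ L * (2 * ‖(y : ℍ[ℝ]) - y'‖) + L * ‖(y : ℍ[ℝ]) - y'‖ :=
          add_le_add (mul_le_mul_of_nonneg_left (norm_one_add_mul_un_sub_le y y') hL) le_rfl
      _ = _ := by ring
  rcases dF_cases y y' with h' | h'
  · refine (key y y').trans (le_of_eq ?_); rw [h']; ring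
  · rw [← unfold_cj hv y']
    refine (key y (cj y')).trans (le_of_eq ?_); rw [h']; ring

end Holder

namespace Nice
variable {T F : Type*} [MeasurableSpace T] [NormedRing F] {f h : T → F}

lemma mul (hf : Nice f) (hh : Nice h) : Nice fun y => f y * h y := by
  obtain ⟨⟨hf, C, hC⟩, hh, C', hC'⟩ := hf, hh
  refine ⟨hf.mul hh, C * C', fun y => (norm_mul_le _ _).trans ?_⟩
  exact mul_le_mul (hC y) (hC' y) (norm_nonneg _) ((norm_nonneg _).trans (hC y))

end Nice

lemma _root_.Continuous.nice {F : Type*} [NormedRing F] {v : USphere → F} (hv : Continuous v) :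
    Nice v := by
  obtain ⟨C, hC⟩ := isCompact_univ.exists_bound_of_continuousOn (hv.norm.continuousOn (s := Set.univ))
  exact ⟨hv.stronglyMeasurable, C, fun y => by simpa using hC y trivial⟩

section Cauchy
variable {v w : USphere → ℍ[ℝ]} {x : ℍ[ℝ]}

lemma Nice.integrable_mul_kern (hv : Nice v) (hx : x ∈ ball (0 : ℍ[ℝ]) 1) :
    Integrable (fun y => v y * kern x y) sphMeas :=
  (hv.mul (continuous_kern hx).nice).integrable _

lemma Nice.cauchy_add (hv : Nice v) (hw : Nice w) (hx : x ∈ ball (0 : ℍ[ℝ]) 1) :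
    cauchy (fun y => v y + w y) x = cauchy v x + cauchy w x := by
  unfold cauchy
  simp only [add_mul]
  exact integral_add (hv.integrable_mul_kern hx) (hw.integrable_mul_kern hx)

lemma Nice.cauchy_sub (hv : Nice v) (hw : Nice w) (hx : x ∈ ball (0 : ℍ[ℝ]) 1) :
    cauchy (fun y => v y - w y) x = cauchy v x - cauchy w x := by
  unfold cauchy
  simp only [sub_mul]
  exact integral_sub (hv.integrable_mul_kern hx) (hw.integrable_mul_kern hx)

lemma Nice.cauchy_const_mul (hv : Nice v) (a : ℍ[ℝ]) (hx : x ∈ ball (0 : ℍ[ℝ]) 1) :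
    cauchy (fun y => a * v y) x = a * cauchy v x := by
  unfold cauchy
  simp only [mul_assoc]
  exact integral_const_mul_of_integrable (hv.integrable_mul_kern hx)

lemma cauchy_sum {ι : Type*} (s : Finset ι) {v : ι → USphere → ℍ[ℝ]} (hv : ∀ i ∈ s, Nice (v i))
    (hx : x ∈ ball (0 : ℍ[ℝ]) 1) :
    cauchy (fun y => ∑ i ∈ s, v i y) x = ∑ i ∈ s, cauchy (v i) x := by
  unfold cauchy
  simp only [Finset.sum_mul]
  exact integral_finsetSum _ fun i hi => (hv i hi).integrable_mul_kern hx

end Cauchy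

namespace Grid
variable {T : Type*} [MeasurableSpace T] {μ : Measure T} [IsProbabilityMeasure μ] (g : Grid T μ)
variable {F : Type*} [NormedRing F] [NormedAlgebra ℝ F] [CompleteSpace F] {v w ψ : T → F} {j l : ℕ}

lemma integral_eq_sum_cells (hv : Nice v) :
    ∫ y, v y ∂μ = ∑ κ ∈ g.C j, ∫ y in g.cell j κ, v y ∂μ := by
  rw [← integral_biUnion_finset]
  · rw [← setIntegral_univ]
    congr 2
    ext z
    simp only [Set.mem_univ, Set.mem_iUnion, exists_prop, true_iff]
    exact ⟨g.cen j z, g.cen_mem _ _, (g.idem _ _).symm⟩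
  · exact fun κ _ => g.measurableSet_cell _ _
  · intro κ hκ κ' hκ' hne
    refine Set.disjoint_left.2 fun z h1 h2 => hne ?_
    rw [← g.mem_C.1 hκ, ← g.mem_C.1 hκ']
    exact (Eq.symm h1).trans h2
  · exact fun κ _ => (hv.integrable μ).integrableOn

lemma integral_mul_lev_eq_zero (hv : Nice v) (hv0 : g.avg j v = 0) (hw : g.Lev j w) :
    ∫ y, v y * w y ∂μ = 0 := by
  rw [g.integral_eq_sum_cells (j := j) (hv.mul hw.nice)]
  refine Finset.sum_eq_zero fun κ _ => ?_
  have h1 : ∫ y in g.cell j κ, v y * w y ∂μ = ∫ y in g.cell j κ, v y * w κ ∂μ :=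
    setIntegral_congr_fun (g.measurableSet_cell _ _) fun y hy => by
      show v y * w y = v y * w κ
      rw [hw y κ hy]
  rw [h1, integral_mul_const_of_integrable (hv.integrable μ).integrableOn,
    g.setIntegral_eq_zero hv0, zero_mul]

end Grid

lemma abs_inv_pow_four_sub_le {p q t : ℝ} (hp : 0 < p) (hq : 0 < q) (h1 : q ≤ 5 * p)
    (h2 : p ≤ 5 * q) (ht : |p - q| ≤ t) : |(p ^ 4)⁻¹ - (q ^ 4)⁻¹| ≤ 97500 * t * (p ^ 5)⁻¹ := by
  have ht0 : 0 ≤ t := (abs_nonneg _).trans ht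
  have e : (p ^ 4)⁻¹ - (q ^ 4)⁻¹ = (q - p) * ((p + q) * (p ^ 2 + q ^ 2)) * (p ^ 4)⁻¹ * (q ^ 4)⁻¹ := by
    field_simp; ring
  have h3 : (q ^ 4)⁻¹ ≤ 625 * (p ^ 4)⁻¹ := by
    rw [inv_le_comm₀ (by positivity) (by positivity), mul_inv, inv_inv]
    have : p ^ 4 ≤ (5 * q) ^ 4 := pow_le_pow_left₀ hp.le h2 4
    linarith [mul_pow 5 q 4]
  have h4 : (p + q) * (p ^ 2 + q ^ 2) ≤ 156 * p ^ 3 := by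
    have : (p + q) * (p ^ 2 + q ^ 2) ≤ (p + 5 * p) * (p ^ 2 + (5 * p) ^ 2) := by gcongr
    linarith [show (p + 5 * p) * (p ^ 2 + (5 * p) ^ 2) = 156 * p ^ 3 by ring]
  rw [e, abs_mul, abs_mul, abs_mul, abs_of_pos (inv_pos.2 (pow_pos hp 4)),
    abs_of_pos (inv_pos.2 (pow_pos hq 4)), abs_of_pos (show 0 < (p + q) * (p ^ 2 + q ^ 2) by positivity),
    abs_sub_comm]
  calc _ ≤ t * (156 * p ^ 3) * (p ^ 4)⁻¹ * (625 * (p ^ 4)⁻¹) := by gcongr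
    _ = _ := by field_simp; ring

lemma norm_kern_sub_kern_le {x : ℍ[ℝ]} (hx : x ∈ ball (0 : ℍ[ℝ]) 1) {y c : USphere}
    (h1 : ‖(c : ℍ[ℝ]) - x‖ ≤ 5 * ‖(y : ℍ[ℝ]) - x‖) (h2 : ‖(y : ℍ[ℝ]) - x‖ ≤ 5 * ‖(c : ℍ[ℝ]) - x‖) :
    ‖kern x y - kern x c‖ ≤ 100000 * ‖(y : ℍ[ℝ]) - c‖ * (‖(y : ℍ[ℝ]) - x‖ ^ 4)⁻¹ := by
  have hp : 0 < ‖(y : ℍ[ℝ]) - x‖ := norm_pos_iff.2 (USphere.sub_ne_zero hx y)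
  have hq : 0 < ‖(c : ℍ[ℝ]) - x‖ := norm_pos_iff.2 (USphere.sub_ne_zero hx c)
  have ht : |‖(y : ℍ[ℝ]) - x‖ - ‖(c : ℍ[ℝ]) - x‖| ≤ ‖(y : ℍ[ℝ]) - c‖ := by
    have := abs_norm_sub_norm_le ((y : ℍ[ℝ]) - x) ((c : ℍ[ℝ]) - x)
    rwa [sub_sub_sub_cancel_right] at this
  have hn : ‖1 - (y : ℍ[ℝ]) * star x‖ = ‖(y : ℍ[ℝ]) - x‖ := by
    rw [← y.mul_star, ← mul_sub, norm_mul, y.norm_eq, one_mul, ← star_sub, norm_star]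
  have hx1 : ‖x‖ ≤ 1 := (mem_ball_zero_iff.1 hx).le
  set p := ‖(y : ℍ[ℝ]) - x‖
  set q := ‖(c : ℍ[ℝ]) - x‖
  set t := ‖(y : ℍ[ℝ]) - c‖
  have e : kern x y - kern x c = ((p ^ 4)⁻¹ - (q ^ 4)⁻¹) • (1 - (y : ℍ[ℝ]) * star x)
      - (q ^ 4)⁻¹ • (((y : ℍ[ℝ]) - c) * star x) := by
    rw [kern_eq, kern_eq, sub_mul]; module
  have h3 : (q ^ 4)⁻¹ ≤ 625 * (p ^ 4)⁻¹ := by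
    rw [inv_le_comm₀ (by positivity) (by positivity), mul_inv, inv_inv]
    have : p ^ 4 ≤ (5 * q) ^ 4 := pow_le_pow_left₀ hp.le h2 4
    linarith [mul_pow 5 q 4]
  rw [e]
  refine (norm_sub_le _ _).trans ?_
  rw [norm_smul, norm_smul, hn, norm_mul, norm_star, Real.norm_eq_abs, Real.norm_eq_abs,
    abs_of_pos (inv_pos.2 (pow_pos hq 4))]
  calc _ ≤ 97500 * t * (p ^ 5)⁻¹ * p + 625 * (p ^ 4)⁻¹ * (t * 1) :=
        add_le_add (mul_le_mul_of_nonneg_right (abs_inv_pow_four_sub_le hp hq h1 h2 ht) hp.le)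
          (mul_le_mul h3 (mul_le_mul_of_nonneg_left hx1 (norm_nonneg _)) (by positivity)
            (by positivity))
    _ = 98125 * t * (p ^ 4)⁻¹ := by field_simp; ring
    _ ≤ _ := by gcongr; norm_num

lemma mul_pow_three_le {a b : ℝ} (ha : 0 ≤ a) (hb : 0 ≤ b) : a * b ^ 3 ≤ a ^ 4 + b ^ 4 := by
  rcases le_total a b with h | h
  · calc a * b ^ 3 ≤ b * b ^ 3 := by gcongr
      _ ≤ _ := by have := pow_nonneg ha 4; linarith [show b * b ^ 3 = b ^ 4 by ring]
  · calc a * b ^ 3 ≤ a * a ^ 3 := by gcongr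
      _ ≤ _ := by have := pow_nonneg hb 4; linarith [show a * a ^ 3 = a ^ 4 by ring]

lemma norm_un_mul_kern_sub_le {x : ℍ[ℝ]} {δ : ℝ} (hδ : 0 < δ) (hδ1 : δ ≤ 1) (hx : ‖x‖ ≤ 1 - δ)
    {y c : USphere} (h : ‖(y : ℍ[ℝ]) - c‖ ≤ 4 * δ) :
    ‖un y * kern x y - un c * kern x c‖ ≤ 500000 * δ *
      ((‖(y : ℍ[ℝ]) - x‖ ^ 4)⁻¹ + (‖(y : ℍ[ℝ]) - (δ - 1 : ℝ)‖ ^ 4)⁻¹) := by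
  have hxb : x ∈ ball (0 : ℍ[ℝ]) 1 := mem_ball_zero_iff.2 (by linarith)
  have hxb' : ((δ - 1 : ℝ) : ℍ[ℝ]) ∈ ball (0 : ℍ[ℝ]) 1 := mem_ball_zero_iff.2 (by
    rw [Quaternion.norm_coe, Real.norm_eq_abs, abs_lt]; constructor <;> linarith)
  have hp1 : δ ≤ ‖(y : ℍ[ℝ]) - x‖ := by linarith [one_sub_norm_le x y]
  have hq1 : δ ≤ ‖(c : ℍ[ℝ]) - x‖ := by linarith [one_sub_norm_le x c]
  have ht : |‖(y : ℍ[ℝ]) - x‖ - ‖(c : ℍ[ℝ]) - x‖| ≤ ‖(y : ℍ[ℝ]) - c‖ := by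
    have := abs_norm_sub_norm_le ((y : ℍ[ℝ]) - x) ((c : ℍ[ℝ]) - x)
    rwa [sub_sub_sub_cancel_right] at this
  obtain ⟨ht1, ht2⟩ := abs_le.1 ht
  have hk := norm_kern_sub_kern_le hxb (y := y) (c := c) (by linarith) (by linarith)
  have ha : 0 < ‖(y : ℍ[ℝ]) - (δ - 1 : ℝ)‖ := norm_pos_iff.2 (USphere.sub_ne_zero hxb' y)
  have ha1 : ‖(y : ℍ[ℝ]) - (δ - 1 : ℝ)‖ ≤ ‖1 + (y : ℍ[ℝ])‖ + δ := by
    have := norm_sub_le (1 + (y : ℍ[ℝ])) (δ : ℝ)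
    rw [Quaternion.norm_coe, Real.norm_eq_abs, abs_of_pos hδ] at this
    refine le_trans (le_of_eq (congrArg norm ?_)) this
    rw [Quaternion.coe_sub, Quaternion.coe_one]; abel
  have hu : ‖un y - un c‖ ≤ 10 * δ * ‖(y : ℍ[ℝ]) - (δ - 1 : ℝ)‖⁻¹ := by
    rw [← div_eq_mul_inv, le_div_iff₀ ha]
    have h1 := norm_one_add_mul_un_sub_le y c
    have h2 := norm_un_sub_le y c
    have h3 := mul_le_mul_of_nonneg_left ha1 (norm_nonneg (un y - un c))
    have h4 := mul_le_mul_of_nonneg_right h2 hδ.le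
    linarith
  have hp0 : 0 < ‖(y : ℍ[ℝ]) - x‖ := hδ.trans_le hp1
  have hq0 : 0 < ‖(c : ℍ[ℝ]) - x‖ := hδ.trans_le hq1
  have hq : ‖kern x c‖ ≤ 125 * (‖(y : ℍ[ℝ]) - x‖⁻¹) ^ 3 := by
    rw [norm_kern, inv_le_comm₀ (by positivity) (by positivity), mul_inv, inv_pow, inv_inv]
    have : ‖(y : ℍ[ℝ]) - x‖ ^ 3 ≤ (5 * ‖(c : ℍ[ℝ]) - x‖) ^ 3 :=
      pow_le_pow_left₀ (norm_nonneg _) (by linarith) 3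
    linarith [mul_pow 5 ‖(c : ℍ[ℝ]) - x‖ 3]
  set p := ‖(y : ℍ[ℝ]) - x‖
  set a := ‖(y : ℍ[ℝ]) - (δ - 1 : ℝ)‖
  have hp : 0 < p := hp0
  have e : un y * kern x y - un c * kern x c =
      un y * (kern x y - kern x c) + (un y - un c) * kern x c := by noncomm_ring
  rw [e]
  refine (norm_add_le _ _).trans ?_
  rw [norm_mul, norm_mul]
  calc _ ≤ 1 * (100000 * (4 * δ) * (p ^ 4)⁻¹) + (10 * δ * a⁻¹) * (125 * p⁻¹ ^ 3) := by
        refine add_le_add (mul_le_mul (norm_un_le y) (hk.trans ?_) (norm_nonneg _) zero_le_one)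
          (mul_le_mul hu hq (norm_nonneg _) (by positivity))
        gcongr
    _ = 400000 * δ * (p ^ 4)⁻¹ + 1250 * δ * (a⁻¹ * p⁻¹ ^ 3) := by ring
    _ ≤ 400000 * δ * (p ^ 4)⁻¹ + 1250 * δ * (a⁻¹ ^ 4 + p⁻¹ ^ 4) := by
        have := mul_pow_three_le (inv_pos.2 ha).le (inv_pos.2 hp).le
        gcongr
    _ ≤ _ := by
        rw [inv_pow, inv_pow]
        have h1 : 0 ≤ δ * (p ^ 4)⁻¹ := by positivity
        have h2 : 0 ≤ δ * (a ^ 4)⁻¹ := by positivity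
        linarith

lemma norm_cauchy_mul_un_le_of_avg_eq_zero (g : Grid USphere sphMeas) (hg : g.d = dF) {j : ℕ}
    {Φ : USphere → ℍ[ℝ]} (hΦ : Nice Φ) {S : ℝ} (hS : ∀ y, ‖Φ y‖ ≤ S)
    (hcj : ∀ y, Φ (cj y) = Φ y) (h0 : g.avg j Φ = 0) {x : ℍ[ℝ]} (hx : ‖x‖ ≤ 1 - g.δ j) :
    ‖cauchy (fun y => Φ y * un y) x‖ ≤ 1000000 * S := by
  have hδ : 0 < g.δ j := g.δ_pos j
  have hδ1 : g.δ j ≤ 1 := pow_le_one₀ g.θ_pos.le (by linarith [g.θ_le])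
  have hS0 : 0 ≤ S := (norm_nonneg _).trans (hS 1)
  have hxb : x ∈ ball (0 : ℍ[ℝ]) 1 := mem_ball_zero_iff.2 (by linarith)
  have hxb' : ((g.δ j - 1 : ℝ) : ℍ[ℝ]) ∈ ball (0 : ℍ[ℝ]) 1 := mem_ball_zero_iff.2 (by
    rw [Quaternion.norm_coe, Real.norm_eq_abs, abs_lt]; constructor <;> linarith)
  set A : USphere → ℍ[ℝ] := fun y => un y * kern x y with hA
  set G : USphere → ℍ[ℝ] := fun y => A y + A (cj y) with hG
  set P : USphere → ℝ := fun y => (‖(y : ℍ[ℝ]) - x‖ ^ 4)⁻¹ +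
    (‖(y : ℍ[ℝ]) - (g.δ j - 1 : ℝ)‖ ^ 4)⁻¹ with hP
  have hAn : Nice A := nice_un.mul (continuous_kern hxb).nice
  have hAn' : Nice fun y => A (cj y) := by
    obtain ⟨C, hC⟩ := hAn.2
    exact ⟨hAn.1.comp_measurable continuous_cj.measurable, C, fun y => hC _⟩
  have hGn : Nice G := hAn.add hAn'
  have hGcj : ∀ y, G (cj y) = G y := fun y => by simp only [hG, cj_cj, add_comm]
  have hP1 : Integrable (fun y : USphere => (‖(y : ℍ[ℝ]) - x‖ ^ 4)⁻¹) sphMeas :=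
    integrable_sph (continuous_inv_dist hxb 4)
  have hP2 : Integrable (fun y : USphere => (‖(y : ℍ[ℝ]) - (g.δ j - 1 : ℝ)‖ ^ 4)⁻¹) sphMeas :=
    integrable_sph (continuous_inv_dist hxb' 4)
  have hPi : Integrable P sphMeas := hP1.add hP2
  have hPi' : Integrable (fun y => P (cj y)) sphMeas :=
    integrable_sph (((continuous_inv_dist hxb 4).add (continuous_inv_dist hxb' 4)).comp continuous_cj)
  have hPle : ∫ y, P y ∂sphMeas ≤ 2 * (g.δ j)⁻¹ := by
    have h1 := poisson_norm_le hxb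
    have h2 := poisson_norm_le hxb'
    have h3 : (1 - ‖x‖)⁻¹ ≤ (g.δ j)⁻¹ := inv_anti₀ hδ (by linarith)
    have h4 : 1 - ‖((g.δ j - 1 : ℝ) : ℍ[ℝ])‖ = g.δ j := by
      rw [Quaternion.norm_coe, Real.norm_eq_abs, abs_of_nonpos (by linarith)]; ring
    rw [h4] at h2
    rw [hP, integral_add hP1 hP2]
    linarith
  have hlev : g.Lev j fun y => G (g.cen j y) := fun y y' h => congrArg G h
  have hclose : ∀ y c : USphere, ‖(y : ℍ[ℝ]) - c‖ ≤ 4 * g.δ j →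
      ‖G y - G c‖ ≤ 500000 * g.δ j * (P y + P (cj y)) := fun y c h => by
    have h1 := norm_un_mul_kern_sub_le hδ hδ1 hx h
    have h2 := norm_un_mul_kern_sub_le hδ hδ1 hx (y := cj y) (c := cj c)
      (by rwa [cj_coe, cj_coe, ← star_sub, norm_star])
    have e : G y - G c = (A y - A c) + (A (cj y) - A (cj c)) := by simp only [hG]; abel
    rw [e, mul_add]
    exact (norm_add_le _ _).trans (add_le_add h1 h2)
  have hGle : ∀ y, ‖G y - G (g.cen j y)‖ ≤ 500000 * g.δ j * (P y + P (cj y)) := fun y => by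
    have hd : dF y (g.cen j y) ≤ g.δ j := by
      rw [← hg]; exact g.diam j _ _ (g.idem j y).symm
    rcases dF_cases y (g.cen j y) with h | h
    · exact hclose _ _ (by rw [h] at hd; linarith)
    · rw [← hGcj (g.cen j y)]
      exact hclose _ _ (by rw [h] at hd; linarith)
  have e1 : cauchy (fun y => Φ y * un y) x = ∫ y, Φ y * A y ∂sphMeas := by
    simp only [cauchy, hA, mul_assoc]
  have e2 : ∫ y, Φ y * A (cj y) ∂sphMeas = ∫ y, Φ y * A y ∂sphMeas := by
    rw [← integral_cj]
    simp only [hcj, cj_cj]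
  have e3 : (2 : ℝ) • cauchy (fun y => Φ y * un y) x =
      ∫ y, Φ y * (G y - G (g.cen j y)) ∂sphMeas := by
    simp only [mul_sub]
    rw [integral_sub ((hΦ.mul hGn).integrable _) ((hΦ.mul hlev.nice).integrable _),
      g.integral_mul_lev_eq_zero hΦ h0 hlev, sub_zero]
    simp only [hG, mul_add]
    rw [integral_add ((hΦ.mul hAn).integrable _) ((hΦ.mul hAn').integrable _), e2, e1, two_smul]
  have e4 : ‖∫ y, Φ y * (G y - G (g.cen j y)) ∂sphMeas‖ ≤
      ∫ y, S * (500000 * g.δ j * (P y + P (cj y))) ∂sphMeas := by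
    refine norm_integral_le_of_norm_le (((hPi.add hPi').const_mul _).const_mul _)
      (Filter.Eventually.of_forall fun y => ?_)
    rw [norm_mul]
    exact mul_le_mul (hS y) (hGle y) (norm_nonneg _) hS0
  rw [integral_const_mul, integral_const_mul, integral_add hPi hPi', integral_cj P, ← e3, norm_smul,
    Real.norm_two] at e4
  have e5 : g.δ j * (∫ y, P y ∂sphMeas) ≤ 2 := by
    have := mul_le_mul_of_nonneg_left hPle hδ.le
    rwa [mul_left_comm, mul_inv_cancel₀ hδ.ne', mul_one] at this
  nlinarith [mul_le_mul_of_nonneg_left e5 hS0]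

lemma norm_foldS_le {f : ℍ[ℝ] → ℍ[ℝ]} {S : ℝ} (hS : ∀ z ∈ closedBall (0 : ℍ[ℝ]) 1, ‖f z‖ ≤ S)
    (y : USphere) : ‖foldS f y‖ ≤ 2 * S := by
  have h1 := hS y (mem_closedBall_zero_iff.2 y.norm_eq.le)
  have h2 := hS (star (y : ℍ[ℝ])) (mem_closedBall_zero_iff.2 (by rw [norm_star, y.norm_eq]))
  rw [foldS]
  refine (norm_add_le _ _).trans ?_
  rw [norm_mul, norm_star, y.norm_eq, mul_one]
  linarith

lemma exists_pow_near_pow_θ (g : Grid USphere sphMeas) (l : ℕ) :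
    ∃ n ≠ 0, g.δ (l + 1) ≤ (1 / 2) ^ n ∧ sqh ^ n ≤ 2 * g.θ ^ (l + 1) := by
  have h1 := g.θ_pos
  have h2 := g.θ_le
  have h3 : g.δ (l + 1) ≤ 1 / 4 := by
    calc g.δ (l + 1) ≤ g.θ ^ 2 := pow_le_pow_of_le_one h1.le (by linarith) (by omega)
      _ ≤ 1 / 4 := by nlinarith
  obtain ⟨n, hn1, hn2⟩ := exists_nat_pow_near_of_lt_one (x := g.δ (l + 1)) (y := 1 / 2)
    (g.δ_pos _) (by linarith) (by norm_num) (by norm_num)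
  refine ⟨n, ?_, hn2, ?_⟩
  · rintro rfl
    linarith
  · rw [← g.sqrt_δ, ← Real.sqrt_sq (pow_pos sqh_pos n).le, ← pow_mul, mul_comm n, pow_mul, sqh_sq]
    calc √((1 / 2) ^ n) ≤ √(2 ^ 2 * g.δ (l + 1)) := by
          apply Real.sqrt_le_sqrt
          have := g.δ_pos (l + 1)
          rw [pow_succ] at hn1
          linarith
      _ = 2 * √(g.δ (l + 1)) := by
          rw [Real.sqrt_mul (by norm_num), Real.sqrt_sq (by norm_num)]

namespace Grid
variable {g : Grid USphere sphMeas} {v : USphere → ℍ[ℝ]} {j : ℕ} {S : ℝ}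

lemma holder_V (hg : g.d = dF) (hl : g.Lev j v) (hS : ∀ y, ‖v y‖ ≤ S) (y y' : USphere) :
    ‖g.V j v y - g.V j v y'‖ ≤ 2 * (4 * g.L + 1) * g.θ⁻¹ * S * (g.θ ^ j)⁻¹ * √(dF y y') := by
  rw [← hg]; exact g.norm_V_sub_V_le hS hl y y'

lemma holS_V_mul_un (hg : g.d = dF) (ho : g.o = -1) (hl : g.Lev j v) (hS : ∀ y, ‖v y‖ ≤ S) :
    HolS (3 * (2 * (4 * g.L + 1) * g.θ⁻¹ * S * (g.θ ^ j)⁻¹)) fun y => g.V j v y * un y := by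
  have := g.L_pos
  have := g.θ_pos
  have : 0 ≤ S := (norm_nonneg _).trans (hS 1)
  refine holS_mul_un (by positivity) (holder_V hg hl hS) ?_
  rw [← ho]; exact g.V_o hl

/-- The sup-norm bound of partial sums. -/
def cP (g : Grid USphere sphMeas) : ℝ := 2 * g.L + 1 + (1 + g.Q) * (2 * g.L + 2)

lemma exists_partial_bound (hg : g.d = dF) (ho : g.o = -1) : ∃ K, 0 ≤ K ∧
    ∀ f, memK f → ∀ S, (∀ z ∈ closedBall (0 : ℍ[ℝ]) 1, ‖f z‖ ≤ S) → ∀ l, ∀ s ⊆ g.I l,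
    ∀ z ∈ closedBall (0 : ℍ[ℝ]) 1,
      ‖cext (fun y => g.V l (g.prt l s (unfold (foldS f))) y * un y) z‖ ≤ K * S := by
  have hL := g.L_pos
  have hθ := g.θ_pos
  have hθ1 := g.θ_le
  have hQ := g.Q_pos
  have hc : 0 < g.cP := by unfold cP; positivity
  set M : ℝ := (4 * g.L + 1) * g.cP with hM
  have hM0 : 0 < M := by positivity
  have hcB : 0 < cB := by unfold cB; norm_num
  refine ⟨cB * (24 * M * g.θ⁻¹) * g.θ⁻¹ + 8 * (M * 2) + 1 + 1000000 * (2 * (M + 1)), by positivity, ?_⟩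
  intro f hf S hS l s hs z hz
  rw [mem_closedBall_zero_iff] at hz
  have hS0 : 0 ≤ S := (norm_nonneg _).trans (hS 0 (by simp))
  have hψ : Nice (unfold (foldS f)) := nice_unfold hf.continuous_foldS
  have hψS : ∀ y, ‖unfold (foldS f) y‖ ≤ 2 * S := fun y =>
    (norm_unfold_le _ y).trans (norm_foldS_le hS y)
  set ψ := unfold (foldS f) with hψdef
  have hp : ∀ y, ‖g.prt l s ψ y‖ ≤ g.cP * (2 * S) := g.norm_prt_le hψ hψS hs
  have hlev := g.lev_prt l s ψ
  have hV : ∀ y, ‖g.V l (g.prt l s ψ) y‖ ≤ M * (2 * S) := fun y =>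
    (g.norm_V_le hp hlev y).trans (le_of_eq (by rw [hM]; ring))
  have hH := holS_V_mul_un hg ho hlev hp
  have hVu : ∀ y, ‖g.V l (g.prt l s ψ) y * un y‖ ≤ M * (2 * S) := fun y => by
    rw [norm_mul]
    exact (mul_le_of_le_one_right (norm_nonneg _) (norm_un_le y)).trans (hV y)
  have key : ∀ n ≠ 0, ∀ B, (‖cauchy (fun y => g.V l (g.prt l s ψ) y * un y) (rproj n z)‖ ≤ B) →
      sqh ^ n * (g.θ ^ l)⁻¹ ≤ 2 * g.θ⁻¹ →
      ‖cext (fun y => g.V l (g.prt l s ψ) y * un y) z‖ ≤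
        cB * (24 * M * g.θ⁻¹) * g.θ⁻¹ * S + B := fun n hn B hB hq => by
    have h1 := norm_cext_sub_rproj_le hH hn hz
    have h2 := norm_le_norm_sub_add (cext (fun y => g.V l (g.prt l s ψ) y * un y) z)
      (cauchy (fun y => g.V l (g.prt l s ψ) y * un y) (rproj n z))
    have e : cB * (3 * (2 * (4 * g.L + 1) * g.θ⁻¹ * (g.cP * (2 * S)) * (g.θ ^ l)⁻¹)) * sqh ^ n =
        cB * (12 * M * g.θ⁻¹) * S * (sqh ^ n * (g.θ ^ l)⁻¹) := by rw [hM]; ring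
    have h3 : cB * (12 * M * g.θ⁻¹) * S * (sqh ^ n * (g.θ ^ l)⁻¹) ≤
        cB * (12 * M * g.θ⁻¹) * S * (2 * g.θ⁻¹) := by gcongr
    have e2 : cB * (24 * M * g.θ⁻¹) * g.θ⁻¹ * S = cB * (12 * M * g.θ⁻¹) * S * (2 * g.θ⁻¹) := by ring
    rw [e2]
    linarith
  have hinv : 1 ≤ g.θ⁻¹ := (one_le_inv₀ hθ).2 (by linarith)
  have hsmall : l ≤ 1 →
      ‖cext (fun y => g.V l (g.prt l s ψ) y * un y) z‖ ≤ cB * (24 * M * g.θ⁻¹) * g.θ⁻¹ * S +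
        8 * (M * (2 * S)) := fun hl => by
    refine key 1 one_ne_zero _ ((norm_cauchy_le hVu (rproj_mem 1 z)).trans ?_) ?_
    · have h1 : ‖rproj 1 z‖ ≤ 1 / 2 := (norm_rproj_le 1 z).trans (by unfold rad; norm_num)
      have h2 : ((1 - ‖rproj 1 z‖) ^ 3)⁻¹ ≤ 8 := by
        rw [inv_le_comm₀ (pow_pos (by linarith) 3) (by norm_num)]
        calc (8 : ℝ)⁻¹ = (1 / 2) ^ 3 := by norm_num
          _ ≤ _ := pow_le_pow_left₀ (by norm_num) (by linarith) 3
      rw [mul_comm]; gcongr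
    · have h1 : (g.θ ^ l)⁻¹ ≤ g.θ⁻¹ := by
        apply inv_anti₀ hθ
        calc g.θ = g.θ ^ 1 := (pow_one _).symm
          _ ≤ _ := pow_le_pow_of_le_one hθ.le (by linarith) (by omega)
      have h2 : sqh ^ 1 ≤ 2 := by rw [pow_one]; linarith [sqh_lt]
      exact mul_le_mul h2 h1 (by positivity) (by norm_num)
  have hX : 0 ≤ M * S := by positivity
  obtain hl | ⟨m, rfl⟩ : l ≤ 1 ∨ ∃ m, l = m + 2 := by
    rcases le_or_gt l 1 with h | h
    · exact Or.inl h
    · exact Or.inr ⟨l - 2, by omega⟩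
  · refine (hsmall hl).trans ?_
    linarith
  · obtain ⟨n, hn, hn1, hn2⟩ := exists_pow_near_pow_θ g m
    have hx : ‖rproj n z‖ ≤ 1 - g.δ (m + 1) := (norm_rproj_le n z).trans (by unfold rad; linarith)
    have hxb := rproj_mem n z
    have hN1 := g.nice_V hlev
    have hfar := norm_cauchy_mul_un_le_of_avg_eq_zero g hg (j := m + 1) (hN1.sub hψ)
      (S := 2 * (M + 1) * S)
      (fun y => (norm_sub_le _ _).trans ((add_le_add (hV y) (hψS y)).trans (le_of_eq (by ring))))
      (fun y => by
        have h1 := even_of_holder (holder_V hg hlev hp) y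
        have h2 := unfold_cj (foldSym_foldS f) y
        rw [h1, hψdef, h2]) ?_ hx
    · have e1 : cauchy (fun y => g.V (m + 2) (g.prt (m + 2) s ψ) y * un y) (rproj n z) =
          cauchy (fun y => (g.V (m + 2) (g.prt (m + 2) s ψ) y - ψ y) * un y) (rproj n z) +
            f (rproj n z) := by
        simp only [sub_mul]
        rw [Nice.cauchy_sub (hN1.mul nice_un) (hψ.mul nice_un) hxb, hf.eq_cauchy hxb]
        simp only [hψdef, unfold_mul_un (foldSym_foldS f)]
        exact (sub_add_cancel _ _).symm
      have h1 := hS _ (ball_subset_closedBall hxb)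
      refine (key n hn (1000000 * (2 * (M + 1) * S) + S) ?_ ?_).trans ?_
      · rw [e1]
        exact (norm_add_le _ _).trans (add_le_add hfar h1)
      · calc sqh ^ n * (g.θ ^ (m + 2))⁻¹ ≤ 2 * g.θ ^ (m + 1) * (g.θ ^ (m + 2))⁻¹ := by gcongr
          _ = 2 * g.θ⁻¹ := by field_simp; ring
      · linarith
    · funext y
      rw [g.avg_sub hN1 hψ, ← g.avg_avg_succ hN1, g.avg_V hlev, g.avg_prt hs]
      exact sub_self _

end Grid

section Enumeration
variable {T M : Type*} [AddCommMonoid M]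

lemma exists_bijOn_range [Nonempty T] (s : Finset T) :
    ∃ e : ℕ → T, Set.BijOn e (Finset.range s.card) s := by
  classical
  refine ⟨fun j => if h : j < s.card then s.equivFin.symm ⟨j, h⟩ else Classical.arbitrary T,
    fun j hj => ?_, fun j hj j' hj' h => ?_, fun κ hκ => ?_⟩
  · have hj : j < s.card := Finset.mem_range.1 hj
    simp only [dif_pos hj]
    exact (s.equivFin.symm ⟨j, hj⟩).2
  · have hj : j < s.card := Finset.mem_range.1 hj
    have hj' : j' < s.card := Finset.mem_range.1 hj'
    simp only [dif_pos hj, dif_pos hj'] at h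
    simpa using s.equivFin.symm.injective (Subtype.ext h)
  · refine ⟨s.equivFin ⟨κ, hκ⟩, Finset.mem_coe.2 (Finset.mem_range.2 (s.equivFin ⟨κ, hκ⟩).2), ?_⟩
    simp

/-- The number of indices below a given level. -/
def cnt (I : ℕ → Finset T) (l : ℕ) : ℕ := ∑ i ∈ Finset.range l, (I i).card

lemma cnt_succ (I : ℕ → Finset T) (l : ℕ) : cnt I (l + 1) = cnt I l + (I l).card :=
  Finset.sum_range_succ _ _

lemma cnt_mono (I : ℕ → Finset T) : Monotone (cnt I) :=
  monotone_nat_of_le_succ fun l => by rw [cnt_succ]; omega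

lemma exists_lt_cnt {I : ℕ → Finset T} (h : ∀ l, ∃ i ≥ l, (I i).Nonempty) (m : ℕ) :
    ∃ l, m < cnt I (l + 1) := by
  have key : ∀ m, ∃ l, m ≤ cnt I l := fun m => by
    induction m with
    | zero => exact ⟨0, Nat.zero_le _⟩
    | succ m ih =>
      obtain ⟨l, hl⟩ := ih
      obtain ⟨i, hi, hne⟩ := h l
      refine ⟨i + 1, ?_⟩
      rw [cnt_succ]
      have := cnt_mono I hi
      have := hne.card_pos
      omega
  obtain ⟨l, hl⟩ := key (m + 1)
  exact ⟨l, lt_of_lt_of_le hl (cnt_mono I l.le_succ)⟩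

/-- An enumeration of a sequence of finite sets, one after the other. -/
lemma exists_enumeration [Nonempty T] {I : ℕ → Finset T} (h : ∀ l, ∃ i ≥ l, (I i).Nonempty) :
    ∃ en : ℕ → ℕ × T, (∀ m, (en m).2 ∈ I (en m).1) ∧ Function.Injective en ∧
      (∀ n, ∃ l, ∃ s ⊆ I l, ∀ F : ℕ × T → M, ∑ m ∈ Finset.range n, F (en m) =
        ∑ i ∈ Finset.range l, ∑ κ ∈ I i, F (i, κ) + ∑ κ ∈ s, F (l, κ)) ∧
      ∀ l, ∃ n, ∀ F : ℕ × T → M,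
        ∑ m ∈ Finset.range n, F (en m) = ∑ i ∈ Finset.range l, ∑ κ ∈ I i, F (i, κ) := by
  classical
  choose e he using fun l => exists_bijOn_range (I l)
  set lv : ℕ → ℕ := fun m => Nat.find (exists_lt_cnt h m) with hlv
  set en : ℕ → ℕ × T := fun m => (lv m, e (lv m) (m - cnt I (lv m))) with hen
  have hlv_eq : ∀ l j, j < (I l).card → lv (cnt I l + j) = l := fun l j hj => by
    refine (Nat.find_eq_iff _).2 ⟨by rw [cnt_succ]; omega, fun n hn => ?_⟩
    have := cnt_mono I (show n + 1 ≤ l from hn)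
    omega
  have hen_eq : ∀ l j, j < (I l).card → en (cnt I l + j) = (l, e l j) := fun l j hj => by
    simp only [hen, hlv_eq l j hj, Nat.add_sub_cancel_left]
  have hdec : ∀ m, ∃ l j, j < (I l).card ∧ m = cnt I l + j := fun m => by
    have h1 : m < cnt I (lv m + 1) := Nat.find_spec (exists_lt_cnt h m)
    have h2 : cnt I (lv m) ≤ m := by
      rcases Nat.eq_zero_or_pos (lv m) with h0 | h0
      · rw [h0]; exact Nat.zero_le _
      · have := Nat.find_min (exists_lt_cnt h m) (m := lv m - 1) (by simp only [hlv] at h0 ⊢; omega)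
        rw [Nat.sub_add_cancel h0] at this
        omega
    rw [cnt_succ] at h1
    exact ⟨lv m, m - cnt I (lv m), by omega, by omega⟩
  have hfull : ∀ l (F : ℕ × T → M),
      ∑ m ∈ Finset.range (cnt I l), F (en m) = ∑ i ∈ Finset.range l, ∑ κ ∈ I i, F (i, κ) := by
    intro l F
    induction l with
    | zero => simp [cnt]
    | succ l ih =>
      rw [cnt_succ, Finset.sum_range_add, ih, Finset.sum_range_succ]
      congr 1
      rw [Finset.sum_congr rfl fun j hj => by rw [hen_eq l j (Finset.mem_range.1 hj)]]
      refine Finset.sum_nbij (e l) (fun j hj => (he l).mapsTo (Finset.mem_coe.2 hj)) (he l).injOn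
        (he l).surjOn fun j hj => rfl
  refine ⟨en, fun m => ?_, fun m m' hm => ?_, fun n => ?_, fun l => ⟨cnt I l, hfull l⟩⟩
  · obtain ⟨l, j, hj, rfl⟩ := hdec m
    rw [hen_eq l j hj]
    exact (he l).mapsTo (Finset.mem_coe.2 (Finset.mem_range.2 hj))
  · obtain ⟨l, j, hj, rfl⟩ := hdec m
    obtain ⟨l', j', hj', rfl⟩ := hdec m'
    rw [hen_eq l j hj, hen_eq l' j' hj'] at hm
    obtain ⟨rfl, hm2⟩ := Prod.mk.inj hm
    rw [(he l).injOn (Finset.mem_coe.2 (Finset.mem_range.2 hj))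
      (Finset.mem_coe.2 (Finset.mem_range.2 hj')) hm2]
  · obtain ⟨l, j, hj, rfl⟩ := hdec n
    have hsub : Finset.range j ⊆ Finset.range (I l).card := Finset.range_subset_range.2 hj.le
    refine ⟨l, (Finset.range j).image (e l), fun κ hκ => ?_, fun F => ?_⟩
    · obtain ⟨i, hi, rfl⟩ := Finset.mem_image.1 hκ
      exact (he l).mapsTo (Finset.mem_coe.2 (hsub hi))
    · have himg : ∑ κ ∈ (Finset.range j).image (e l), F (l, κ) = ∑ i ∈ Finset.range j, F (l, e l i) :=
        Finset.sum_image fun i hi i' hi' => (he l).injOn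
          (Finset.mem_coe.2 (hsub hi)) (Finset.mem_coe.2 (hsub hi'))
      rw [Finset.sum_range_add, hfull, himg]
      congr 1
      exact Finset.sum_congr rfl fun i hi => by
        rw [hen_eq l i ((Finset.mem_range.1 hi).trans hj)]

end Enumeration

section Abstract

lemma memK.const_mul {f : ℍ[ℝ] → ℍ[ℝ]} (hf : memK f) (a : ℍ[ℝ]) : memK fun z => a * f z := by
  refine ⟨continuousOn_const.mul hf.1, contDiffOn_const.mul hf.2.1, fun z hz => ?_⟩
  have h2 := hf.2.2 z hz
  unfold Dirac at h2 ⊢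
  rw [((hf.2.1.hasFDerivAt_ball hz).const_mul a).fderiv]
  calc _ = a * ∑ j, fderiv ℝ f z (qe j) * qe j := by
        rw [Finset.mul_sum]
        exact Finset.sum_congr rfl fun j _ => mul_assoc _ _ _
    _ = 0 := by rw [h2, mul_zero]

lemma memK_sum {w : ℕ → ℍ[ℝ] → ℍ[ℝ]} (hw : ∀ m, memK (w m)) (a : ℕ → ℍ[ℝ]) (n : ℕ) :
    memK fun z => ∑ m ∈ Finset.range n, a m * w m z := by
  induction n with
  | zero =>
    convert (hw 0).const_mul 0 using 2
    simp
  | succ n ih =>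
    convert ih.sub ((hw n).const_mul (-a n)) using 2
    rw [Finset.sum_range_succ, neg_mul, sub_neg_eq_add]

/-- A biorthogonal system with bounded coefficients, uniformly bounded partial sums and dense span
is a Schauder basis. -/
theorem existsUnique_expansion {w : ℕ → ℍ[ℝ] → ℍ[ℝ]} {c : ℕ → (ℍ[ℝ] → ℍ[ℝ]) → ℍ[ℝ]} {C K : ℝ}
    (hw : ∀ m, memK (w m))
    (hsub : ∀ m f h, memK f → memK h → c m (fun z => f z - h z) = c m f - c m h)
    (hmul : ∀ m a f, memK f → c m (fun z => a * f z) = a * c m f)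
    (hcw : ∀ m k, c m (w k) = if m = k then 1 else 0)
    (hC : ∀ m f S, memK f → (∀ z ∈ closedBall (0 : ℍ[ℝ]) 1, ‖f z‖ ≤ S) → ‖c m f‖ ≤ C * S)
    (hK0 : 0 ≤ K) (hK : ∀ n f S, memK f → (∀ z ∈ closedBall (0 : ℍ[ℝ]) 1, ‖f z‖ ≤ S) →
      ∀ z ∈ closedBall (0 : ℍ[ℝ]) 1, ‖∑ m ∈ Finset.range n, c m f * w m z‖ ≤ K * S)
    (hdense : ∀ f, memK f → ∀ ε, 0 < ε → ∃ n, ∃ a : ℕ → ℍ[ℝ], ∀ z ∈ closedBall (0 : ℍ[ℝ]) 1,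
      ‖f z - ∑ m ∈ Finset.range n, a m * w m z‖ ≤ ε)
    (h : ℍ[ℝ] → ℍ[ℝ]) (hh : memK h) :
    ∃! a : ℕ → ℍ[ℝ], ∀ ε : ℝ, 0 < ε → ∃ N : ℕ, ∀ n ≥ N, ∀ z ∈ closedBall (0 : ℍ[ℝ]) 1,
      ‖h z - ∑ m ∈ Finset.range n, a m * w m z‖ ≤ ε := by
  have hsum : ∀ (a : ℕ → ℍ[ℝ]) n m, c m (fun z => ∑ k ∈ Finset.range n, a k * w k z) =
      if m < n then a m else 0 := fun a n m => by
    induction n with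
    | zero =>
      have := hsub m (w 0) (w 0) (hw 0) (hw 0)
      simpa using this
    | succ n ih =>
      have e : (fun z => ∑ k ∈ Finset.range (n + 1), a k * w k z) =
          fun z => ∑ k ∈ Finset.range n, a k * w k z - (-a n) * w n z := by
        funext z
        rw [Finset.sum_range_succ, neg_mul, sub_neg_eq_add]
      rw [e, hsub _ _ _ (memK_sum hw a n) ((hw n).const_mul _), hmul _ _ _ (hw n), hcw, ih]
      rcases lt_trichotomy m n with hm | rfl | hm
      · rw [if_pos hm, if_neg hm.ne, if_pos (by omega), mul_zero, sub_zero]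
      · rw [if_neg (lt_irrefl _), if_pos rfl, if_pos (by omega), mul_one, zero_sub, neg_neg]
      · rw [if_neg (by omega), if_neg hm.ne', if_neg (by omega), mul_zero, sub_zero]
  refine ⟨fun m => c m h, fun ε hε => ?_, fun a ha => funext fun m => ?_⟩
  · obtain ⟨N, a, hN⟩ := hdense h hh (ε / (K + 1)) (by positivity)
    refine ⟨N, fun n hn z hz => ?_⟩
    have hd : memK fun z => h z - ∑ m ∈ Finset.range N, a m * w m z := hh.sub (memK_sum hw a N)
    have h1 := hK n _ _ hd hN z hz
    have h2 : ∀ m, c m (fun z => h z - ∑ m ∈ Finset.range N, a m * w m z) =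
        c m h - if m < N then a m else 0 := fun m => by
      rw [hsub _ _ _ hh (memK_sum hw a N), hsum]
    have h3 : ∑ m ∈ Finset.range n, (if m < N then a m else 0) * w m z =
        ∑ m ∈ Finset.range N, a m * w m z := by
      rw [← Finset.sum_subset (Finset.range_subset_range.2 hn) fun m _ hm => by
        rw [if_neg fun h => hm (Finset.mem_range.2 h), zero_mul]]
      exact Finset.sum_congr rfl fun m hm => by rw [if_pos (Finset.mem_range.1 hm)]
    simp only [h2, sub_mul, Finset.sum_sub_distrib, h3] at h1
    have h4 := hN z hz
    have e : h z - ∑ m ∈ Finset.range n, c m h * w m z =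
        (h z - ∑ m ∈ Finset.range N, a m * w m z) -
          (∑ m ∈ Finset.range n, c m h * w m z - ∑ m ∈ Finset.range N, a m * w m z) := by abel
    rw [e]
    refine (norm_sub_le _ _).trans ((add_le_add h4 h1).trans (le_of_eq ?_))
    field_simp
    ring
  · have hz : ∀ ε, 0 < ε → ‖a m - c m h‖ ≤ C * ε := fun ε hε => by
      obtain ⟨N, hN⟩ := ha ε hε
      have h1 := hC m _ _ (hh.sub (memK_sum hw a (max N (m + 1)))) (hN _ (le_max_left _ _))
      rw [hsub _ _ _ hh (memK_sum hw a _), hsum, if_pos (by omega), norm_sub_rev] at h1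
      exact h1
    have h0 : ‖a m - c m h‖ ≤ 0 := by
      have hlim : Filter.Tendsto (fun ε : ℝ => C * ε) (nhdsWithin 0 (Set.Ioi 0)) (nhds (C * 0)) :=
        (Filter.tendsto_id.const_mul C).mono_left nhdsWithin_le_nhds
      rw [mul_zero] at hlim
      exact ge_of_tendsto hlim (eventually_nhdsWithin_of_forall hz)
    exact sub_eq_zero.1 (norm_le_zero_iff.1 h0)

end Abstract

lemma infinite_uSphere : Infinite USphere := by
  have h1 : IsPreconnected (sphere (0 : ℍ[ℝ]) 1) :=
    isPreconnected_sphere (by rw [Quaternion.rank_eq_four]; norm_num) 0 1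
  refine (h1.infinite_of_nontrivial ⟨1, by simp, -1, by simp, fun h => ?_⟩).to_subtype
  have := congrArg (fun q : ℍ[ℝ] => q.re) h
  norm_num at this

lemma exists_dF_ne_zero (s : Finset USphere) : ∃ y, ∀ z ∈ s, dF y z ≠ 0 := by
  classical
  have := infinite_uSphere
  obtain ⟨y, hy⟩ := Infinite.exists_notMem_finset (s ∪ s.image cj)
  rw [Finset.mem_union, not_or] at hy
  refine ⟨y, fun z hz h0 => ?_⟩
  rcases dF_cases y z with h | h
  · rw [h0, eq_comm, div_eq_zero_iff, norm_eq_zero, sub_eq_zero] at h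
    obtain rfl : y = z := Subtype.ext (h.resolve_right four_ne_zero)
    exact hy.1 hz
  · rw [h0, eq_comm, div_eq_zero_iff, norm_eq_zero, sub_eq_zero] at h
    obtain rfl : y = cj z := Subtype.ext (h.resolve_right four_ne_zero)
    exact hy.2 (Finset.mem_image_of_mem _ hz)

lemma norm_le_of_ball {f : ℍ[ℝ] → ℍ[ℝ]} (hf : ContinuousOn f (closedBall 0 1)) {S : ℝ}
    (h : ∀ z ∈ ball (0 : ℍ[ℝ]) 1, ‖f z‖ ≤ S) : ∀ z ∈ closedBall (0 : ℍ[ℝ]) 1, ‖f z‖ ≤ S := by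
  have e := closure_ball (0 : ℍ[ℝ]) one_ne_zero
  intro z hz
  rw [← e] at hf hz
  exact le_on_closure (f := fun z => ‖f z‖) (g := fun _ => S) h hf.norm continuousOn_const hz

lemma memK.unfold_nice {f : ℍ[ℝ] → ℍ[ℝ]} (hf : memK f) : Nice (unfold (foldS f)) :=
  nice_unfold hf.continuous_foldS

namespace Grid
variable {g : Grid USphere sphMeas} {f h : ℍ[ℝ] → ℍ[ℝ]} {ψ φ : USphere → ℍ[ℝ]} {l j : ℕ}
  {κ κ' : USphere}

lemma D_mul (hψ : Nice ψ) (a : ℍ[ℝ]) (l : ℕ) (y : USphere) :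
    g.D l (fun y => a * ψ y) y = a * g.D l ψ y := by
  cases l with
  | zero => exact g.avg_const_mul a hψ y
  | succ l =>
    have e : g.avg l (fun y => a * ψ y) = fun y => a * g.avg l ψ y :=
      funext fun y => g.avg_const_mul a hψ y
    simp only [D]
    rw [g.avg_const_mul a hψ, e, g.step_mul a (g.lev_avg l ψ), mul_sub]

lemma D_sub (hψ : Nice ψ) (hφ : Nice φ) (l : ℕ) (y : USphere) :
    g.D l (fun y => ψ y - φ y) y = g.D l ψ y - g.D l φ y := by
  cases l with
  | zero => exact g.avg_sub hψ hφ y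
  | succ l =>
    have e : g.avg l (fun y => ψ y - φ y) = fun y => g.avg l ψ y + (-1) * g.avg l φ y :=
      funext fun y => by rw [g.avg_sub hψ hφ, sub_eq_add_neg, neg_one_mul]
    simp only [D]
    rw [g.avg_sub hψ hφ, e, g.step_add (g.lev_avg l ψ) ((g.lev_avg l φ).mul _),
      g.step_mul _ (g.lev_avg l φ)]
    simp only [neg_one_mul]
    abel

/-- The coefficient functionals of the basis. -/
def coeff (g : Grid USphere sphMeas) (l : ℕ) (κ : USphere) (f : ℍ[ℝ] → ℍ[ℝ]) : ℍ[ℝ] :=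
  g.D l (unfold (foldS f)) κ

lemma coeff_sub (hf : memK f) (hh : memK h) :
    g.coeff l κ (fun z => f z - h z) = g.coeff l κ f - g.coeff l κ h := by
  have e : unfold (foldS fun z => f z - h z) =
      fun y => unfold (foldS f) y - unfold (foldS h) y := funext fun y => by
    simp only [unfold, foldS]; noncomm_ring
  rw [coeff, e, D_sub hf.unfold_nice hh.unfold_nice]; rfl

lemma coeff_mul (hf : memK f) (a : ℍ[ℝ]) :
    g.coeff l κ (fun z => a * f z) = a * g.coeff l κ f := by
  have e : unfold (foldS fun z => a * f z) = fun y => a * unfold (foldS f) y := funext fun y => by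
    simp only [unfold, foldS]; noncomm_ring
  rw [coeff, e, D_mul hf.unfold_nice]; rfl

lemma norm_coeff_le (hf : memK f) {S : ℝ} (hS : ∀ z ∈ closedBall (0 : ℍ[ℝ]) 1, ‖f z‖ ≤ S) :
    ‖g.coeff l κ f‖ ≤ (2 * g.L + 2) * 2 * S := by
  rw [mul_assoc]
  exact g.norm_D_le hf.unfold_nice
    (fun y => (norm_unfold_le _ y).trans (norm_foldS_le hS y)) l κ

/-- The basis functions. -/
def bas (g : Grid USphere sphMeas) (l : ℕ) (κ : USphere) : ℍ[ℝ] → ℍ[ℝ] :=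
  cext fun y => g.W ℍ[ℝ] l κ y * un y

lemma lev_W (g : Grid USphere sphMeas) (l : ℕ) (κ : USphere) :
    g.Lev l fun y => g.e l κ y • (1 : ℍ[ℝ]) := (g.lev_e l κ).smul_const _

lemma exists_holS_W (hg : g.d = dF) (ho : g.o = -1) (l : ℕ) (κ : USphere) :
    ∃ A, HolS A fun y => g.W ℍ[ℝ] l κ y * un y := by
  obtain ⟨S, hS⟩ := (g.lev_W l κ).nice.2
  exact ⟨_, holS_V_mul_un hg ho (g.lev_W l κ) hS⟩

lemma memK_bas (hg : g.d = dF) (ho : g.o = -1) (l : ℕ) (κ : USphere) : memK (g.bas l κ) := by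
  obtain ⟨A, hA⟩ := exists_holS_W hg ho l κ
  exact memK_cext hA

lemma unfold_foldS_bas (hg : g.d = dF) (ho : g.o = -1) (l : ℕ) (κ : USphere) :
    unfold (foldS (g.bas l κ)) = g.W ℍ[ℝ] l κ := funext fun y => by
  obtain ⟨A, hA⟩ := exists_holS_W hg ho l κ
  obtain ⟨S, hS⟩ := (g.lev_W l κ).nice.2
  have hs := foldSym_mul_un (even_of_holder (holder_V hg (g.lev_W l κ) hS))
  have e : foldS (g.bas l κ) y = g.W ℍ[ℝ] l κ y * un y := cext_fold hA hs y
  by_cases hy : 1 + (y : ℍ[ℝ]) = 0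
  · obtain rfl : y = -1 := Subtype.ext <| by
      rw [coe_neg_sphere, USphere.coe_one, eq_neg_of_add_eq_zero_right hy]
    rw [unfold_neg_one, ← ho]
    exact (g.V_o (g.lev_W l κ)).symm
  · have h1 : un y * star (un y) = 1 := by
      rw [Quaternion.self_mul_star, Quaternion.normSq_eq_norm_mul_self, norm_un hy]; simp
    rw [unfold, e, mul_assoc, h1, mul_one]

open Classical in
lemma coeff_bas (hg : g.d = dF) (ho : g.o = -1) (hκ : κ ∈ g.I l) (hk : κ' ∈ g.I j) :
    g.coeff j κ' (g.bas l κ) = if j = l ∧ κ' = κ then 1 else 0 := by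
  rw [coeff, unfold_foldS_bas hg ho, g.D_W hκ hk]

/-- The expansion of the regularised partial averages on the open ball. -/
lemma cauchy_V_prt (hψ : Nice ψ) (l : ℕ) (s : Finset USphere) {z : ℍ[ℝ]}
    (hz : z ∈ ball (0 : ℍ[ℝ]) 1) :
    cauchy (fun y => g.V l (g.prt l s ψ) y * un y) z =
      ∑ i ∈ Finset.range l, ∑ κ ∈ g.I i, g.D i ψ κ * g.bas i κ z +
        ∑ κ ∈ s, g.D l ψ κ * g.bas l κ z := by
  have hW : ∀ i κ, Nice fun y => g.W ℍ[ℝ] i κ y * un y := fun i κ => (g.nice_W i κ).mul nice_un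
  have hW' : ∀ i κ, Nice fun y => g.D i ψ κ * (g.W ℍ[ℝ] i κ y * un y) :=
    fun i κ => (hW i κ).const_mul _
  have hb : ∀ i κ, cauchy (fun y => g.D i ψ κ * (g.W ℍ[ℝ] i κ y * un y)) z =
      g.D i ψ κ * g.bas i κ z := fun i κ => by
    rw [(hW i κ).cauchy_const_mul _ hz, bas, cext_eq hz]
  simp only [g.V_prt hψ, add_mul, Finset.sum_mul, mul_assoc]
  rw [Nice.cauchy_add (Nice.sum _ fun i _ => Nice.sum _ fun κ _ => hW' i κ)
    (Nice.sum _ fun κ _ => hW' l κ) hz,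
    cauchy_sum _ (fun i _ => Nice.sum _ fun κ _ => hW' i κ) hz, cauchy_sum _ (fun κ _ => hW' l κ) hz]
  simp only [hb]
  congr 1
  refine Finset.sum_congr rfl fun i _ => ?_
  rw [cauchy_sum _ (fun κ _ => hW' i κ) hz]
  simp only [hb]

lemma exists_avg_close (hg : g.d = dF) (ho : g.o = -1) (hf : memK f) {ε : ℝ} (hε : 0 < ε) :
    ∃ ψ, Nice ψ ∧ ∃ l, ∀ z ∈ ball (0 : ℍ[ℝ]) 1,
      ‖f z - cauchy (fun y => g.V l (g.avg l ψ) y * un y) z‖ ≤ ε := by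
  obtain ⟨r, hr, hr', hc⟩ := hf.exists_dil_close (half_pos hε)
  obtain ⟨L, hL, hLip⟩ := hf.exists_lipschitz_dil hr hr'
  have hfr := hf.dil hr hr'.le
  have hsym := foldSym_foldS fun z => f (r • z)
  set ψ := unfold (foldS fun z => f (r • z)) with hψdef
  have hψ : Nice ψ := hfr.unfold_nice
  have hψL : ∀ y y', ‖ψ y - ψ y'‖ ≤ 12 * L * g.d y y' := fun y y' => by
    rw [hg]; exact norm_unfold_sub_le hL hsym hLip y y'
  have hψo : ψ g.o = 0 := by rw [ho]; exact unfold_neg_one _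
  have hL0 : 0 ≤ 12 * L := by positivity
  obtain ⟨K, hK, hKV⟩ := g.exists_holder_V_avg hψ hψL hL0 hψo
  have hV := g.norm_V_avg_sub_le hψ hψL hL0 hψo
  have hlev := fun l => g.lev_avg l ψ
  have hH : ∀ l, HolS (3 * (K + 12 * L)) fun y => (g.V l (g.avg l ψ) y - ψ y) * un y := fun l => by
    refine holS_mul_un (ψ := fun y => g.V l (g.avg l ψ) y - ψ y) (by positivity) (fun y y' => ?_) ?_
    · have h1 : g.d y y' ≤ √(g.d y y') :=
        Real.le_sqrt_of_sq_le (by nlinarith [g.d_nonneg y y', g.d_le_one y y'])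
      have h2 := hKV l y y'
      have h3 := (hψL y y').trans (mul_le_mul_of_nonneg_left h1 hL0)
      rw [← hg, sub_sub_sub_comm, add_mul]
      exact (norm_sub_le _ _).trans (add_le_add h2 h3)
    · simp only [← ho, hψo, g.V_o (hlev l), sub_zero]
  have hcB : 0 ≤ cB := by norm_num [cB]
  have hLp := g.L_pos
  obtain ⟨n, hn0, hn⟩ : ∃ n ≠ 0, cB * (3 * (K + 12 * L)) * sqh ^ n ≤ ε / 4 := by
    have h1 := tendsto_sqh_pow.const_mul (cB * (3 * (K + 12 * L)))
    rw [mul_zero] at h1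
    obtain ⟨n, h2, h3⟩ := ((h1.eventually_le_const (by positivity : 0 < ε / 4)).and
      (Filter.eventually_ne_atTop 0)).exists
    exact ⟨n, h3, h2⟩
  have hrad : 0 < 1 - rad n := by unfold rad; rw [sub_sub_cancel]; positivity
  obtain ⟨l, hl⟩ : ∃ l, (12 * g.L + 1) * (12 * L) * g.δ l * ((1 - rad n) ^ 3)⁻¹ ≤ ε / 4 := by
    have h1 := (g.tendsto_pow_θ ((12 * g.L + 1) * (12 * L) * ((1 - rad n) ^ 3)⁻¹)).comp
      (Filter.tendsto_id.const_mul_atTop' two_pos : Filter.Tendsto (fun l : ℕ => 2 * l) _ _)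
    obtain ⟨l, h2⟩ := (h1.eventually_le_const (by positivity : 0 < ε / 4)).exists
    refine ⟨l, le_trans (le_of_eq ?_) h2⟩
    simp only [Function.comp, δ]
    ring
  refine ⟨ψ, hψ, l, fun z hz => ?_⟩
  have hz1 := (mem_ball_zero_iff.1 hz).le
  have hx := rproj_mem n z
  set v := fun y => (g.V l (g.avg l ψ) y - ψ y) * un y with hv
  have hvb : ∀ y, ‖v y‖ ≤ (12 * g.L + 1) * (12 * L) * g.δ l := fun y => by
    rw [hv, norm_mul]
    exact (mul_le_of_le_one_right (norm_nonneg _) (norm_un_le y)).trans (hV l y)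
  have h1 := norm_cext_sub_rproj_le (hH l) hn0 hz1
  have h2 := norm_cauchy_le hvb hx
  have h3 : ((1 - ‖rproj n z‖) ^ 3)⁻¹ ≤ ((1 - rad n) ^ 3)⁻¹ := by
    have := norm_rproj_le n z
    gcongr
  have h4 : ‖cauchy v (rproj n z)‖ ≤ ε / 4 := by
    refine h2.trans ((mul_le_mul_of_nonneg_left h3 ?_).trans hl)
    exact (norm_nonneg _).trans (hvb 1)
  have h5 : ‖cext v z‖ ≤ ε / 2 := by
    have := norm_le_norm_sub_add (cext v z) (cauchy v (rproj n z))
    have h6 : ‖cext v z - cauchy v (rproj n z)‖ ≤ ε / 4 := h1.trans hn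
    linarith
  have h7 : cext v z = cauchy (fun y => g.V l (g.avg l ψ) y * un y) z - f (r • z) := by
    rw [cext_eq hz, hv]
    simp only [sub_mul]
    rw [Nice.cauchy_sub ((g.nice_V (hlev l)).mul nice_un) (hψ.mul nice_un) hz, hfr.eq_cauchy hz]
    simp only [hψdef, unfold_mul_un hsym]
  have h8 := hc z (ball_subset_closedBall hz)
  rw [h7] at h5
  have e : f z - cauchy (fun y => g.V l (g.avg l ψ) y * un y) z = -((f (r • z) - f z) +
      (cauchy (fun y => g.V l (g.avg l ψ) y * un y) z - f (r • z))) := by abel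
  rw [e, norm_neg]
  exact (norm_add_le _ _).trans (by linarith)

end Grid

end

/-- The left ℍ-module `K(B, ℍ)` with the supremum norm has a Schauder basis over the
quaternion skew field: a sequence `w` in `K(B, ℍ)` such that every `h ∈ K(B, ℍ)` has a
unique sequence of quaternion coefficients `a` with
`‖h − ∑_{m<N} aₘ·wₘ‖_{C(B̄)} → 0` as `N → ∞`. -/
theorem memK_has_schauder_basis :
    ∃ w : ℕ → (ℍ[ℝ] → ℍ[ℝ]), (∀ m, memK (w m)) ∧
      ∀ h : ℍ[ℝ] → ℍ[ℝ], memK h →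
        ∃! a : ℕ → ℍ[ℝ], ∀ ε : ℝ, 0 < ε → ∃ N : ℕ, ∀ n ≥ N,
          ∀ z ∈ closedBall (0 : ℍ[ℝ]) 1,
            ‖h z - ∑ m ∈ Finset.range n, a m * w m z‖ ≤ ε := by
  classical
  obtain ⟨g, hg, ho⟩ := exists_grid
  have hT : ∀ s : Finset USphere, ∃ y, ∀ z ∈ s, g.d y z ≠ 0 := by rw [hg]; exact exists_dF_ne_zero
  obtain ⟨en, hen, hinj, hpart, hfull⟩ :=
    exists_enumeration (M := ℍ[ℝ]) (g.exists_I_nonempty hT)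
  obtain ⟨K, hK0, hK⟩ := Grid.exists_partial_bound hg ho
  set w : ℕ → ℍ[ℝ] → ℍ[ℝ] := fun m => g.bas (en m).1 (en m).2 with hw
  set c : ℕ → (ℍ[ℝ] → ℍ[ℝ]) → ℍ[ℝ] := fun m => g.coeff (en m).1 (en m).2 with hc
  have hwK : ∀ m, memK (w m) := fun m => Grid.memK_bas hg ho _ _
  refine ⟨w, hwK, existsUnique_expansion (c := c) hwK (fun m f h hf hh => Grid.coeff_sub hf hh)
    (fun m a f hf => Grid.coeff_mul hf a) (fun m k => ?_)
    (fun m f S hf hS => Grid.norm_coeff_le hf hS) hK0 (fun n f S hf hS => ?_) fun f hf ε hε => ?_⟩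
  · rw [hc, hw]
    refine (Grid.coeff_bas hg ho (hen k) (hen m)).trans ?_
    simp only [← Prod.ext_iff, hinj.eq_iff]
  · refine norm_le_of_ball (memK_sum hwK _ n).1 fun z hz => ?_
    obtain ⟨l, s, hs, hF⟩ := hpart n
    have h1 := hK f hf S hS l s hs z (ball_subset_closedBall hz)
    rw [cext_eq hz, Grid.cauchy_V_prt hf.unfold_nice l s hz] at h1
    rw [hF fun p => g.coeff p.1 p.2 f * g.bas p.1 p.2 z]
    exact h1
  · obtain ⟨ψ, hψ, l, hl⟩ := Grid.exists_avg_close hg ho hf hε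
    obtain ⟨n, hn⟩ := hfull (l + 1)
    refine ⟨n, fun m => g.D (en m).1 ψ (en m).2,
      norm_le_of_ball (hf.sub (memK_sum hwK _ n)).1 fun z hz => ?_⟩
    have h1 := hl z hz
    rw [← g.prt_full hψ, Grid.cauchy_V_prt hψ l _ hz, ← Finset.sum_range_succ
      (fun i => ∑ κ ∈ g.I i, g.D i ψ κ * g.bas i κ z),
      ← hn fun p => g.D p.1 ψ p.2 * g.bas p.1 p.2 z] at h1
    exact h1
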